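/- For every ε > 0 there exists a constant A > 0 such that for all real X ≥ 2, the series ∑_{n=1}^∞ P_4(n)² e^{−n/X} converges and |∑_{n=1}^∞ P_4(n)² e^{−n/X} − C_4 Γ(3) X³ − C_4' Γ(5/2) X^{5/2}| ≤ A X^{2+ε}. -/

import Mathlib

open scoped Real

/-- `rk k m` = number of ways to write `m` as a sum of `k` integer squares. -/
noncomputable def rk (k m : ℕ) : ℕ :=
  Nat.card {v : Fin k → ℤ // (∑ i, (v i) ^ 2) = (m : ℤ)}

/-- `Sk k t` = number of lattice points of `ℤ^k` in the closed ball of radius `√t`. -/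
noncomputable def Sk (k : ℕ) (t : ℝ) : ℕ :=
  Nat.card {v : Fin k → ℤ // (∑ i, ((v i : ℝ)) ^ 2) ≤ t}

/-- `Vk k` = volume of the unit ball in `ℝ^k`. -/
noncomputable def Vk (k : ℕ) : ℝ :=
  Real.pi ^ ((k : ℝ) / 2) / Real.Gamma ((k : ℝ) / 2 + 1)

/-- `Pk k t` = lattice point discrepancy of the `k`-dimensional ball of radius `√t`. -/
noncomputable def Pk (k : ℕ) (t : ℝ) : ℝ :=
  (Sk k t : ℝ) - Vk k * t ^ ((k : ℝ) / 2)

/-- Value of the (analytically continued) Riemann zeta function at a real point. -/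
noncomputable def rzeta (x : ℝ) : ℝ := (riemannZeta (x : ℂ)).re

/-- The Riemann zeta function with its 2-factor removed. -/
noncomputable def rzeta2 (x : ℝ) : ℝ := (1 - (2 : ℝ) ^ (-x)) * rzeta x

/-- The constant `C_k` for `k ≥ 4`. -/
noncomputable def Ck (k : ℕ) : ℝ :=
  ((k : ℝ) ^ 2 / 24) * (Vk k) ^ 2 +
    Real.pi ^ (k : ℝ) * rzeta ((k : ℝ) - 2) * (1 + (2 : ℝ) ^ ((3 : ℝ) - (k : ℝ))) /
      (12 * (Real.Gamma ((k : ℝ) / 2)) ^ 2 * rzeta2 (k : ℝ))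

/-- The constant `C_4'`. -/
noncomputable def C4' : ℝ :=
  16 * (9 * Real.sqrt 2 - 8) * rzeta (1/2) * (rzeta (3/2)) ^ 2 * rzeta (5/2) /
    (7 * Real.pi ^ 2 * rzeta 3)

namespace FourSq

open Finset

/-- The triples `(i, d, e)` with `d, e > 0` and `i² + d e = n`. -/
noncomputable def sols (n : ℤ) : Finset (ℤ × ℤ × ℤ) :=
  ((Icc (-n) n) ×ˢ (Icc 1 n) ×ˢ (Icc 1 n)).filter fun t => t.1 ^ 2 + t.2.1 * t.2.2 = n

lemma mem_sols {n i d e : ℤ} : (i, d, e) ∈ sols n ↔ 0 < d ∧ 0 < e ∧ i ^ 2 + d * e = n := by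
  simp only [sols, mem_filter, mem_product, mem_Icc]
  constructor
  · rintro ⟨⟨_, ⟨h1, _⟩, h2, _⟩, h⟩
    exact ⟨by omega, by omega, h⟩
  · rintro ⟨hd, he, h⟩
    have hi : |i| ≤ i ^ 2 := by
      rw [← sq_abs]
      rcases eq_or_ne i 0 with rfl | h0
      · simp
      · nlinarith [Int.one_le_abs h0]
    have hde : 0 < d * e := mul_pos hd he
    have := abs_le.mp (hi.trans (by linarith : i ^ 2 ≤ n))
    refine ⟨⟨⟨this.1, this.2⟩, ⟨by omega, ?_⟩, by omega, ?_⟩, h⟩ <;> nlinarith [sq_nonneg i]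

/-- A sign depending on `x` and `z` modulo four, even in each variable. -/
def parSign (x z : ℤ) : ℤ := if Even x ∧ Even z ∧ 4 ∣ x - z then -1 else 1

lemma parSign_neg_left (x z : ℤ) : parSign (-x) z = parSign x z := by
  unfold parSign
  refine if_congr ?_ rfl rfl
  simp only [even_neg, Int.even_iff]
  constructor <;> rintro ⟨h1, h2, h3⟩ <;> refine ⟨h1, h2, ?_⟩ <;> omega

lemma parSign_neg_right (x z : ℤ) : parSign x (-z) = parSign x z := by
  unfold parSign
  refine if_congr ?_ rfl rfl
  simp only [even_neg, Int.even_iff]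
  constructor <;> rintro ⟨h1, h2, h3⟩ <;> refine ⟨h1, h2, ?_⟩ <;> omega

/-- The weight `x y z · sign`, odd in each variable. -/
def wt (x y z : ℤ) : ℤ := x * y * z * parSign x z

lemma wt_neg₁ (x y z : ℤ) : wt (-x) y z = -wt x y z := by
  simp only [wt, parSign_neg_left]; ring

lemma wt_neg₂ (x y z : ℤ) : wt x (-y) z = -wt x y z := by
  simp only [wt]; ring

lemma wt_neg₃ (x y z : ℤ) : wt x y (-z) = -wt x y z := by
  simp only [wt, parSign_neg_right]; ring

lemma sum_wt_pos (n : ℤ) :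
    ∑ t ∈ (sols n).filter (fun t => 0 < t.2.1 + 2 * t.1 - t.2.2),
      wt (t.2.2 - 2 * t.1) (t.2.1 + t.1) (2 * t.2.1 + 2 * t.1 - t.2.2) = 0 := by
  refine sum_involution (fun t _ => (t.2.2 - t.1, t.2.1 + 2 * t.1 - t.2.2, t.2.2)) ?_ ?_ ?_ ?_
  · rintro ⟨i, d, e⟩ -
    dsimp only
    have h1 : e - 2 * (e - i) = -(e - 2 * i) := by ring
    have h2 : d + 2 * i - e + (e - i) = d + i := by ring
    have h3 : 2 * (d + 2 * i - e) + 2 * (e - i) - e = 2 * d + 2 * i - e := by ring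
    rw [h1, h2, h3, wt_neg₁]; ring
  · rintro ⟨i, d, e⟩ - hne heq
    apply hne
    simp only [Prod.mk.injEq] at heq
    have : e - 2 * i = 0 := by omega
    simp [wt, this]
  · rintro ⟨i, d, e⟩ h
    simp only [mem_filter, mem_sols] at h ⊢
    obtain ⟨⟨hd, he, h⟩, hp⟩ := h
    refine ⟨⟨hp, he, ?_⟩, by omega⟩
    rw [← h]; ring
  · rintro ⟨i, d, e⟩ h
    simp only [Prod.mk.injEq]
    refine ⟨by ring, by ring, trivial⟩

lemma sum_wt_neg_eq (n : ℤ) :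
    ∑ t ∈ (sols n).filter (fun t => t.2.1 + 2 * t.1 - t.2.2 < 0),
      wt (t.2.2 - 2 * t.1) (t.2.1 + t.1) (2 * t.2.1 + 2 * t.1 - t.2.2) =
    ∑ t ∈ (sols n).filter (fun t => t.2.1 - t.2.2 < 2 * t.1),
      wt (t.2.1 + t.2.2) t.1 (t.2.1 - t.2.2) := by
  refine sum_nbij' (fun t => (t.1 + t.2.1, t.2.1, t.2.2 - 2 * t.1 - t.2.1))
    (fun t => (t.1 - t.2.1, t.2.1, 2 * t.1 - t.2.1 + t.2.2)) ?_ ?_ ?_ ?_ ?_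
  · rintro ⟨i, d, e⟩ h
    simp only [mem_filter, mem_sols] at h ⊢
    obtain ⟨⟨hd, he, h⟩, hp⟩ := h
    refine ⟨⟨hd, by omega, by rw [← h]; ring⟩, by omega⟩
  · rintro ⟨i, d, e⟩ h
    simp only [mem_filter, mem_sols] at h ⊢
    obtain ⟨⟨hd, he, h⟩, hp⟩ := h
    refine ⟨⟨hd, by omega, by rw [← h]; ring⟩, by omega⟩
  · rintro ⟨i, d, e⟩ h
    simp only [Prod.mk.injEq]
    refine ⟨by ring, trivial, by ring⟩
  · rintro ⟨i, d, e⟩ h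
    simp only [Prod.mk.injEq]
    refine ⟨by ring, trivial, by ring⟩
  · rintro ⟨i, d, e⟩ h
    dsimp only
    congr 1 <;> ring

lemma two_mul_sum_wt_neg (n : ℤ) :
    2 * ∑ t ∈ (sols n).filter (fun t => t.2.1 - t.2.2 < 2 * t.1),
      wt (t.2.1 + t.2.2) t.1 (t.2.1 - t.2.2) =
    -∑ t ∈ (sols n).filter (fun t => t.2.1 - t.2.2 = 2 * t.1),
      wt (t.2.1 + t.2.2) t.1 (t.2.1 - t.2.2) := by
  set g : ℤ × ℤ × ℤ → ℤ := fun t => wt (t.2.1 + t.2.2) t.1 (t.2.1 - t.2.2) with hg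
  have htot : ∑ t ∈ sols n, g t = 0 := by
    refine sum_involution (fun t _ => (-t.1, t.2)) ?_ ?_ ?_ ?_
    · rintro ⟨i, d, e⟩ -
      simp only [hg, wt_neg₂]; ring
    · rintro ⟨i, d, e⟩ - hne heq
      apply hne
      simp only [Prod.mk.injEq] at heq
      have : i = 0 := by omega
      simp [hg, wt, this]
    · rintro ⟨i, d, e⟩ h
      simp only [mem_sols] at h ⊢
      simpa using h
    · rintro ⟨i, d, e⟩ h
      simp
  have hswap : ∑ t ∈ (sols n).filter (fun t => 2 * t.1 < t.2.1 - t.2.2), g t =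
      ∑ t ∈ (sols n).filter (fun t => t.2.1 - t.2.2 < 2 * t.1), g t := by
    refine sum_nbij' (fun t => (-t.1, t.2.2, t.2.1)) (fun t => (-t.1, t.2.2, t.2.1)) ?_ ?_ ?_ ?_ ?_
    · rintro ⟨i, d, e⟩ h
      simp only [mem_filter, mem_sols] at h ⊢
      obtain ⟨⟨hd, he, h⟩, hp⟩ := h
      refine ⟨⟨he, hd, by rw [← h]; ring⟩, by omega⟩
    · rintro ⟨i, d, e⟩ h
      simp only [mem_filter, mem_sols] at h ⊢
      obtain ⟨⟨hd, he, h⟩, hp⟩ := h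
      refine ⟨⟨he, hd, by rw [← h]; ring⟩, by omega⟩
    · rintro ⟨i, d, e⟩ h; simp
    · rintro ⟨i, d, e⟩ h; simp
    · rintro ⟨i, d, e⟩ h
      simp only [hg]
      rw [wt_neg₂, ← wt_neg₃]
      congr 1 <;> ring
  rw [← sum_filter_add_sum_filter_not (sols n) (fun t => t.2.1 - t.2.2 < 2 * t.1),
    ← sum_filter_add_sum_filter_not ((sols n).filter fun t => ¬ t.2.1 - t.2.2 < 2 * t.1)
      (fun t => t.2.1 - t.2.2 = 2 * t.1), filter_filter, filter_filter] at htot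
  have e1 : (sols n).filter (fun t => ¬ t.2.1 - t.2.2 < 2 * t.1 ∧ t.2.1 - t.2.2 = 2 * t.1) =
      (sols n).filter (fun t => t.2.1 - t.2.2 = 2 * t.1) := by
    refine filter_congr fun t _ => ?_; omega
  have e2 : (sols n).filter (fun t => ¬ t.2.1 - t.2.2 < 2 * t.1 ∧ ¬ t.2.1 - t.2.2 = 2 * t.1) =
      (sols n).filter (fun t => 2 * t.1 < t.2.1 - t.2.2) := by
    refine filter_congr fun t _ => ?_; omega
  rw [e1, e2, hswap] at htot
  linarith

lemma two_mul_sum_wt (n : ℤ) :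
    2 * ∑ t ∈ sols n, wt (t.2.2 - 2 * t.1) (t.2.1 + t.1) (2 * t.2.1 + 2 * t.1 - t.2.2) =
    2 * ∑ t ∈ (sols n).filter (fun t => t.2.2 = t.2.1 + 2 * t.1), wt t.2.1 (t.2.1 + t.1) t.2.1
    - ∑ t ∈ (sols n).filter (fun t => t.2.1 - t.2.2 = 2 * t.1),
      wt (t.2.1 + t.2.2) t.1 (t.2.1 - t.2.2) := by
  rw [← sum_filter_add_sum_filter_not (sols n) (fun t => 0 < t.2.1 + 2 * t.1 - t.2.2), sum_wt_pos,
    ← sum_filter_add_sum_filter_not ((sols n).filter fun t => ¬ 0 < t.2.1 + 2 * t.1 - t.2.2)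
      (fun t => t.2.2 = t.2.1 + 2 * t.1), filter_filter, filter_filter]
  have e1 : (sols n).filter (fun t => ¬ 0 < t.2.1 + 2 * t.1 - t.2.2 ∧ t.2.2 = t.2.1 + 2 * t.1) =
      (sols n).filter (fun t => t.2.2 = t.2.1 + 2 * t.1) := by
    refine filter_congr fun t _ => ?_; omega
  have e2 : (sols n).filter (fun t => ¬ 0 < t.2.1 + 2 * t.1 - t.2.2 ∧
      ¬ t.2.2 = t.2.1 + 2 * t.1) =
      (sols n).filter (fun t => t.2.1 + 2 * t.1 - t.2.2 < 0) := by
    refine filter_congr fun t _ => ?_; omega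
  rw [e1, e2, sum_wt_neg_eq, zero_add, mul_add, two_mul_sum_wt_neg, sub_eq_add_neg]
  congr 2
  refine sum_congr rfl ?_
  rintro ⟨i, d, e⟩ h
  simp only [mem_filter] at h
  obtain ⟨-, h⟩ := h
  simp only
  rw [h]
  congr 1 <;> ring

lemma sum_alternating_sq (m : ℕ) :
    ∑ d ∈ range m, (-1 : ℤ) ^ d * (d : ℤ) ^ 2 * 2 = -(-1 : ℤ) ^ m * ((m : ℤ) * (m - 1)) := by
  induction m with
  | zero => simp
  | succ k ih => rw [sum_range_succ, ih]; push_cast; ring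

lemma parSign_self (d : ℤ) : parSign d d = -(-1) ^ d.natAbs := by
  unfold parSign
  rcases Int.even_or_odd d with h | h
  · have h' : Even d.natAbs := Int.natAbs_even.mpr h
    simp [h, h'.neg_one_pow]
  · have h' : Odd d.natAbs := Int.natAbs_odd.mpr h
    have : ¬ Even d := Int.not_even_iff_odd.mpr h
    simp [this, h'.neg_one_pow]

lemma parSign_two_mul (s : ℕ) (y : ℤ) : parSign (2 * s) (2 * y) = -(-1) ^ (s + y.natAbs) := by
  unfold parSign
  have e : (4 ∣ (2 * s : ℤ) - 2 * y) ↔ Even (s + y.natAbs) := by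
    rw [Nat.even_add, Int.natAbs_even, ← Int.even_coe_nat, Int.even_iff, Int.even_iff]
    omega
  by_cases h : Even (s + y.natAbs)
  · rw [if_pos ⟨even_two_mul _, even_two_mul _, e.mpr h⟩, h.neg_one_pow]
  · rw [if_neg (fun hh => h (e.mp hh.2.2)), (Nat.not_even_iff_odd.mp h).neg_one_pow]; simp

lemma sum_diag (s : ℕ) (hs : 0 < s) :
    ∑ t ∈ (sols ((s : ℤ) ^ 2)).filter (fun t => t.2.2 = t.2.1 + 2 * t.1),
      wt t.2.1 (t.2.1 + t.1) t.2.1 = (s : ℤ) ^ 2 * (2 * s - 1) := by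
  have : ∑ t ∈ (sols ((s : ℤ) ^ 2)).filter (fun t => t.2.2 = t.2.1 + 2 * t.1),
      wt t.2.1 (t.2.1 + t.1) t.2.1 = ∑ d ∈ range (2 * s), -((-1 : ℤ) ^ d * (d : ℤ) ^ 2 * s) := by
    have hz : ∑ d ∈ range (2 * s), -((-1 : ℤ) ^ d * (d : ℤ) ^ 2 * s) =
        ∑ d ∈ (range (2 * s)).filter (0 < ·), -((-1 : ℤ) ^ d * (d : ℤ) ^ 2 * s) := by
      symm
      refine sum_filter_of_ne fun d _ hd => ?_
      rcases Nat.eq_zero_or_pos d with h | h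
      · simp [h] at hd
      · exact h
    rw [hz]
    refine sum_nbij' (fun t => t.2.1.toNat) (fun d => ((s : ℤ) - d, (d : ℤ), 2 * (s : ℤ) - d))
      ?_ ?_ ?_ ?_ ?_
    all_goals simp only [mem_filter, mem_range]
    · rintro ⟨i, d, e⟩ h
      simp only [mem_sols] at h
      obtain ⟨⟨hd, he, h⟩, hp⟩ := h
      have h2 : (d + i) ^ 2 = (s : ℤ) ^ 2 := by rw [← h, hp]; ring
      rcases sq_eq_sq_iff_eq_or_eq_neg.mp h2 with h3 | h3 <;> simp only <;> omega
    · intro d h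
      simp only [mem_sols]
      refine ⟨⟨by omega, by omega, by ring⟩, by ring⟩
    · rintro ⟨i, d, e⟩ h
      simp only [mem_sols] at h
      obtain ⟨⟨hd, he, h⟩, hp⟩ := h
      have h2 : (d + i) ^ 2 = (s : ℤ) ^ 2 := by rw [← h, hp]; ring
      simp only [Prod.mk.injEq]
      rcases sq_eq_sq_iff_eq_or_eq_neg.mp h2 with h3 | h3 <;> omega
    · intro d h
      simp
    · rintro ⟨i, d, e⟩ h
      simp only [mem_sols] at h
      obtain ⟨⟨hd, he, h⟩, hp⟩ := h
      have h2 : (d + i) ^ 2 = (s : ℤ) ^ 2 := by rw [← h, hp]; ring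
      have h4 : d + i = s := by
        rcases sq_eq_sq_iff_eq_or_eq_neg.mp h2 with h3 | h3 <;> omega
      simp only [wt, parSign_self, h4]
      have e1 : d.natAbs = d.toNat := by omega
      have e2 : (d.toNat : ℤ) = d := by omega
      rw [e1, e2]; ring
  rw [this, sum_neg_distrib]
  have h := sum_alternating_sq (2 * s)
  rw [← sum_mul] at h
  rw [← sum_mul]
  rw [(even_two_mul s).neg_one_pow] at h
  push_cast at h
  nlinarith

lemma sum_antidiag (s : ℕ) (hs : 0 < s) :
    ∑ t ∈ (sols ((s : ℤ) ^ 2)).filter (fun t => t.2.1 - t.2.2 = 2 * t.1),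
      wt (t.2.1 + t.2.2) t.1 (t.2.1 - t.2.2) = 4 * (s : ℤ) ^ 2 * (s - 1) := by
  have key : ∑ t ∈ (sols ((s : ℤ) ^ 2)).filter (fun t => t.2.1 - t.2.2 = 2 * t.1),
      wt (t.2.1 + t.2.2) t.1 (t.2.1 - t.2.2) =
      ∑ y ∈ Ioo (-(s : ℤ)) s, -(4 * s * y ^ 2 * (-1) ^ (s + y.natAbs)) := by
    refine sum_nbij' (fun t => t.1) (fun y => (y, s + y, s - y)) ?_ ?_ ?_ ?_ ?_
    all_goals simp only [mem_filter, mem_Ioo]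
    · rintro ⟨i, d, e⟩ h
      simp only [mem_sols] at h
      obtain ⟨⟨hd, he, h⟩, hp⟩ := h
      have hd' : d = e + 2 * i := by omega
      have h2 : (i + e) ^ 2 = (s : ℤ) ^ 2 := by rw [← h, hd']; ring
      rcases sq_eq_sq_iff_eq_or_eq_neg.mp h2 with h3 | h3 <;> simp only <;> omega
    · intro y h
      simp only [mem_sols]
      refine ⟨⟨by omega, by omega, by ring⟩, by ring⟩
    · rintro ⟨i, d, e⟩ h
      simp only [mem_sols] at h
      obtain ⟨⟨hd, he, h⟩, hp⟩ := h
      have hd' : d = e + 2 * i := by omega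
      have h2 : (i + e) ^ 2 = (s : ℤ) ^ 2 := by rw [← h, hd']; ring
      simp only [Prod.mk.injEq, true_and]
      rcases sq_eq_sq_iff_eq_or_eq_neg.mp h2 with h3 | h3 <;> omega
    · intro y h; trivial
    · rintro ⟨i, d, e⟩ h
      simp only [mem_sols] at h
      obtain ⟨⟨hd, he, h⟩, hp⟩ := h
      have hd' : d = e + 2 * i := by omega
      have h2 : (i + e) ^ 2 = (s : ℤ) ^ 2 := by rw [← h, hd']; ring
      have h4 : d + e = 2 * s := by
        rcases sq_eq_sq_iff_eq_or_eq_neg.mp h2 with h3 | h3 <;> omega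
      simp only [wt]
      rw [h4, hp, parSign_two_mul]; ring
  rw [key]
  have half : ∀ m : ℕ, ∑ y ∈ Ioo (-(m : ℤ) - 1) (m + 1), (y ^ 2 * (-1 : ℤ) ^ y.natAbs) =
      (-1) ^ m * (m * (m + 1)) := by
    intro m
    induction m with
    | zero =>
      have : Ioo (-((0 : ℕ) : ℤ) - 1) ((0 : ℕ) + 1) = {0} := by
        ext y; simp only [mem_Ioo, mem_singleton]; omega
      rw [this]; simp
    | succ k ih =>
      have e : Ioo (-((k + 1 : ℕ) : ℤ) - 1) ((k + 1 : ℕ) + 1) =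
          insert (-((k : ℤ) + 1)) (insert ((k : ℤ) + 1) (Ioo (-(k : ℤ) - 1) (k + 1))) := by
        ext y; simp only [mem_Ioo, mem_insert]; omega
      rw [e, sum_insert, sum_insert, ih]
      · have : ((k : ℤ) + 1).natAbs = k + 1 := by omega
        rw [Int.natAbs_neg, this]; push_cast; ring
      · simp
      · simp only [mem_insert, mem_Ioo]; omega
  obtain ⟨m, rfl⟩ : ∃ m, s = m + 1 := ⟨s - 1, by omega⟩
  have hm := half m
  have e : Ioo (-((m + 1 : ℕ) : ℤ)) ((m + 1 : ℕ) : ℤ) = Ioo (-(m : ℤ) - 1) (m + 1) := by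
    ext y; simp only [mem_Ioo]; omega
  rw [e]
  have : ∀ y : ℤ, -(4 * ((m + 1 : ℕ) : ℤ) * y ^ 2 * (-1) ^ (m + 1 + y.natAbs)) =
      (4 * ((m + 1 : ℕ) : ℤ) * (-1) ^ m) * (y ^ 2 * (-1 : ℤ) ^ y.natAbs) := by
    intro y; rw [pow_add, pow_succ]; ring
  simp only [this]
  rw [← mul_sum, hm]
  have h1 : ((-1 : ℤ) ^ m) * (-1) ^ m = 1 := by rw [← mul_pow]; simp
  push_cast
  linear_combination (4 * ((m : ℤ) + 1) ^ 2 * m) * h1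

end FourSq

namespace FourSq

open Finset

lemma sum_wt_eq (n : ℤ) :
    ∑ t ∈ sols n, wt (t.2.2 - 2 * t.1) (t.2.1 + t.1) (2 * t.2.1 + 2 * t.1 - t.2.2) =
    ∑ t ∈ sols n, t.2.1 * (t.2.1 * t.2.2 - 4 * t.1 ^ 2) *
      (if Even t.2.1 ∧ Even t.2.2 then -1 else 1) := by
  set c : ℤ → ℤ → ℤ := fun d e => if Even d ∧ Even e then -1 else 1 with hc
  have hc' : ∀ d e, c d e = c e d := fun d e => by simp only [hc, and_comm]
  have hpar : ∀ i d e : ℤ, parSign (e - 2 * i) (2 * d + 2 * i - e) = c d e := by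
    intro i d e
    simp only [parSign, hc]
    refine if_congr ?_ rfl rfl
    simp only [Int.even_iff]
    omega
  set g : ℤ × ℤ × ℤ → ℤ := fun t =>
    wt (t.2.2 - 2 * t.1) (t.2.1 + t.1) (2 * t.2.1 + 2 * t.1 - t.2.2) with hg
  have hflip : ∑ t ∈ sols n, g t = ∑ t ∈ sols n, g (-t.1, t.2) := by
    refine sum_nbij' (fun t => (-t.1, t.2)) (fun t => (-t.1, t.2)) ?_ ?_ ?_ ?_ ?_
    · rintro ⟨i, d, e⟩ h
      simp only [mem_sols] at h ⊢; simpa using h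
    · rintro ⟨i, d, e⟩ h
      simp only [mem_sols] at h ⊢; simpa using h
    · rintro ⟨i, d, e⟩ h; simp
    · rintro ⟨i, d, e⟩ h; simp
    · rintro ⟨i, d, e⟩ h; simp
  have hswap : ∑ t ∈ sols n, t.2.2 * (t.2.1 * t.2.2 - 4 * t.1 ^ 2) * c t.2.1 t.2.2 =
      ∑ t ∈ sols n, t.2.1 * (t.2.1 * t.2.2 - 4 * t.1 ^ 2) * c t.2.1 t.2.2 := by
    refine sum_nbij' (fun t => (t.1, t.2.2, t.2.1)) (fun t => (t.1, t.2.2, t.2.1)) ?_ ?_ ?_ ?_ ?_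
    · rintro ⟨i, d, e⟩ h
      simp only [mem_sols] at h ⊢
      exact ⟨h.2.1, h.1, by rw [← h.2.2]; ring⟩
    · rintro ⟨i, d, e⟩ h
      simp only [mem_sols] at h ⊢
      exact ⟨h.2.1, h.1, by rw [← h.2.2]; ring⟩
    · rintro ⟨i, d, e⟩ h; simp
    · rintro ⟨i, d, e⟩ h; simp
    · rintro ⟨i, d, e⟩ h
      simp only
      rw [hc' d e]; ring
  have h2 : 2 * ∑ t ∈ sols n, g t =
      2 * ∑ t ∈ sols n, (2 * t.2.1 - t.2.2) * (t.2.1 * t.2.2 - 4 * t.1 ^ 2) * c t.2.1 t.2.2 := by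
    rw [two_mul]
    nth_rewrite 2 [hflip]
    rw [← sum_add_distrib, mul_sum]
    refine sum_congr rfl ?_
    rintro ⟨i, d, e⟩ -
    simp only [hg, wt, hpar]
    ring
  have h3 : ∑ t ∈ sols n, (2 * t.2.1 - t.2.2) * (t.2.1 * t.2.2 - 4 * t.1 ^ 2) * c t.2.1 t.2.2 =
      2 * ∑ t ∈ sols n, t.2.1 * (t.2.1 * t.2.2 - 4 * t.1 ^ 2) * c t.2.1 t.2.2 -
      ∑ t ∈ sols n, t.2.2 * (t.2.1 * t.2.2 - 4 * t.1 ^ 2) * c t.2.1 t.2.2 := by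
    rw [mul_sum, ← sum_sub_distrib]
    exact sum_congr rfl fun t _ => by ring
  change ∑ t ∈ sols n, g t =
    ∑ t ∈ sols n, t.2.1 * (t.2.1 * t.2.2 - 4 * t.1 ^ 2) * c t.2.1 t.2.2
  linarith

lemma sum_even_even (n : ℤ) :
    2 * ∑ t ∈ (sols n).filter (fun t => Even t.2.1 ∧ Even t.2.2),
      t.2.1 * (t.2.1 * t.2.2 - 4 * t.1 ^ 2) =
    ∑ t ∈ (sols n).filter (fun t => 4 ∣ t.2.1), t.2.1 * (t.2.1 * t.2.2 - 4 * t.1 ^ 2) := by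
  rw [mul_sum]
  refine sum_nbij' (fun t => (t.1, 2 * t.2.1, t.2.2 / 2)) (fun t => (t.1, t.2.1 / 2, 2 * t.2.2))
    ?_ ?_ ?_ ?_ ?_
  all_goals
    rintro ⟨i, d, e⟩ h
    simp only [mem_filter, mem_sols] at h
    obtain ⟨⟨hd, he, h⟩, hp⟩ := h
  · obtain ⟨⟨a, rfl⟩, b, rfl⟩ := hp
    simp only [mem_filter, mem_sols]
    have : (b + b) / 2 = b := by omega
    rw [this]
    exact ⟨⟨by omega, by omega, by rw [← h]; ring⟩, ⟨a, by ring⟩⟩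
  · obtain ⟨a, rfl⟩ := hp
    simp only [mem_filter, mem_sols]
    have : 4 * a / 2 = 2 * a := by omega
    rw [this]
    exact ⟨⟨by omega, by omega, by rw [← h]; ring⟩, even_two_mul _, even_two_mul _⟩
  · obtain ⟨⟨a, rfl⟩, b, rfl⟩ := hp
    simp only [Prod.mk.injEq, true_and]; omega
  · obtain ⟨a, rfl⟩ := hp
    simp only [Prod.mk.injEq, true_and]; omega
  · obtain ⟨⟨a, rfl⟩, b, rfl⟩ := hp
    have : (b + b) / 2 = b := by omega
    simp only [this]; ring

lemma sum_not_four_dvd (n : ℤ) :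
    ∑ t ∈ (sols n).filter (fun t => ¬ 4 ∣ t.2.1), t.2.1 * (t.2.1 * t.2.2 - 4 * t.1 ^ 2) =
    ∑ t ∈ sols n, wt (t.2.2 - 2 * t.1) (t.2.1 + t.1) (2 * t.2.1 + 2 * t.1 - t.2.2) := by
  rw [sum_wt_eq]
  have h1 := sum_filter_add_sum_filter_not (sols n) (fun t => 4 ∣ t.2.1)
    (fun t => t.2.1 * (t.2.1 * t.2.2 - 4 * t.1 ^ 2))
  have h2 := sum_even_even n
  have h3 := sum_filter_add_sum_filter_not (sols n) (fun t => Even t.2.1 ∧ Even t.2.2)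
    (fun t => t.2.1 * (t.2.1 * t.2.2 - 4 * t.1 ^ 2))
  have h4 : ∑ t ∈ sols n, t.2.1 * (t.2.1 * t.2.2 - 4 * t.1 ^ 2) *
      (if Even t.2.1 ∧ Even t.2.2 then -1 else 1) =
      -∑ t ∈ (sols n).filter (fun t => Even t.2.1 ∧ Even t.2.2),
        t.2.1 * (t.2.1 * t.2.2 - 4 * t.1 ^ 2) +
      ∑ t ∈ (sols n).filter (fun t => ¬ (Even t.2.1 ∧ Even t.2.2)),
        t.2.1 * (t.2.1 * t.2.2 - 4 * t.1 ^ 2) := by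
    rw [← sum_filter_add_sum_filter_not (sols n) (fun t => Even t.2.1 ∧ Even t.2.2),
      ← sum_neg_distrib]
    congr 1
    · refine sum_congr rfl fun t ht => ?_
      rw [if_pos (mem_filter.mp ht).2]; ring
    · refine sum_congr rfl fun t ht => ?_
      rw [if_neg (mem_filter.mp ht).2]; ring
  rw [h4]
  linarith

lemma sum_not_four_dvd_sq (s : ℕ) (hs : 0 < s) :
    ∑ t ∈ (sols ((s : ℤ) ^ 2)).filter (fun t => ¬ 4 ∣ t.2.1),
      t.2.1 * (t.2.1 * t.2.2 - 4 * t.1 ^ 2) = (s : ℤ) ^ 2 := by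
  rw [sum_not_four_dvd]
  have := two_mul_sum_wt ((s : ℤ) ^ 2)
  rw [sum_diag s hs, sum_antidiag s hs] at this
  linarith

lemma sum_not_four_dvd_of_not_isSquare (n : ℤ) (hn : ¬ IsSquare n) :
    ∑ t ∈ (sols n).filter (fun t => ¬ 4 ∣ t.2.1),
      t.2.1 * (t.2.1 * t.2.2 - 4 * t.1 ^ 2) = 0 := by
  rw [sum_not_four_dvd]
  have h := two_mul_sum_wt n
  have e1 : (sols n).filter (fun t => t.2.2 = t.2.1 + 2 * t.1) = ∅ := by
    refine filter_eq_empty_iff.mpr ?_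
    rintro ⟨i, d, e⟩ h hp
    simp only [mem_sols] at h hp
    exact hn ⟨d + i, by rw [← h.2.2, hp]; ring⟩
  have e2 : (sols n).filter (fun t => t.2.1 - t.2.2 = 2 * t.1) = ∅ := by
    refine filter_eq_empty_iff.mpr ?_
    rintro ⟨i, d, e⟩ h hp
    simp only [mem_sols] at h hp
    exact hn ⟨i + e, by rw [← h.2.2, show d = e + 2 * i by linarith]; ring⟩
  rw [e1, e2] at h
  simp at h
  exact h

/-- The sum of the divisors of `n` that are not divisible by four. -/
def rho (n : ℕ) : ℕ := ∑ d ∈ n.divisors with ¬ 4 ∣ d, d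

/-- Jacobi's formula for the number of representations as a sum of four squares. -/
def jacobiR (n : ℕ) : ℕ := if n = 0 then 1 else 8 * rho n

lemma sum_rho (n : ℕ) :
    ∑ i ∈ (Icc (-(n : ℤ)) n).filter (fun i => i ^ 2 < (n : ℤ)),
      ((n : ℤ) - 5 * i ^ 2) * (rho (n - i ^ 2 : ℤ).toNat : ℤ) =
    ∑ t ∈ (sols n).filter (fun t => ¬ 4 ∣ t.2.1), t.2.1 * (t.2.1 * t.2.2 - 4 * t.1 ^ 2) := by
  have : ∀ i ∈ (Icc (-(n : ℤ)) n).filter (fun i => i ^ 2 < (n : ℤ)),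
      ((n : ℤ) - 5 * i ^ 2) * (rho (n - i ^ 2 : ℤ).toNat : ℤ) =
      ∑ d ∈ (n - i ^ 2 : ℤ).toNat.divisors.filter (fun d => ¬ 4 ∣ d),
        ((n : ℤ) - 5 * i ^ 2) * d := by
    intro i _
    rw [rho]; push_cast; rw [mul_sum]
  rw [sum_congr rfl this, sum_sigma']
  symm
  refine sum_nbij' (fun t => ⟨t.1, t.2.1.toNat⟩)
    (fun p => (p.1, (p.2 : ℤ), ((n : ℤ) - p.1 ^ 2) / p.2)) ?_ ?_ ?_ ?_ ?_
  · rintro ⟨i, d, e⟩ h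
    have hbox := mem_of_mem_filter _ h
    simp only [sols, mem_filter, mem_product, mem_Icc] at hbox
    simp only [mem_filter, mem_sols] at h
    obtain ⟨⟨hd, he, h⟩, hp⟩ := h
    have hde := mul_pos hd he
    simp only [mem_sigma, mem_filter, mem_Icc, Nat.mem_divisors]
    refine ⟨⟨hbox.1.1, by linarith⟩, ⟨?_, ?_⟩, ?_⟩
    · rw [← Int.natCast_dvd_natCast, Int.toNat_of_nonneg hd.le,
        Int.toNat_of_nonneg (by linarith)]
      exact ⟨e, by linarith⟩
    · have : 0 < (n : ℤ) - i ^ 2 := by linarith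
      omega
    · omega
  · rintro ⟨i, d⟩ h
    simp only [mem_sigma, mem_filter, mem_Icc, Nat.mem_divisors] at h
    obtain ⟨⟨hi, hi2⟩, ⟨hd, h0⟩, h4⟩ := h
    rw [← Int.natCast_dvd_natCast, Int.toNat_of_nonneg (by linarith)] at hd
    obtain ⟨e, he⟩ := hd
    have hdpos : (0 : ℤ) < d := by
      rcases Nat.eq_zero_or_pos d with h | h
      · subst h; simp at he; linarith
      · exact_mod_cast h
    have : ((n : ℤ) - i ^ 2) / d = e := by
      rw [he, Int.mul_ediv_cancel_left _ hdpos.ne']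
    simp only [mem_filter, mem_sols, this]
    refine ⟨⟨hdpos, ?_, by linarith⟩, by omega⟩
    by_contra hne
    nlinarith
  · rintro ⟨i, d, e⟩ h
    simp only [mem_filter, mem_sols] at h
    obtain ⟨⟨hd, he, h⟩, hp⟩ := h
    simp only [Prod.mk.injEq, true_and]
    rw [Int.toNat_of_nonneg hd.le]
    refine ⟨rfl, ?_⟩
    rw [show (n : ℤ) - i ^ 2 = d * e by linarith, Int.mul_ediv_cancel_left _ hd.ne']
  · rintro ⟨i, d⟩ h
    simp
  · rintro ⟨i, d, e⟩ h
    simp only [mem_filter, mem_sols] at h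
    obtain ⟨⟨hd, he, h⟩, hp⟩ := h
    simp only [Int.toNat_of_nonneg hd.le]
    rw [← h]; ring

lemma sum_jacobiR (n : ℕ) (hn : 0 < n) :
    ∑ i ∈ (Icc (-(n : ℤ)) n).filter (fun i => i ^ 2 ≤ (n : ℤ)),
      ((n : ℤ) - 5 * i ^ 2) * (jacobiR (n - i ^ 2 : ℤ).toNat : ℤ) = 0 := by
  rw [← sum_filter_add_sum_filter_not _ (fun i : ℤ => i ^ 2 < (n : ℤ)), filter_filter,
    filter_filter]
  have e1 : (Icc (-(n : ℤ)) n).filter (fun i => i ^ 2 ≤ (n : ℤ) ∧ i ^ 2 < (n : ℤ)) =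
      (Icc (-(n : ℤ)) n).filter (fun i => i ^ 2 < (n : ℤ)) :=
    filter_congr fun i _ => ⟨fun h => h.2, fun h => ⟨h.le, h⟩⟩
  have e2 : (Icc (-(n : ℤ)) n).filter (fun i => i ^ 2 ≤ (n : ℤ) ∧ ¬ i ^ 2 < (n : ℤ)) =
      (Icc (-(n : ℤ)) n).filter (fun i => i ^ 2 = (n : ℤ)) :=
    filter_congr fun i _ => ⟨fun h => by linarith [h.1, not_lt.mp h.2], fun h => by
      rw [h]; simp⟩
  rw [e1, e2]
  have h1 : ∑ i ∈ (Icc (-(n : ℤ)) n).filter (fun i => i ^ 2 < (n : ℤ)),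
      ((n : ℤ) - 5 * i ^ 2) * (jacobiR (n - i ^ 2 : ℤ).toNat : ℤ) =
      8 * ∑ i ∈ (Icc (-(n : ℤ)) n).filter (fun i => i ^ 2 < (n : ℤ)),
      ((n : ℤ) - 5 * i ^ 2) * (rho (n - i ^ 2 : ℤ).toNat : ℤ) := by
    rw [mul_sum]
    refine sum_congr rfl fun i hi => ?_
    have := (mem_filter.mp hi).2
    rw [jacobiR, if_neg (by omega)]
    push_cast; ring
  rw [h1, sum_rho]
  by_cases hsq : IsSquare (n : ℤ)
  · obtain ⟨r, hr⟩ := hsq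
    obtain ⟨s, hs⟩ : ∃ s : ℕ, (n : ℤ) = (s : ℤ) ^ 2 := ⟨r.natAbs, by
      rw [Int.natCast_natAbs, sq_abs, hr, sq]⟩
    have hspos : 0 < s := by
      rcases Nat.eq_zero_or_pos s with h | h
      · subst h; simp at hs; omega
      · exact h
    have e3 : (Icc (-(n : ℤ)) n).filter (fun i => i ^ 2 = (n : ℤ)) = {(s : ℤ), -(s : ℤ)} := by
      ext i
      simp only [mem_filter, mem_Icc, mem_insert, mem_singleton]
      constructor
      · rintro ⟨-, h⟩
        exact sq_eq_sq_iff_eq_or_eq_neg.mp (h.trans hs)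
      · have : (s : ℤ) ≤ (s : ℤ) ^ 2 := by exact_mod_cast Nat.le_self_pow two_ne_zero s
        rintro (rfl | rfl) <;> rw [hs] <;> refine ⟨⟨by omega, by omega⟩, by ring⟩
    rw [e3, sum_pair (by omega), hs, sum_not_four_dvd_sq s hspos]
    simp [jacobiR]
    ring
  · rw [sum_not_four_dvd_of_not_isSquare _ hsq]
    rw [filter_eq_empty_iff.mpr]
    · simp
    · intro i _ hi
      exact hsq ⟨i, by rw [← hi, sq]⟩

end FourSq

namespace FourSq

open Finset

/-- The lattice points of `ℤ^k` on the sphere of squared radius `n`. -/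
noncomputable def shell (k : ℕ) (n : ℤ) : Finset (Fin k → ℤ) :=
  (Fintype.piFinset fun _ => Icc (-n) n).filter fun v => ∑ i, v i ^ 2 = n

lemma abs_le_sq_int (i : ℤ) : |i| ≤ i ^ 2 := by
  rw [← sq_abs]
  rcases eq_or_ne i 0 with rfl | h0
  · simp
  · nlinarith [Int.one_le_abs h0]

lemma mem_shell {k : ℕ} {n : ℤ} {v : Fin k → ℤ} : v ∈ shell k n ↔ ∑ i, v i ^ 2 = n := by
  simp only [shell, mem_filter, Fintype.mem_piFinset, mem_Icc, and_iff_right_iff_imp]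
  intro h i
  have h1 : v i ^ 2 ≤ n := by
    rw [← h]
    exact single_le_sum (f := fun i => v i ^ 2) (fun j _ => sq_nonneg (v j)) (mem_univ i)
  exact abs_le.mp ((abs_le_sq_int _).trans h1)

lemma rk_eq_card (k m : ℕ) : rk k m = (shell k m).card := by
  rw [rk, ← Nat.card_eq_finsetCard]
  exact Nat.card_congr (Equiv.subtypeEquivRight fun v => mem_shell.symm)

lemma sum_shell_sq (k : ℕ) (n : ℤ) :
    ∑ v ∈ shell (k + 1) n, (n - (k + 1) * v 0 ^ 2) = 0 := by
  have hswap : ∀ j : Fin (k + 1), ∑ v ∈ shell (k + 1) n, v j ^ 2 =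
      ∑ v ∈ shell (k + 1) n, v 0 ^ 2 := by
    intro j
    refine sum_nbij' (fun v => v ∘ Equiv.swap 0 j) (fun v => v ∘ Equiv.swap 0 j) ?_ ?_ ?_ ?_ ?_
    · intro v hv
      rw [mem_shell] at hv ⊢
      rw [← hv]
      exact Equiv.sum_comp (Equiv.swap 0 j) fun i => v i ^ 2
    · intro v hv
      rw [mem_shell] at hv ⊢
      rw [← hv]
      exact Equiv.sum_comp (Equiv.swap 0 j) fun i => v i ^ 2
    · intro v _; ext i; simp
    · intro v _; ext i; simp
    · intro v _; simp
  have h1 : ∑ v ∈ shell (k + 1) n, ∑ j, v j ^ 2 = ∑ v ∈ shell (k + 1) n, n :=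
    sum_congr rfl fun v hv => mem_shell.mp hv
  rw [sum_comm, sum_congr rfl fun j _ => hswap j] at h1
  simp only [sum_const, card_univ, Fintype.card_fin, nsmul_eq_mul] at h1
  rw [sum_sub_distrib, ← mul_sum, sum_const, nsmul_eq_mul]
  push_cast at h1
  linarith

lemma sum_rk (k n : ℕ) :
    ∑ i ∈ (Icc (-(n : ℤ)) n).filter (fun i => i ^ 2 ≤ (n : ℤ)),
      ((n : ℤ) - (k + 1) * i ^ 2) * (rk k (n - i ^ 2 : ℤ).toNat : ℤ) = 0 := by
  rw [← sum_shell_sq k n]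
  have : ∀ i ∈ (Icc (-(n : ℤ)) n).filter (fun i => i ^ 2 ≤ (n : ℤ)),
      ((n : ℤ) - (k + 1) * i ^ 2) * (rk k (n - i ^ 2 : ℤ).toNat : ℤ) =
      ∑ v ∈ shell k (n - i ^ 2), ((n : ℤ) - (k + 1) * i ^ 2) := by
    intro i hi
    have := (mem_filter.mp hi).2
    rw [rk_eq_card, sum_const, nsmul_eq_mul, Int.toNat_of_nonneg (by linarith), mul_comm]
  rw [sum_congr rfl this, sum_sigma']
  refine sum_nbij' (fun p => Fin.cons p.1 p.2) (fun v => ⟨v 0, Fin.tail v⟩) ?_ ?_ ?_ ?_ ?_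
  · rintro ⟨i, v⟩ h
    simp only [mem_sigma, mem_shell] at h
    rw [mem_shell, Fin.sum_univ_succ]
    simp [h.2]
  · intro v hv
    have hbox := mem_of_mem_filter _ hv
    rw [mem_shell, Fin.sum_univ_succ] at hv
    simp only [Fintype.mem_piFinset, mem_Icc] at hbox
    simp only [mem_sigma, mem_filter, mem_shell, mem_Icc, Fin.tail]
    refine ⟨⟨hbox 0, ?_⟩, by linarith⟩
    have : 0 ≤ ∑ i : Fin k, v i.succ ^ 2 := sum_nonneg fun i _ => sq_nonneg _
    linarith
  · rintro ⟨i, v⟩ _; simp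
  · intro v _; simp
  · rintro ⟨i, v⟩ _; simp

/-- **Jacobi's four-square theorem.** -/
theorem rk_four (n : ℕ) : rk 4 n = jacobiR n := by
  induction n using Nat.strong_induction_on with
  | _ n ih =>
    rcases Nat.eq_zero_or_pos n with rfl | hn
    · rw [rk_eq_card, jacobiR, if_pos rfl, card_eq_one]
      refine ⟨0, ?_⟩
      ext v
      rw [mem_shell, mem_singleton]
      constructor
      · intro h
        have := (sum_eq_zero_iff_of_nonneg (fun i _ => sq_nonneg (v i))).mp (by exact_mod_cast h)
        ext i
        simpa using this i (mem_univ i)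
      · rintro rfl; simp
    · have h1 := sum_rk 4 n
      have h2 := sum_jacobiR n hn
      have h0 : (0 : ℤ) ∈ (Icc (-(n : ℤ)) n).filter (fun i => i ^ 2 ≤ (n : ℤ)) := by
        simp
      rw [← add_sum_erase _ _ h0] at h1 h2
      have h3 : ∀ i ∈ ((Icc (-(n : ℤ)) n).filter (fun i => i ^ 2 ≤ (n : ℤ))).erase 0,
          ((n : ℤ) - ((4 : ℕ) + 1) * i ^ 2) * (rk 4 (n - i ^ 2 : ℤ).toNat : ℤ) =
          ((n : ℤ) - 5 * i ^ 2) * (jacobiR (n - i ^ 2 : ℤ).toNat : ℤ) := by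
        intro i hi
        have hi0 := (mem_erase.mp hi).1
        have : 0 < i ^ 2 := by positivity
        rw [ih _ (by omega)]
        norm_num
      rw [sum_congr rfl h3] at h1
      have h4 : (n : ℤ) * rk 4 n = n * jacobiR n := by
        simp at h1 h2
        linarith
      have := mul_left_cancel₀ (by exact_mod_cast hn.ne') h4
      exact_mod_cast this

end FourSq

namespace FourSq

open Finset

def hfun : ArithmeticFunction ℕ := ⟨fun d => if 4 ∣ d then 0 else d, by simp⟩

lemma hfun_apply (d : ℕ) : hfun d = if 4 ∣ d then 0 else d := rfl

lemma hfun_isMultiplicative : hfun.IsMultiplicative := by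
  refine ⟨by simp [hfun_apply], ?_⟩
  intro m n hmn
  have h4 : IsPrimePow 4 := ⟨2, 2, Nat.prime_iff.mp Nat.prime_two, by norm_num, by norm_num⟩
  simp only [hfun_apply, hmn.isPrimePow_dvd_mul h4]
  by_cases h1 : 4 ∣ m <;> by_cases h2 : 4 ∣ n <;> simp [h1, h2]

lemma rho_eq (n : ℕ) : rho n = (hfun * ArithmeticFunction.zeta) n := by
  rw [ArithmeticFunction.mul_zeta_apply, rho, sum_filter]
  refine sum_congr rfl fun d _ => ?_
  rw [hfun_apply]
  split_ifs <;> simp_all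

lemma rho_mul {m n : ℕ} (h : m.Coprime n) : rho (m * n) = rho m * rho n := by
  simp only [rho_eq]
  exact (hfun_isMultiplicative.mul ArithmeticFunction.isMultiplicative_zeta).map_mul_of_coprime h

lemma rho_le (n : ℕ) : rho n ≤ n ^ 2 := by
  calc rho n ≤ ∑ d ∈ n.divisors, d := sum_le_sum_of_subset (filter_subset _ _)
    _ = ArithmeticFunction.sigma 1 n := (ArithmeticFunction.sigma_one_apply n).symm
    _ ≤ n ^ 2 := ArithmeticFunction.sigma_le_pow_succ 1 n

lemma rho_one : rho 1 = 1 := by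
  rw [rho_eq]
  exact (hfun_isMultiplicative.mul ArithmeticFunction.isMultiplicative_zeta).map_one

lemma rho_zero : rho 0 = 0 := by simp [rho]

lemma rho_prime_pow {p : ℕ} (hp : p.Prime) (k : ℕ) :
    rho (p ^ k) = ∑ i ∈ range (k + 1), hfun (p ^ i) := by
  rw [rho_eq, ArithmeticFunction.mul_zeta_apply, Nat.sum_divisors_prime_pow hp]

lemma rho_two_pow (k : ℕ) : rho (2 ^ (k + 1)) = 3 := by
  rw [rho_prime_pow Nat.prime_two, sum_range_succ', sum_range_succ', sum_eq_zero]
  · simp [hfun_apply]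
  · intro i _
    have : 4 ∣ 2 ^ (i + 1 + 1) := ⟨2 ^ i, by ring⟩
    simp [hfun_apply, this]

lemma rho_odd_prime_pow {p : ℕ} (hp : p.Prime) (h2 : p ≠ 2) (k : ℕ) :
    rho (p ^ k) = ∑ i ∈ range (k + 1), p ^ i := by
  rw [rho_prime_pow hp]
  refine sum_congr rfl fun i _ => ?_
  have : ¬ 4 ∣ p ^ i := by
    intro h
    have : 2 ∣ p := Nat.prime_two.dvd_of_dvd_pow (Dvd.dvd.trans (by norm_num) h)
    exact h2 ((Nat.prime_dvd_prime_iff_eq Nat.prime_two hp).mp this).symm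
  simp [hfun_apply, this]

/-- The summand of the Dirichlet series of the square of `rho`. -/
noncomputable def dser (s : ℂ) (n : ℕ) : ℂ := (rho n : ℂ) ^ 2 * (n : ℂ) ^ (-s)

lemma dser_summable {s : ℂ} (hs : 5 < s.re) : Summable fun n => ‖dser s n‖ := by
  have h1 : Summable fun n : ℕ => 1 / (n : ℝ) ^ (s.re - 4) :=
    Real.summable_one_div_nat_rpow.mpr (by linarith)
  refine Summable.of_nonneg_of_le (fun _ => norm_nonneg _) (fun n => ?_) h1
  rcases Nat.eq_zero_or_pos n with rfl | hn
  · simp [dser, rho_zero]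
    positivity
  have hn' : (0 : ℝ) < n := by exact_mod_cast hn
  rw [dser, norm_mul, norm_pow, Complex.norm_natCast, Complex.norm_natCast_cpow_of_pos hn,
    Complex.neg_re, one_div, ← Real.rpow_neg hn'.le]
  have h2 : (rho n : ℝ) ≤ (n : ℝ) ^ 2 := by exact_mod_cast rho_le n
  calc (rho n : ℝ) ^ 2 * (n : ℝ) ^ (-s.re) ≤ ((n : ℝ) ^ 2) ^ 2 * (n : ℝ) ^ (-s.re) := by gcongr
    _ = (n : ℝ) ^ (-(s.re - 4)) := by
      rw [← pow_mul, ← Real.rpow_natCast, ← Real.rpow_add hn']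
      congr 1; push_cast; ring

lemma hasSum_local {P x : ℂ} (hP : P ≠ 1) (h0 : ‖x‖ < 1) (h1 : ‖P * x‖ < 1) (h2 : ‖P ^ 2 * x‖ < 1) :
    HasSum (fun e : ℕ => (∑ i ∈ range (e + 1), P ^ i) ^ 2 * x ^ e)
      ((1 + P * x) * ((1 - x)⁻¹ * (1 - P * x)⁻¹ * (1 - P ^ 2 * x)⁻¹)) := by
  have a0 : 1 - x ≠ 0 := fun h => by
    rw [← sub_eq_zero.mp h] at h0; simp at h0
  have a1 : 1 - P * x ≠ 0 := fun h => by
    rw [← sub_eq_zero.mp h] at h1; simp at h1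
  have a2 : 1 - P ^ 2 * x ≠ 0 := fun h => by
    rw [← sub_eq_zero.mp h] at h2; simp at h2
  have hP' : P - 1 ≠ 0 := sub_ne_zero.mpr hP
  have := (((hasSum_geometric_of_norm_lt_one h2).mul_left (P ^ 2)).sub
    ((hasSum_geometric_of_norm_lt_one h1).mul_left (2 * P))).add
    (hasSum_geometric_of_norm_lt_one h0)
  have := this.mul_left (((P - 1) ^ 2)⁻¹)
  have e1 : ∀ e : ℕ, (∑ i ∈ range (e + 1), P ^ i) ^ 2 * x ^ e = ((P - 1) ^ 2)⁻¹ *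
      (P ^ 2 * (P ^ 2 * x) ^ e - 2 * P * (P * x) ^ e + x ^ e) := by
    intro e
    rw [geom_sum_eq hP]
    field_simp
    ring
  have e2 : (1 + P * x) * ((1 - x)⁻¹ * (1 - P * x)⁻¹ * (1 - P ^ 2 * x)⁻¹) = ((P - 1) ^ 2)⁻¹ *
      (P ^ 2 * (1 - P ^ 2 * x)⁻¹ - 2 * P * (1 - P * x)⁻¹ + (1 - x)⁻¹) := by
    field_simp
    ring
  simpa only [e1, e2] using this

lemma hasSum_local_two {x : ℂ} (h0 : ‖x‖ < 1) :
    HasSum (fun e : ℕ => (rho (2 ^ e) : ℂ) ^ 2 * x ^ e) ((1 + 8 * x) * (1 - x)⁻¹) := by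
  have a0 : 1 - x ≠ 0 := fun h => by
    rw [← sub_eq_zero.mp h] at h0; simp at h0
  rw [← hasSum_nat_add_iff' 1]
  have := (hasSum_geometric_of_norm_lt_one h0).mul_left (9 * x)
  have e1 : ∀ e : ℕ, (rho (2 ^ (e + 1)) : ℂ) ^ 2 * x ^ (e + 1) = 9 * x * x ^ e := by
    intro e
    rw [rho_two_pow]
    push_cast
    ring
  have e2 : (1 + 8 * x) * (1 - x)⁻¹ - ∑ i ∈ range 1, (rho (2 ^ i) : ℂ) ^ 2 * x ^ i =
      9 * x * (1 - x)⁻¹ := by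
    simp [rho_one]
    field_simp
    ring
  simpa only [e1, e2] using this

/-- The Euler factor at `2` relative to the generic shape, as a function of `x = 2 ^ (-s)`. -/
noncomputable def twoFac (x : ℂ) : ℂ := (1 + 8 * x) * (1 - 2 * x) * (1 - 4 * x) / (1 + 2 * x)

lemma dser_euler {s : ℂ} (hs : 5 < s.re) :
    (∑' n, dser s n) * riemannZeta (2 * s - 2) =
      riemannZeta s * riemannZeta (s - 1) ^ 2 * riemannZeta (s - 2) * twoFac (2 ^ (-s)) := by
  have hnorm : ∀ p : ℕ, p.Prime → ∀ k : ℝ, k ≤ 4 → (p : ℝ) ^ k * ‖(p : ℂ) ^ (-s)‖ < 1 := by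
    intro p hp k hk
    have hp0 : (0 : ℝ) < p := by exact_mod_cast hp.pos
    have hp1 : (1 : ℝ) < p := by exact_mod_cast hp.one_lt
    rw [Complex.norm_natCast_cpow_of_pos hp.pos, ← Real.rpow_add hp0]
    apply Real.rpow_lt_one_of_one_lt_of_neg hp1
    simp; linarith
  have H := EulerProduct.eulerProduct_hasProd (f := dser s) (by simp [dser, rho_one])
    (by
      intro m n hmn
      simp only [dser, rho_mul hmn]
      push_cast
      rw [Complex.natCast_mul_natCast_cpow]
      ring)
    (dser_summable hs) (by simp [dser, rho_zero])
  have Z1 := riemannZeta_eulerProduct_hasProd (s := s) (by linarith)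
  have Z2 := riemannZeta_eulerProduct_hasProd (s := s - 1) (by simp; linarith)
  have Z3 := riemannZeta_eulerProduct_hasProd (s := s - 2) (by simp; linarith)
  have Z4 := riemannZeta_eulerProduct_hasProd (s := 2 * s - 2) (by simp; linarith)
  have W := hasProd_ite_eq (⟨2, Nat.prime_two⟩ : Nat.Primes) (twoFac (2 ^ (-s)))
  have e1 := H.mul Z4
  have e2 := ((Z1.mul (Z2.mul Z2)).mul Z3).mul W
  rw [pow_two]
  refine e1.unique ?_
  convert e2 using 1
  ext ⟨p, hp⟩
  have hp0 : (p : ℂ) ≠ 0 := by exact_mod_cast hp.ne_zero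
  set x : ℂ := (p : ℂ) ^ (-s) with hx
  have c1 : (p : ℂ) ^ (-(s - 1)) = p * x := by
    rw [neg_sub, sub_eq_add_neg, Complex.cpow_add _ _ hp0, Complex.cpow_one]
  have c2 : (p : ℂ) ^ (-(s - 2)) = p ^ 2 * x := by
    rw [neg_sub, sub_eq_add_neg, Complex.cpow_add _ _ hp0, Complex.cpow_ofNat]
  have c3 : (p : ℂ) ^ (-(2 * s - 2)) = p ^ 2 * x ^ 2 := by
    rw [neg_sub, sub_eq_add_neg, Complex.cpow_add _ _ hp0, Complex.cpow_ofNat,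
      show -(2 * s) = -s + -s by ring, Complex.cpow_add _ _ hp0]
    ring
  have n0 : ‖x‖ < 1 := by simpa using hnorm p hp 0 (by norm_num)
  have n1 : ‖(p : ℂ) * x‖ < 1 := by
    rw [norm_mul, Complex.norm_natCast]
    simpa using hnorm p hp 1 (by norm_num)
  have n2 : ‖(p : ℂ) ^ 2 * x‖ < 1 := by
    rw [norm_mul, norm_pow, Complex.norm_natCast]
    have := hnorm p hp (2 : ℕ) (by norm_num)
    rwa [Real.rpow_natCast] at this
  have ne : ∀ z : ℂ, ‖z‖ < 1 → 1 - z ≠ 0 := by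
    intro z hz h
    rw [← sub_eq_zero.mp h] at hz; simp at hz
  have ne' : ∀ z : ℂ, ‖z‖ < 1 → 1 + z ≠ 0 := by
    intro z hz h
    exact ne (-z) (by simpa) (by simpa using h)
  have hd : ∀ e : ℕ, dser s (p ^ e) = (rho (p ^ e) : ℂ) ^ 2 * x ^ e := by
    intro e
    rw [dser, hx]
    push_cast
    rw [← Complex.natCast_cpow_natCast_mul, ← Complex.cpow_nat_mul, mul_comm]
  have a0 := ne _ n0
  have a1 := ne _ n1
  have a2 := ne _ n2
  have a3 := ne' _ n1
  simp only [hd, c1, c2, c3, Subtype.mk.injEq]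
  have a4 : (1 : ℂ) - p ^ 2 * x ^ 2 = (1 - p * x) * (1 + p * x) := by ring
  by_cases h2 : p = 2
  · subst h2
    have n0' := n0
    rw [(hasSum_local_two n0).tsum_eq, a4]
    have hx2 : (2 : ℂ) ^ (-s) = x := by rw [hx]; norm_num
    simp only [if_true, hx2, twoFac]
    push_cast at a1 a2 a3 ⊢
    rw [show (2 : ℂ) ^ 2 = 4 by norm_num] at a2 ⊢
    field_simp
    have a5 : 1 - x * 4 ≠ 0 := by rwa [mul_comm]
    rw [mul_div_mul_right _ _ a5]
  · rw [if_neg h2, a4]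
    have hP1 : (p : ℂ) ≠ 1 := by exact_mod_cast hp.one_lt.ne'
    have := (hasSum_local hP1 n0 n1 n2).tsum_eq
    have e3 : ∀ e, (rho (p ^ e) : ℂ) = ∑ i ∈ range (e + 1), (p : ℂ) ^ i := by
      intro e; rw [rho_odd_prime_pow hp h2]; push_cast; rfl
    simp only [e3, this]
    field_simp

end FourSq

namespace FourSq

lemma hasSum_prod_pow {a : ℤ → ℂ} (ha : Summable fun n => ‖a n‖) (k : ℕ) :
    HasSum (fun v : Fin k → ℤ => ∏ i, a (v i)) ((∑' n, a n) ^ k) ∧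
      Summable fun v : Fin k → ℤ => ‖∏ i, a (v i)‖ := by
  induction k with
  | zero =>
    constructor
    · simp
    · exact (hasSum_unique _).summable
  | succ k ih =>
    have key : (fun v : Fin (k + 1) → ℤ => ∏ i, a (v i)) ∘ (Fin.consEquiv fun _ => ℤ) =
        fun p : ℤ × (Fin k → ℤ) => a p.1 * ∏ i, a (p.2 i) := by
      ext p
      simp [Fin.prod_univ_succ, Fin.consEquiv]
    have hs := ha.mul_norm ih.2
    constructor
    · rw [← (Fin.consEquiv fun _ => ℤ).hasSum_iff, key, pow_succ', ← ih.1.tsum_eq,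
        tsum_mul_tsum_of_summable_norm ha ih.2]
      exact hs.of_norm.hasSum
    · rw [← (Fin.consEquiv fun _ => ℤ).summable_iff]
      change Summable fun p =>
        ‖((fun v : Fin (k + 1) → ℤ => ∏ i, a (v i)) ∘ (Fin.consEquiv fun _ => ℤ)) p‖
      rw [key]
      exact hs

lemma summable_theta_term {τ : ℂ} (hτ : 0 < τ.im) :
    Summable fun n : ℤ => ‖Complex.exp (π * Complex.I * (n : ℂ) ^ 2 * τ)‖ := by
  have := (hasSum_jacobiTheta₂_term 0 hτ).summable.norm
  refine this.congr fun n => ?_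
  simp [jacobiTheta₂_term]

/-- The generating function of `rk k` is the `k`-th power of Jacobi's theta function. -/
theorem hasSum_theta_pow (k : ℕ) {τ : ℂ} (hτ : 0 < τ.im) :
    HasSum (fun n : ℕ => (rk k n : ℂ) * Complex.exp (π * Complex.I * n * τ))
      (jacobiTheta τ ^ k) := by
  have h := (hasSum_prod_pow (summable_theta_term hτ) k).1
  rw [← jacobiTheta] at h
  have h2 := h.tsum_fiberwise (fun v : Fin k → ℤ => (∑ i, v i ^ 2).toNat)
  suffices hfun : (fun n : ℕ => (rk k n : ℂ) * Complex.exp (π * Complex.I * n * τ)) = _ from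
    hfun ▸ h2
  funext n
  have hmem : ∀ v : Fin k → ℤ, (∑ i, v i ^ 2).toNat = n ↔ ∑ i, v i ^ 2 = (n : ℤ) := by
    intro v
    have : 0 ≤ ∑ i, v i ^ 2 := Finset.sum_nonneg fun i _ => sq_nonneg _
    omega
  have hc : ∀ b : ((fun v : Fin k → ℤ => (∑ i, v i ^ 2).toNat) ⁻¹' {n}),
      ∏ i, Complex.exp (π * Complex.I * ((b : Fin k → ℤ) i : ℂ) ^ 2 * τ) =
        Complex.exp (π * Complex.I * n * τ) := by
    rintro ⟨v, hv⟩
    have hv' := (hmem v).mp hv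
    rw [← Complex.exp_sum, ← Finset.sum_mul, ← Finset.mul_sum]
    have : (∑ i, (v i : ℂ) ^ 2) = n := by exact_mod_cast hv'
    rw [this]
  simp only [hc]
  rw [tsum_const, nsmul_eq_mul, rk]
  congr 2
  exact Nat.card_congr (Equiv.subtypeEquivRight fun v => (hmem v).symm)

/-- The number of representations as a sum of four squares. -/
noncomputable abbrev r4 (n : ℕ) : ℝ := rk 4 n

lemma r4_nonneg (n : ℕ) : 0 ≤ r4 n := Nat.cast_nonneg _

lemma r4_eq {n : ℕ} (hn : n ≠ 0) : r4 n = 8 * rho n := by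
  rw [r4, rk_four, jacobiR, if_neg hn]; push_cast; ring

lemma r4_zero : r4 0 = 1 := by
  rw [r4, rk_four, jacobiR, if_pos rfl]; norm_num

lemma r4_le (n : ℕ) : r4 n ≤ 8 * (n + 1) ^ 2 := by
  rcases eq_or_ne n 0 with rfl | hn
  · rw [r4_zero]; norm_num
  · rw [r4_eq hn]
    have : (rho n : ℝ) ≤ (n : ℝ) ^ 2 := by exact_mod_cast rho_le n
    have : (0 : ℝ) ≤ n := Nat.cast_nonneg n
    nlinarith

lemma summable_pow_exp (k : ℕ) {a : ℝ} (ha : 0 < a) :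
    Summable fun n : ℕ => ((n : ℝ) + 1) ^ k * Real.exp (-a * n) := by
  have h := (Real.summable_pow_mul_exp_neg_nat_mul k ha)
  have h2 := ((summable_nat_add_iff 1).mpr h).mul_left (Real.exp a)
  refine h2.congr fun n => ?_
  rw [mul_left_comm, ← Real.exp_add]
  push_cast
  congr 2
  ring

lemma summable_r4_pow (k : ℕ) {a : ℝ} (ha : 0 < a) :
    Summable fun n : ℕ => ((n : ℝ) + 1) ^ k * r4 n * Real.exp (-a * n) := by
  refine Summable.of_nonneg_of_le (fun n => ?_) (fun n => ?_)
    ((summable_pow_exp (k + 2) ha).mul_left 8)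
  · have := r4_nonneg n; positivity
  · have h := r4_le n
    calc ((n : ℝ) + 1) ^ k * r4 n * Real.exp (-a * n)
        ≤ ((n : ℝ) + 1) ^ k * (8 * (n + 1) ^ 2) * Real.exp (-a * n) := by gcongr
      _ = _ := by ring

lemma summable_r4 {a : ℝ} (ha : 0 < a) : Summable fun n : ℕ => r4 n * Real.exp (-a * n) := by
  simpa using summable_r4_pow 0 ha

end FourSq

namespace FourSq

open MeasureTheory Set FourierTransform

/-- `π` times the Poisson kernel of the upper half plane. -/
noncomputable def pker (y x : ℝ) : ℝ := y / (x ^ 2 + y ^ 2)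

lemma pker_pos {y : ℝ} (hy : 0 < y) (x : ℝ) : 0 < pker y x := by unfold pker; positivity

lemma continuous_pker {y : ℝ} (hy : 0 < y) : Continuous (pker y) := by
  unfold pker
  exact continuous_const.div (by fun_prop) fun x => by positivity

lemma pker_eq {y : ℝ} (hy : 0 < y) (x : ℝ) : pker y x = y⁻¹ * (1 + (x / y) ^ 2)⁻¹ := by
  unfold pker
  field_simp
  ring

lemma integrable_pker {y : ℝ} (hy : 0 < y) : Integrable (pker y) := by
  rw [show pker y = fun x => y⁻¹ * (1 + (x / y) ^ 2)⁻¹ from funext (pker_eq hy)]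
  exact (integrable_inv_one_add_sq.comp_div hy.ne').const_mul _

lemma integral_pker {y : ℝ} (hy : 0 < y) : ∫ x, pker y x = π := by
  simp_rw [pker_eq hy]
  rw [integral_const_mul, Measure.integral_comp_div (fun x : ℝ => (1 + x ^ 2)⁻¹),
    integral_univ_inv_one_add_sq, abs_of_pos hy, smul_eq_mul]
  field_simp

lemma fourier_exp_abs {a : ℝ} (ha : 0 < a) (w : ℝ) :
    𝓕 (fun t : ℝ => (Real.exp (-a * |t|) : ℂ)) w = ((2 * a / (a ^ 2 + 4 * π ^ 2 * w ^ 2) : ℝ) : ℂ) ∧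
    Integrable fun t : ℝ => (Real.exp (-a * |t|) : ℂ) := by
  have h1 : (-(a : ℂ) - 2 * π * w * Complex.I).re < 0 := by simpa
  have h2 : 0 < ((a : ℂ) - 2 * π * w * Complex.I).re := by simpa
  have i1 := integrableOn_exp_mul_complex_Ioi h1 0
  have i2 := integrableOn_exp_mul_complex_Iic h2 0
  have e1 : EqOn (fun t : ℝ => Complex.exp (↑(-2 * π * t * w) * Complex.I) •
      (Real.exp (-a * |t|) : ℂ)) (fun t : ℝ => Complex.exp ((-(a : ℂ) - 2 * π * w * Complex.I) * t))
      (Ioi 0) := by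
    intro t ht
    simp only [smul_eq_mul, Complex.ofReal_exp, ← Complex.exp_add, abs_of_pos (mem_Ioi.mp ht)]
    congr 1
    push_cast
    ring
  have e2 : EqOn (fun t : ℝ => Complex.exp (↑(-2 * π * t * w) * Complex.I) •
      (Real.exp (-a * |t|) : ℂ)) (fun t : ℝ => Complex.exp (((a : ℂ) - 2 * π * w * Complex.I) * t))
      (Iic 0) := by
    intro t ht
    simp only [smul_eq_mul, Complex.ofReal_exp, ← Complex.exp_add, abs_of_nonpos (mem_Iic.mp ht)]
    congr 1
    push_cast
    ring
  have j1 := i1.congr_fun e1.symm measurableSet_Ioi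
  have j2 := i2.congr_fun e2.symm measurableSet_Iic
  constructor
  · rw [Real.fourier_real_eq_integral_exp_smul, ← intervalIntegral.integral_Iic_add_Ioi j2 j1,
      setIntegral_congr_fun measurableSet_Iic e2, setIntegral_congr_fun measurableSet_Ioi e1,
      integral_exp_mul_complex_Ioi h1, integral_exp_mul_complex_Iic h2]
    have n1 : (-(a : ℂ) - 2 * π * w * Complex.I) ≠ 0 := fun h => by simp [h] at h1
    have n2 : ((a : ℂ) - 2 * π * w * Complex.I) ≠ 0 := fun h => by simp [h] at h2
    have n3 : ((a : ℂ) ^ 2 + 4 * π ^ 2 * w ^ 2) ≠ 0 := by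
      have : (0 : ℝ) < a ^ 2 + 4 * π ^ 2 * w ^ 2 := by positivity
      exact_mod_cast this.ne'
    push_cast
    simp only [mul_zero, Complex.exp_zero]
    rw [div_add_div _ _ n2 n1, div_eq_div_iff (mul_ne_zero n2 n1) n3]
    ring_nf
    simp only [Complex.I_sq]
    ring
  · have h0 : 0 < (a : ℂ).re := by simpa
    have h0' : (-(a : ℂ)).re < 0 := by simpa
    have k1 := integrableOn_exp_mul_complex_Ioi h0' 0
    have k2 := integrableOn_exp_mul_complex_Iic h0 0
    rw [← integrableOn_univ, ← Iic_union_Ioi (a := (0 : ℝ))]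
    refine IntegrableOn.union ?_ ?_
    · refine k2.congr_fun (fun t ht => ?_) measurableSet_Iic
      simp [abs_of_nonpos (mem_Iic.mp ht)]
    · refine k1.congr_fun (fun t ht => ?_) measurableSet_Ioi
      simp [abs_of_pos (mem_Ioi.mp ht)]

lemma integral_cexp_pker {y : ℝ} (hy : 0 < y) (h : ℝ) :
    ∫ x : ℝ, Complex.exp (h * x * Complex.I) * (pker y x : ℂ) = π * Real.exp (-y * |h|) := by
  have ha : 0 < 2 * π * y := by positivity
  have hF : 𝓕 (fun t : ℝ => (Real.exp (-(2 * π * y) * |t|) : ℂ)) = fun w =>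
      ((π⁻¹ * pker y w : ℝ) : ℂ) := by
    ext w
    rw [(fourier_exp_abs ha w).1]
    congr 1
    unfold pker
    field_simp
    ring
  have hint : Integrable fun w => ((π⁻¹ * pker y w : ℝ) : ℂ) :=
    ((integrable_pker hy).const_mul _).ofReal
  have hc : Continuous fun t : ℝ => (Real.exp (-(2 * π * y) * |t|) : ℂ) := by fun_prop
  have inv := hc.fourierInv_fourier_eq (fourier_exp_abs ha 0).2 (by rw [hF]; exact hint)
  have inv' := congrFun inv (h / (2 * π))
  rw [hF, Real.fourierInv_eq'] at inv'
  have : ∫ v : ℝ, Complex.exp (h * v * Complex.I) * (pker y v : ℂ) =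
      π * ∫ v : ℝ, Complex.exp (↑(2 * π * inner ℝ v (h / (2 * π))) * Complex.I) •
        ((π⁻¹ * pker y v : ℝ) : ℂ) := by
    rw [← integral_const_mul]
    refine integral_congr_ae (Filter.Eventually.of_forall fun v => ?_)
    have hpi : (π : ℂ) ≠ 0 := by exact_mod_cast Real.pi_ne_zero
    have e1 : 2 * π * inner ℝ v (h / (2 * π)) = h * v := by
      simp only [RCLike.inner_apply, conj_trivial]
      field_simp
    simp only [e1, smul_eq_mul]
    push_cast
    field_simp
  rw [this, inv', abs_div, abs_of_pos (by positivity : 0 < 2 * π)]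
  congr 3
  field_simp

lemma integrable_cos_pker {y : ℝ} (hy : 0 < y) (h : ℝ) :
    Integrable fun x : ℝ => Real.cos (h * x) * pker y x := by
  refine (integrable_pker hy).bdd_mul (c := 1) (by fun_prop) ?_
  exact Filter.Eventually.of_forall fun x => by simpa using Real.abs_cos_le_one _

lemma integral_cos_pker {y : ℝ} (hy : 0 < y) (h : ℝ) :
    ∫ x : ℝ, Real.cos (h * x) * pker y x = π * Real.exp (-y * |h|) := by
  have h1 := integral_cexp_pker hy h
  have hi : Integrable fun x : ℝ => Complex.exp (h * x * Complex.I) * (pker y x : ℂ) := by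
    refine (integrable_pker hy).ofReal.bdd_mul (c := 1) (by fun_prop) ?_
    refine Filter.Eventually.of_forall fun x => ?_
    rw [← Complex.ofReal_mul, Complex.norm_exp_ofReal_mul_I]
  have h2 := congrArg Complex.re h1
  rw [← RCLike.re_to_complex, ← integral_re hi] at h2
  rw [← Complex.ofReal_mul, Complex.ofReal_re] at h2
  rw [← h2]
  refine integral_congr_ae (Filter.Eventually.of_forall fun x => ?_)
  simp only [RCLike.re_to_complex, Complex.re_mul_ofReal, ← Complex.ofReal_mul,
    Complex.exp_ofReal_mul_I_re]

end FourSq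

namespace FourSq

open MeasureTheory Set

/-- The invariant height of the fourth power of Jacobi's theta function. -/
noncomputable def Fth (z : ℂ) : ℝ := z.im ^ 2 * ‖jacobiTheta z‖ ^ 8

lemma summable_r4_pair {a : ℝ} (ha : 0 < a) :
    Summable fun p : ℕ × ℕ => r4 p.1 * r4 p.2 * Real.exp (-a * (p.1 + p.2)) := by
  have h := summable_r4 ha
  have h2 := h.mul_of_nonneg h (fun n => mul_nonneg (r4_nonneg n) (Real.exp_pos _).le)
    (fun n => mul_nonneg (r4_nonneg n) (Real.exp_pos _).le)
  refine h2.congr fun p => ?_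
  rw [mul_add, Real.exp_add]
  ring

lemma hasSum_norm_theta (x : ℝ) {y : ℝ} (hy : 0 < y) :
    HasSum (fun p : ℕ × ℕ => r4 p.1 * r4 p.2 * Real.exp (-(π * y) * (p.1 + p.2)) *
      Real.cos (π * (p.1 - p.2) * x)) (‖jacobiTheta (x + y * Complex.I)‖ ^ 8) := by
  set z : ℂ := x + y * Complex.I with hz
  have hzi : 0 < z.im := by simp [hz, hy]
  have h := hasSum_theta_pow 4 hzi
  have hn : Summable fun n : ℕ => ‖(rk 4 n : ℂ) * Complex.exp (π * Complex.I * n * z)‖ := by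
    refine (summable_r4 (a := π * y) (by positivity)).congr fun n => ?_
    rw [norm_mul, Complex.norm_natCast, Complex.norm_exp]
    congr 2
    simp [hz]
    ring
  have hn' : Summable fun n : ℕ =>
      ‖starRingEnd ℂ ((rk 4 n : ℂ) * Complex.exp (π * Complex.I * n * z))‖ := by
    simpa only [RCLike.norm_conj] using hn
  have hp := summable_mul_of_summable_norm hn hn'
  have hs := hp.hasSum
  rw [← tsum_mul_tsum_of_summable_norm hn hn', ← Complex.conj_tsum, h.tsum_eq,
    Complex.mul_conj] at hs
  have hre := Complex.hasSum_re hs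
  rw [Complex.ofReal_re, Complex.normSq_eq_norm_sq, norm_pow, ← pow_mul] at hre
  suffices hfun : (fun p : ℕ × ℕ => r4 p.1 * r4 p.2 * Real.exp (-(π * y) * (p.1 + p.2)) *
      Real.cos (π * (p.1 - p.2) * x)) = _ from hfun ▸ hre
  funext p
  have hc : starRingEnd ℂ ((rk 4 p.2 : ℂ) * Complex.exp (π * Complex.I * p.2 * z)) =
      (rk 4 p.2 : ℂ) * Complex.exp (-(π * Complex.I * p.2 * (x - y * Complex.I))) := by
    rw [map_mul, Complex.conj_natCast, ← Complex.exp_conj]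
    congr 2
    simp only [hz, map_mul, map_add, Complex.conj_I, Complex.conj_ofReal, Complex.conj_natCast]
    ring
  have he : (π * Complex.I * p.1 * z : ℂ) + -(π * Complex.I * p.2 * (x - y * Complex.I)) =
      ((-(π * y) * (p.1 + p.2) : ℝ) : ℂ) + ((π * (p.1 - p.2) * x : ℝ) : ℂ) * Complex.I := by
    rw [hz]
    push_cast
    linear_combination (π * p.1 * y + π * p.2 * y) * Complex.I_sq
  rw [hc, mul_mul_mul_comm, ← Complex.exp_add, he, Complex.exp_add, ← Complex.ofReal_exp,
    ← Complex.ofReal_natCast, ← Complex.ofReal_natCast, ← Complex.ofReal_mul, ← mul_assoc,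
    ← Complex.ofReal_mul, Complex.re_ofReal_mul, Complex.exp_ofReal_mul_I_re]

lemma Fth_eq (x : ℝ) {y : ℝ} (hy : 0 < y) :
    Fth (x + y * Complex.I) = y ^ 2 * ∑' p : ℕ × ℕ, r4 p.1 * r4 p.2 *
      Real.exp (-(π * y) * (p.1 + p.2)) * Real.cos (π * (p.1 - p.2) * x) := by
  rw [(hasSum_norm_theta x hy).tsum_eq, Fth]
  simp

lemma integral_Fth_pker {y : ℝ} (hy : 0 < y) :
    ∫ x : ℝ, Fth (x + y * Complex.I) * pker y x = π * y ^ 2 * ∑' p : ℕ × ℕ,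
      r4 p.1 * r4 p.2 * Real.exp (-(2 * π * y) * (max p.1 p.2 : ℕ)) := by
  set c : ℕ × ℕ → ℝ := fun p => r4 p.1 * r4 p.2 * Real.exp (-(π * y) * (p.1 + p.2)) with hc
  have hcs : Summable c := summable_r4_pair (by positivity)
  have hc0 : ∀ p, 0 ≤ c p := fun p =>
    mul_nonneg (mul_nonneg (r4_nonneg _) (r4_nonneg _)) (Real.exp_pos _).le
  have h := hasSum_integral_of_summable_integral_norm (μ := volume)
    (F := fun (p : ℕ × ℕ) (x : ℝ) => c p * (Real.cos (π * (p.1 - p.2) * x) * pker y x))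
    (fun p => (integrable_cos_pker hy _).const_mul _) (by
      refine Summable.of_nonneg_of_le (fun p => integral_nonneg fun x => norm_nonneg _)
        (fun p => ?_) (hcs.mul_right π)
      have hcp : c p * π = ∫ x, c p * pker y x := by rw [integral_const_mul, integral_pker hy]
      rw [hcp]
      refine integral_mono_of_nonneg (Filter.Eventually.of_forall fun x => norm_nonneg _)
        ((integrable_pker hy).const_mul _) (Filter.Eventually.of_forall fun x => ?_)
      simp only [norm_mul, Real.norm_eq_abs, abs_of_nonneg (hc0 p), abs_of_pos (pker_pos hy x)]
      have := mul_le_mul_of_nonneg_right (Real.abs_cos_le_one (π * (p.1 - p.2) * x))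
        (pker_pos hy x).le
      rw [one_mul] at this
      exact mul_le_mul_of_nonneg_left this (hc0 p))
  have e1 : ∀ p : ℕ × ℕ, ∫ x : ℝ, c p * (Real.cos (π * (p.1 - p.2) * x) * pker y x) =
      π * (r4 p.1 * r4 p.2 * Real.exp (-(2 * π * y) * (max p.1 p.2 : ℕ))) := by
    intro p
    rw [integral_const_mul, integral_cos_pker hy, hc]
    have : Real.exp (-(2 * π * y) * (max p.1 p.2 : ℕ)) = Real.exp (-(π * y) * (p.1 + p.2)) *
        Real.exp (-y * |π * (p.1 - p.2)|) := by
      rw [← Real.exp_add, abs_mul, abs_of_pos Real.pi_pos]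
      congr 1
      rcases le_total p.1 p.2 with h | h
      · have h' : (p.1 : ℝ) ≤ p.2 := by exact_mod_cast h
        rw [max_eq_right h, abs_of_nonpos (by linarith)]
        ring
      · have h' : (p.2 : ℝ) ≤ p.1 := by exact_mod_cast h
        rw [max_eq_left h, abs_of_nonneg (by linarith)]
        ring
    rw [this]
    ring
  simp only [e1] at h
  have h2 := h.tsum_eq
  rw [tsum_mul_left] at h2
  rw [mul_assoc, mul_left_comm, h2, ← integral_const_mul]
  refine integral_congr_ae (Filter.Eventually.of_forall fun x => ?_)
  simp only [Fth_eq x hy]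
  simp only [← mul_assoc]
  rw [tsum_mul_right]
  ring

lemma integral_cos_period (k : ℤ) : ∫ x in (0 : ℝ)..2, Real.cos (π * k * x) =
    if k = 0 then 2 else 0 := by
  split_ifs with h
  · simp [h]
  · have hk : π * k ≠ 0 := mul_ne_zero Real.pi_ne_zero (by exact_mod_cast h)
    rw [intervalIntegral.integral_comp_mul_left (fun x => Real.cos x) hk, integral_cos]
    have : Real.sin (π * k * 2) = 0 := by
      rw [show π * k * 2 = ((2 * k : ℤ) : ℝ) * π by push_cast; ring]
      exact Real.sin_int_mul_pi _
    simp [this]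

lemma integral_Fth_period {y : ℝ} (hy : 0 < y) :
    ∫ x in (0 : ℝ)..2, Fth (x + y * Complex.I) = 2 * y ^ 2 * ∑' n : ℕ,
      r4 n ^ 2 * Real.exp (-(2 * π * y) * n) := by
  set c : ℕ × ℕ → ℝ := fun p => r4 p.1 * r4 p.2 * Real.exp (-(π * y) * (p.1 + p.2)) with hc
  have hcs : Summable c := summable_r4_pair (by positivity)
  have hc0 : ∀ p, 0 ≤ c p := fun p =>
    mul_nonneg (mul_nonneg (r4_nonneg _) (r4_nonneg _)) (Real.exp_pos _).le
  have hi : ∀ p : ℕ × ℕ, Integrable (fun x : ℝ => c p * Real.cos (π * (p.1 - p.2) * x))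
      (volume.restrict (Ioc (0 : ℝ) 2)) := fun p =>
    (Continuous.integrableOn_Icc (by fun_prop)).mono_set Ioc_subset_Icc_self
  have h := hasSum_integral_of_summable_integral_norm (μ := volume.restrict (Ioc (0 : ℝ) 2))
    (F := fun (p : ℕ × ℕ) (x : ℝ) => c p * Real.cos (π * (p.1 - p.2) * x)) hi (by
      refine Summable.of_nonneg_of_le (fun p => integral_nonneg fun x => norm_nonneg _)
        (fun p => ?_) (hcs.mul_right 2)
      have : c p * 2 = ∫ x in Ioc (0 : ℝ) 2, c p := by simp [mul_comm]
      rw [this]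
      refine integral_mono_of_nonneg (Filter.Eventually.of_forall fun x => norm_nonneg _)
        (integrable_const _) (Filter.Eventually.of_forall fun x => ?_)
      simp only [norm_mul, Real.norm_eq_abs, abs_of_nonneg (hc0 p)]
      exact mul_le_of_le_one_right (hc0 p) (Real.abs_cos_le_one _))
  have e1 : ∀ p : ℕ × ℕ, ∫ x in Ioc (0 : ℝ) 2, c p * Real.cos (π * (p.1 - p.2) * x) =
      if p.1 = p.2 then 2 * (r4 p.1 ^ 2 * Real.exp (-(2 * π * y) * p.1)) else 0 := by
    intro p
    rw [integral_const_mul, ← intervalIntegral.integral_of_le (by norm_num)]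
    have := integral_cos_period (p.1 - p.2 : ℤ)
    push_cast at this
    rw [this]
    by_cases hp : p.1 = p.2
    · simp only [hc, hp, sub_self, if_true]
      rw [show -(π * y) * ((p.2 : ℝ) + p.2) = -(2 * π * y) * p.2 by ring]
      ring
    · have : ¬ ((p.1 : ℤ) - p.2 = 0) := by omega
      simp [hp, this]
  simp only [e1] at h
  have h2 := h.tsum_eq
  rw [h.summable.tsum_prod] at h2
  have e2 : ∀ b : ℕ, (∑' c : ℕ, if b = c then
      2 * (r4 b ^ 2 * Real.exp (-(2 * π * y) * b)) else 0) =
      2 * (r4 b ^ 2 * Real.exp (-(2 * π * y) * b)) := fun b => by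
    rw [tsum_eq_single b fun c hcb => if_neg (Ne.symm hcb), if_pos rfl]
  simp only [e2] at h2
  rw [tsum_mul_left] at h2
  rw [mul_right_comm, h2, intervalIntegral.integral_of_le (by norm_num), ← integral_mul_const]
  refine integral_congr_ae (Filter.Eventually.of_forall fun x => ?_)
  simp only [Fth_eq x hy, hc]
  ring

end FourSq

namespace FourSq

open MeasureTheory Set

/-- The general term `v² / |c z + d|⁴` of the real-analytic Eisenstein series at `s = 2`. -/
noncomputable def eterm (p : ℤ × ℤ) (z : ℂ) : ℝ := z.im ^ 2 / ‖(p.1 : ℂ) * z + p.2‖ ^ 4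

/-- The Eisenstein series at `s = 2` with weight `w` on the lattice. -/
noncomputable def Gs (w : ℤ × ℤ → ℝ) (z : ℂ) : ℝ := ∑' p, w p * eterm p z

/-- Indicator of the pairs with odd sum. -/
noncomputable def w0 (p : ℤ × ℤ) : ℝ := if Odd (p.1 + p.2) then 1 else 0

/-- Indicator of the pairs with odd second entry. -/
noncomputable def w1 (p : ℤ × ℤ) : ℝ := if Odd p.2 then 1 else 0

/-- Indicator of the pairs with odd first entry. -/
noncomputable def w2 (p : ℤ × ℤ) : ℝ := if Odd p.1 then 1 else 0

lemma w0_mem (p : ℤ × ℤ) : 0 ≤ w0 p ∧ w0 p ≤ 1 := by unfold w0; split_ifs <;> norm_num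
lemma w1_mem (p : ℤ × ℤ) : 0 ≤ w1 p ∧ w1 p ≤ 1 := by unfold w1; split_ifs <;> norm_num
lemma w2_mem (p : ℤ × ℤ) : 0 ≤ w2 p ∧ w2 p ≤ 1 := by unfold w2; split_ifs <;> norm_num

lemma eterm_nonneg (p : ℤ × ℤ) (z : ℂ) : 0 ≤ eterm p z := by unfold eterm; positivity

lemma summable_eterm (z : UpperHalfPlane) : Summable fun p => eterm p z := by
  have h := (EisensteinSeries.summable_one_div_norm_rpow (k := 4) (by norm_num)).mul_left
    ((z.im) ^ 2 * EisensteinSeries.r z ^ (-4 : ℝ))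
  rw [← (finTwoArrowEquiv ℤ).symm.summable_iff] at h
  refine Summable.of_nonneg_of_le (fun p => eterm_nonneg p z) (fun p => ?_) h
  have h1 := EisensteinSeries.summand_bound z (k := 4) (by norm_num) ![p.1, p.2]
  simp only [Matrix.cons_val_zero, Matrix.cons_val_one] at h1
  rw [eterm, div_eq_mul_inv]
  simp only [Function.comp, finTwoArrowEquiv_symm_apply, mul_assoc]
  refine mul_le_mul_of_nonneg_left ?_ (sq_nonneg _)
  refine le_trans (le_of_eq ?_) h1
  rw [Real.rpow_neg (norm_nonneg _)]
  congr 1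
  norm_cast

lemma summable_weight_eterm {w : ℤ × ℤ → ℝ} (hw : ∀ p, 0 ≤ w p ∧ w p ≤ 1) (z : UpperHalfPlane) :
    Summable fun p => w p * eterm p z :=
  Summable.of_nonneg_of_le (fun p => mul_nonneg (hw p).1 (eterm_nonneg p z))
    (fun p => mul_le_of_le_one_left (eterm_nonneg p z) (hw p).2) (summable_eterm z)

/-- The shear `(c, d) ↦ (c, c k + d)`. -/
def shear (k : ℤ) : ℤ × ℤ ≃ ℤ × ℤ where
  toFun p := (p.1, p.1 * k + p.2)
  invFun p := (p.1, p.2 - p.1 * k)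
  left_inv p := by simp
  right_inv p := by simp

/-- The rotation `(c, d) ↦ (d, -c)`. -/
def rot : ℤ × ℤ ≃ ℤ × ℤ where
  toFun p := (p.2, -p.1)
  invFun p := (-p.2, p.1)
  left_inv p := by simp
  right_inv p := by simp

lemma eterm_add_int (p : ℤ × ℤ) (k : ℤ) (z : ℂ) :
    eterm p (z + k) = eterm (shear k p) z := by
  simp only [eterm, shear, Equiv.coe_fn_mk, Complex.add_im, Complex.intCast_im, add_zero]
  congr 3
  push_cast
  ring

lemma eterm_neg_inv (p : ℤ × ℤ) {z : ℂ} (hz : z ≠ 0) :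
    eterm p (-z⁻¹) = eterm (rot p) z := by
  have hn : ‖z‖ ≠ 0 := norm_ne_zero_iff.2 hz
  have h1 : (p.1 : ℂ) * (-z⁻¹) + p.2 = (p.2 * z + (-p.1 : ℤ)) / z := by
    field_simp
    push_cast
    ring
  simp only [eterm, rot, Equiv.coe_fn_mk]
  rw [h1, norm_div, Complex.neg_im, Complex.inv_im, Complex.normSq_eq_norm_sq, div_pow]
  by_cases h0 : ‖(p.2 : ℂ) * z + (-p.1 : ℤ)‖ = 0
  · simp only [h0]; simp
  · field_simp

lemma Gs_add_int (w : ℤ × ℤ → ℝ) (k : ℤ) (z : ℂ) :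
    Gs w (z + k) = Gs (fun p => w ((shear k).symm p)) z := by
  unfold Gs
  rw [← (shear k).tsum_eq (fun p => w ((shear k).symm p) * eterm p z)]
  simp only [Equiv.symm_apply_apply, eterm_add_int]

lemma Gs_neg_inv (w : ℤ × ℤ → ℝ) {z : ℂ} (hz : z ≠ 0) :
    Gs w (-z⁻¹) = Gs (fun p => w (rot.symm p)) z := by
  unfold Gs
  rw [← rot.tsum_eq (fun p => w (rot.symm p) * eterm p z)]
  simp only [Equiv.symm_apply_apply, eterm_neg_inv _ hz]

lemma Gs_w0_add_one (z : ℂ) : Gs w0 (z + 1) = Gs w1 z := by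
  have h := Gs_add_int w0 1 z
  rw [Int.cast_one] at h
  rw [h]
  congr 1
  funext p
  simp [w0, w1, shear]

lemma Gs_w0_add_two (z : ℂ) : Gs w0 (z + 2) = Gs w0 z := by
  have h := Gs_add_int w0 2 z
  rw [Int.cast_ofNat] at h
  rw [h]
  congr 1
  funext p
  simp only [w0, shear, Equiv.coe_fn_symm_mk]
  have : Odd (p.1 + (p.2 - p.1 * 2)) ↔ Odd (p.1 + p.2) := by
    simp only [Int.odd_iff]; omega
  simp only [this]

lemma Gs_w0_neg_inv {z : ℂ} (hz : z ≠ 0) : Gs w0 (-z⁻¹) = Gs w0 z := by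
  rw [Gs_neg_inv w0 hz]
  congr 1
  funext p
  simp only [w0, rot, Equiv.coe_fn_symm_mk]
  have : Odd (-p.2 + p.1) ↔ Odd (p.1 + p.2) := by
    simp only [Int.odd_iff]; omega
  simp only [this]

lemma Gs_w1_neg_inv {z : ℂ} (hz : z ≠ 0) : Gs w1 (-z⁻¹) = Gs w2 z := by
  rw [Gs_neg_inv w1 hz]
  congr 1

/-- The deviation of `Fth` from its Eisenstein part. -/
noncomputable def B0 (z : ℂ) : ℝ := Fth z - Gs w0 z / (π ^ 4 / 48)

/-- The expansion of `B0` at the cusp `∞`, shifted by one. -/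
noncomputable def B1 (z : ℂ) : ℝ := B0 (z + 1)

/-- The expansion of `B0` at the cusp `1`. -/
noncomputable def B2 (z : ℂ) : ℝ := B1 (-z⁻¹)

lemma Fth_add_two (z : ℂ) : Fth (z + 2) = Fth z := by
  rw [Fth, Fth, add_comm z 2, jacobiTheta_two_add]
  simp

lemma Fth_neg_inv {z : ℂ} (hz : 0 < z.im) : Fth (-z⁻¹) = Fth z := by
  have hz0 : z ≠ 0 := fun h => by simp [h] at hz
  have h := jacobiTheta_S_smul ⟨z, hz⟩
  rw [UpperHalfPlane.modular_S_smul] at h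
  have h' : jacobiTheta (-z⁻¹) = (-Complex.I * z) ^ (1 / 2 : ℂ) * jacobiTheta z := by
    rw [← inv_neg]
    exact h
  have hn : ‖z‖ ≠ 0 := norm_ne_zero_iff.2 hz0
  have h8 : ‖(-Complex.I * z) ^ (1 / 2 : ℂ)‖ ^ 8 = ‖z‖ ^ 4 := by
    have h2 : ((-Complex.I * z) ^ (1 / 2 : ℂ)) ^ 2 = -Complex.I * z := by
      rw [← Complex.cpow_nat_mul]
      norm_num
    rw [← norm_pow, show (8 : ℕ) = 2 * 4 by norm_num, pow_mul, h2, norm_pow]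
    simp
  rw [Fth, Fth, h', norm_mul, mul_pow, h8, Complex.neg_im, Complex.inv_im,
    Complex.normSq_eq_norm_sq]
  field_simp

lemma B0_add_two (z : ℂ) : B0 (z + 2) = B0 z := by
  rw [B0, B0, Fth_add_two, Gs_w0_add_two]

lemma B0_neg_inv {z : ℂ} (hz : 0 < z.im) : B0 (-z⁻¹) = B0 z := by
  have hz0 : z ≠ 0 := fun h => by simp [h] at hz
  rw [B0, B0, Fth_neg_inv hz, Gs_w0_neg_inv hz0]

lemma im_neg_inv_pos {z : ℂ} (hz : 0 < z.im) : 0 < (-z⁻¹).im := by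
  have := UpperHalfPlane.im_inv_neg_coe_pos ⟨z, hz⟩
  rwa [inv_neg] at this

lemma B1_add_one (z : ℂ) : B1 (z + 1) = B0 z := by
  rw [B1, add_assoc, one_add_one_eq_two, B0_add_two]

lemma B2_neg_inv (z : ℂ) : B2 (-z⁻¹) = B1 z := by simp [B2, inv_neg]

lemma B2_add_one {z : ℂ} (hz : 0 < z.im) : B2 (z + 1) = B2 z := by
  have hz0 : z ≠ 0 := fun h => by simp [h] at hz
  have hz1 : z + 1 ≠ 0 := fun h => by
    have : (z + 1).im = 0 := by rw [h]; simp
    simp at this; linarith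
  have h1 : -(z + 1)⁻¹ + 1 = -(-z⁻¹ - 1)⁻¹ := by
    have : (-z⁻¹ - 1) = -(z + 1) / z := by field_simp; ring
    rw [this]
    field_simp
    ring
  have him : 0 < (-z⁻¹ - 1).im := by simpa using im_neg_inv_pos hz
  rw [B2, B1, h1, B0_neg_inv him, ← B0_add_two, B2, B1]
  congr 1
  ring

end FourSq

namespace FourSq

open MeasureTheory Set

lemma hasSum_int_of_even {f : ℤ → ℝ} (hf : ∀ n, f (-n) = f n) (h0 : f 0 = 0) {s : ℝ}
    (h : HasSum (fun n : ℕ => f n) s) : HasSum f (2 * s) := by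
  have h2 : HasSum (fun n : ℕ => f (-n)) s := by simpa only [hf] using h
  have := HasSum.of_nat_of_neg h h2
  rwa [h0, sub_zero, ← two_mul] at this

lemma hasSum_nat_odd_pow {k : ℕ} {s : ℝ} (h : HasSum (fun n : ℕ => 1 / (n : ℝ) ^ k) s) :
    HasSum (fun n : ℕ => if Odd n then 1 / (n : ℝ) ^ k else 0) (s - s / 2 ^ k) ∧
    HasSum (fun n : ℕ => if Odd n then 0 else 1 / (n : ℝ) ^ k) (s / 2 ^ k) := by
  have he : HasSum (fun n : ℕ => if Odd n then 0 else 1 / (n : ℝ) ^ k) (s / 2 ^ k) := by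
    have h1 := h.div_const (2 ^ k)
    have hinj : Function.Injective fun n : ℕ => 2 * n := fun a b hab => by simpa using hab
    refine (hinj.hasSum_iff ?_).1 ?_
    · intro n hn
      rw [if_pos]
      by_contra hodd
      rw [Nat.not_odd_iff_even] at hodd
      obtain ⟨m, hm⟩ := hodd
      exact hn ⟨m, by simp only; omega⟩
    · suffices hfun : ((fun n : ℕ => if Odd n then 0 else 1 / (n : ℝ) ^ k) ∘ fun n : ℕ => 2 * n) = _
        from hfun ▸ h1
      funext n
      simp only [Function.comp]
      rw [if_neg (by simp), div_div]
      push_cast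
      rw [mul_pow, mul_comm]
  refine ⟨?_, he⟩
  have h3 := h.sub he
  suffices hfun : (fun n : ℕ => if Odd n then 1 / (n : ℝ) ^ k else 0) = _ from hfun ▸ h3
  funext n
  split_ifs <;> simp

lemma hasSum_int_odd_four :
    HasSum (fun d : ℤ => if Odd d then 1 / (d : ℝ) ^ 4 else 0) (π ^ 4 / 48) := by
  have h := (hasSum_nat_odd_pow hasSum_zeta_four).1
  have := hasSum_int_of_even (f := fun d : ℤ => if Odd d then 1 / (d : ℝ) ^ 4 else 0)
    (fun n => by simp [Int.odd_iff, Even.neg_pow (by decide : Even 4)]) (by simp) (by simpa using h)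
  rwa [show 2 * (π ^ 4 / 90 - π ^ 4 / 90 / 2 ^ 4) = π ^ 4 / 48 by ring] at this

lemma hasSum_int_odd_two :
    HasSum (fun d : ℤ => if Odd d then 1 / (d : ℝ) ^ 2 else 0) (π ^ 2 / 4) := by
  have h := (hasSum_nat_odd_pow hasSum_zeta_two).1
  have := hasSum_int_of_even (f := fun d : ℤ => if Odd d then 1 / (d : ℝ) ^ 2 else 0)
    (fun n => by simp [Int.odd_iff]) (by simp) (by simpa using h)
  rwa [show 2 * (π ^ 2 / 6 - π ^ 2 / 6 / 2 ^ 2) = π ^ 2 / 4 by ring] at this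

lemma hasSum_int_even_two :
    HasSum (fun d : ℤ => if Odd d then 0 else 1 / (d : ℝ) ^ 2) (π ^ 2 / 12) := by
  have h := (hasSum_nat_odd_pow hasSum_zeta_two).2
  have := hasSum_int_of_even (f := fun d : ℤ => if Odd d then 0 else 1 / (d : ℝ) ^ 2)
    (fun n => by simp [Int.odd_iff]) (by simp) (by simpa using h)
  rwa [show 2 * (π ^ 2 / 6 / 2 ^ 2) = π ^ 2 / 12 by ring] at this

/-- Shifted sums of the Poisson kernel over the integers are comparable to its integral. -/
lemma sum_pker_shift (s : ℝ) {T : ℝ} (hT : 1 / 2 ≤ T) :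
    Summable (fun d : ℤ => pker T (s + d)) ∧ ∑' d : ℤ, pker T (s + d) ≤ 9 * π := by
  have hT0 : 0 < T := by linarith
  have hs := ((integrable_pker hT0).hasSum_intervalIntegral s).mul_left 9
  rw [integral_pker hT0] at hs
  have hle : ∀ d : ℤ, pker T (s + d) ≤ 9 * ∫ x in s + d..s + d + 1, pker T x := by
    intro d
    rw [← intervalIntegral.integral_const_mul]
    have h1 : pker T (s + d) = ∫ x in s + d..s + d + 1, pker T (s + d) := by simp
    rw [h1]
    refine intervalIntegral.integral_mono_on (by linarith) (by simp)
      (((continuous_pker hT0).const_mul 9).intervalIntegrable _ _) fun x hx => ?_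
    unfold pker
    rw [← mul_div_assoc, div_le_div_iff₀ (by positivity) (by positivity)]
    have h3 : x ^ 2 ≤ 2 * (s + d) ^ 2 + 2 := by nlinarith [hx.1, hx.2, sq_nonneg (x - 2 * (s + d))]
    nlinarith [mul_nonneg hT0.le (sq_nonneg (s + d))]
  have hsum : Summable fun d : ℤ => pker T (s + d) :=
    Summable.of_nonneg_of_le (fun d => (pker_pos hT0 _).le) hle hs.summable
  exact ⟨hsum, (hsum.tsum_le_tsum hle hs.summable).trans hs.tsum_eq.le⟩

/-- The part of the Eisenstein series away from the constant terms. -/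
noncomputable def Hs (w : ℤ × ℤ → ℝ) (z : ℂ) : ℝ :=
  ∑' p : ℤ × ℤ, if p.1 = 0 then 0 else w p * eterm p z

lemma summable_Hs {w : ℤ × ℤ → ℝ} (hw : ∀ p, 0 ≤ w p ∧ w p ≤ 1) (z : UpperHalfPlane) :
    Summable fun p : ℤ × ℤ => if p.1 = 0 then 0 else w p * eterm p z := by
  refine Summable.of_nonneg_of_le (fun p => ?_) (fun p => ?_) (summable_weight_eterm hw z)
  · split_ifs
    exacts [le_rfl, mul_nonneg (hw p).1 (eterm_nonneg p z)]
  · split_ifs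
    exacts [mul_nonneg (hw p).1 (eterm_nonneg p z), le_rfl]

lemma Hs_nonneg {w : ℤ × ℤ → ℝ} (hw : ∀ p, 0 ≤ w p ∧ w p ≤ 1) (z : ℂ) : 0 ≤ Hs w z :=
  tsum_nonneg fun p => by
    split_ifs
    exacts [le_rfl, mul_nonneg (hw p).1 (eterm_nonneg p z)]

lemma norm_lin_sq (c d : ℝ) (z : ℂ) :
    ‖(c : ℂ) * z + d‖ ^ 2 = (c * z.re + d) ^ 2 + (c * z.im) ^ 2 := by
  rw [← Complex.normSq_eq_norm_sq, Complex.normSq_apply]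
  simp
  ring

lemma eterm_eq (p : ℤ × ℤ) (z : ℂ) :
    eterm p z = z.im ^ 2 / ((p.1 * z.re + p.2) ^ 2 + (p.1 * z.im) ^ 2) ^ 2 := by
  have h := norm_lin_sq p.1 p.2 z
  push_cast at h
  rw [eterm, ← h, ← pow_mul]

lemma eterm_le_pker {c : ℤ} (hc : c ≠ 0) (d : ℤ) {z : ℂ} (hz : 0 < z.im) :
    eterm (c, d) z ≤ 1 / (|(c : ℝ)| ^ 3 * z.im) * pker (|(c : ℝ)| * z.im) (c * z.re + d) := by
  have hc' : 0 < |(c : ℝ)| := abs_pos.2 (by exact_mod_cast hc)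
  have hT : 0 < |(c : ℝ)| * z.im := mul_pos hc' hz
  rw [eterm_eq, pker]
  simp only
  rw [show ((c : ℝ) * z.im) ^ 2 = (|(c : ℝ)| * z.im) ^ 2 by rw [mul_pow, mul_pow, sq_abs]]
  set a := |(c : ℝ)|
  set v := z.im
  set x := (c : ℝ) * z.re + d
  have e : 1 / (a ^ 3 * v) * (a * v / (x ^ 2 + (a * v) ^ 2)) =
      v ^ 2 / ((x ^ 2 + (a * v) ^ 2) * (a * v) ^ 2) := by
    field_simp
  rw [e]
  apply div_le_div_of_nonneg_left (sq_nonneg v) (by positivity)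
  rw [sq (x ^ 2 + (a * v) ^ 2)]
  exact mul_le_mul_of_nonneg_left (by nlinarith [sq_nonneg x]) (by positivity)

lemma Hs_le : ∃ C : ℝ, 0 < C ∧ ∀ w : ℤ × ℤ → ℝ, (∀ p, 0 ≤ w p ∧ w p ≤ 1) →
    ∀ z : UpperHalfPlane, 1 / 2 ≤ z.im → Hs w z ≤ C / z.im := by
  have h3 : Summable fun c : ℤ => 1 / |(c : ℝ)| ^ 3 := by
    have := (Real.summable_one_div_int_pow (p := 3)).2 (by norm_num)
    refine this.abs.congr fun c => ?_
    rw [abs_div, abs_one, abs_pow]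
  refine ⟨9 * π * ∑' c : ℤ, 1 / |(c : ℝ)| ^ 3 + 1, by positivity, fun w hw z hz => ?_⟩
  have hv : 0 < z.im := z.im_pos
  have hsum := summable_Hs hw z
  rw [Hs, hsum.tsum_prod]
  have hin : ∀ c : ℤ, (∑' d : ℤ, if c = 0 then 0 else w (c, d) * eterm (c, d) z) ≤
      9 * π / z.im * (1 / |(c : ℝ)| ^ 3) := by
    intro c
    by_cases hc : c = 0
    · simp [hc]
    · simp only [if_neg hc]
      have hc1 : 1 ≤ |(c : ℝ)| := by
        rw [← Int.cast_abs]; exact_mod_cast Int.one_le_abs hc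
      have hT : 1 / 2 ≤ |(c : ℝ)| * z.im := by nlinarith
      obtain ⟨hs, hb⟩ := sum_pker_shift (c * z.re) hT
      have hs' := hs.mul_left (1 / (|(c : ℝ)| ^ 3 * z.im))
      have hle : ∀ d : ℤ, w (c, d) * eterm (c, d) z ≤
          1 / (|(c : ℝ)| ^ 3 * z.im) * pker (|(c : ℝ)| * z.im) (c * z.re + d) := fun d =>
        (mul_le_of_le_one_left (eterm_nonneg _ _) (hw _).2).trans (eterm_le_pker hc d hv)
      have hs2 := Summable.of_nonneg_of_le
        (fun d => mul_nonneg (hw (c, d)).1 (eterm_nonneg (c, d) z)) hle hs'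
      refine (hs2.tsum_le_tsum hle hs').trans ?_
      rw [tsum_mul_left]
      refine (mul_le_mul_of_nonneg_left hb (by positivity)).trans (le_of_eq ?_)
      field_simp
  have h4 := h3.mul_left (9 * π / z.im)
  refine (hsum.prod.tsum_le_tsum hin h4).trans ?_
  rw [tsum_mul_left, add_div, div_mul_eq_mul_div]
  have : 0 < 1 / z.im := by positivity
  linarith

lemma Gs_eq_Hs_add {w : ℤ × ℤ → ℝ} (hw : ∀ p, 0 ≤ w p ∧ w p ≤ 1) {s : ℝ}
    (h : HasSum (fun d : ℤ => w (0, d) * (1 / (d : ℝ) ^ 4)) s) (z : UpperHalfPlane) :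
    Gs w z = Hs w z + s * z.im ^ 2 := by
  have h1 := (summable_Hs hw z).hasSum
  have h2 : HasSum (fun p : ℤ × ℤ => if p.1 = 0 then w p * eterm p z else 0) (s * z.im ^ 2) := by
    have hinj : Function.Injective fun d : ℤ => ((0 : ℤ), d) := fun a b hab => by simpa using hab
    refine (hinj.hasSum_iff ?_).1 ?_
    · rintro ⟨c, d⟩ hp
      rw [if_neg]
      rintro rfl
      exact hp ⟨d, rfl⟩
    · have := h.mul_right (z.im ^ 2)
      suffices hfun : ((fun p : ℤ × ℤ => if p.1 = 0 then w p * eterm p z else 0) ∘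
        fun d : ℤ => ((0 : ℤ), d)) = _ from hfun ▸ this
      funext d
      simp only [Function.comp, if_true, eterm_eq]
      rw [UpperHalfPlane.coe_im]
      simp
      rw [← pow_mul]
      ring
  have h3 := (h1.add h2).tsum_eq
  rw [Gs, Hs, ← h3]
  refine tsum_congr fun p => ?_
  split_ifs <;> simp

lemma Gs_w0_eq (z : UpperHalfPlane) : Gs w0 z = Hs w0 z + π ^ 4 / 48 * z.im ^ 2 :=
  Gs_eq_Hs_add w0_mem (by
    simpa only [w0, zero_add, ite_mul, one_mul, zero_mul] using hasSum_int_odd_four) z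

lemma Gs_w1_eq (z : UpperHalfPlane) : Gs w1 z = Hs w1 z + π ^ 4 / 48 * z.im ^ 2 :=
  Gs_eq_Hs_add w1_mem (by
    simpa only [w1, zero_add, ite_mul, one_mul, zero_mul] using hasSum_int_odd_four) z

lemma Gs_w2_eq (z : UpperHalfPlane) : Gs w2 z = Hs w2 z := by
  have := Gs_eq_Hs_add w2_mem (s := 0) (by simp [w2, hasSum_zero]) z
  rwa [zero_mul, add_zero] at this

lemma dist_SL_smul (g : Matrix.SpecialLinearGroup (Fin 2) ℤ) (z z' : UpperHalfPlane) :
    dist (g • z) (g • z') = dist z z' := by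
  have h : ∀ u : UpperHalfPlane,
      g • u = (Matrix.SpecialLinearGroup.map (Int.castRingHom ℝ) g) • u := fun u => by
    apply UpperHalfPlane.ext
    rw [UpperHalfPlane.coe_specialLinearGroup_apply, UpperHalfPlane.coe_specialLinearGroup_apply]
    simp
  rw [h, h, dist_smul]

lemma eterm_le_exp_dist {p : ℤ × ℤ} (hp : p.1 ≠ 0) (z z' : UpperHalfPlane) :
    eterm p z' ≤ Real.exp (2 * dist z z') * eterm p z := by
  have hc : (p.1 : ℝ) ≠ 0 := by exact_mod_cast hp
  have key : ∀ u : UpperHalfPlane, eterm p u = (1 / (p.1 : ℝ) ^ 4) *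
      (ModularGroup.S • (((p.2 : ℝ) / p.1) +ᵥ u)).im ^ 2 := by
    intro u
    rw [UpperHalfPlane.modular_S_smul, eterm_eq]
    have hu : u.im ≠ 0 := u.im_pos.ne'
    have hpos : (u.re + p.2 / p.1 : ℝ) ^ 2 + u.im ^ 2 ≠ 0 := by
      have := u.im_pos
      positivity
    have e : ((p.1 : ℝ) * u.re + p.2) ^ 2 + (p.1 * u.im) ^ 2 =
        (p.1 : ℝ) ^ 2 * ((u.re + p.2 / p.1 : ℝ) ^ 2 + u.im ^ 2) := by
      field_simp
    have e2 : (UpperHalfPlane.mk ((-((((p.2 : ℝ) / p.1) +ᵥ u : UpperHalfPlane) : ℂ))⁻¹)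
        (UpperHalfPlane.im_inv_neg_coe_pos _)).im =
        u.im / ((u.re + p.2 / p.1 : ℝ) ^ 2 + u.im ^ 2) := by
      rw [UpperHalfPlane.mk_im, Complex.inv_im, Complex.normSq_apply]
      simp
      ring
    rw [e2, UpperHalfPlane.coe_re, UpperHalfPlane.coe_im, e]
    field_simp
  rw [key, key, mul_left_comm]
  refine mul_le_mul_of_nonneg_left ?_ (by positivity)
  have h1 := UpperHalfPlane.im_le_im_mul_exp_dist (ModularGroup.S • (((p.2 : ℝ) / p.1) +ᵥ z'))
    (ModularGroup.S • (((p.2 : ℝ) / p.1) +ᵥ z))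
  have h2 : dist (ModularGroup.S • (((p.2 : ℝ) / p.1) +ᵥ z'))
      (ModularGroup.S • (((p.2 : ℝ) / p.1) +ᵥ z)) = dist z z' := by
    rw [dist_SL_smul, (UpperHalfPlane.isometry_real_vadd _).dist_eq, dist_comm]
  rw [h2] at h1
  calc _ ≤ _ := pow_le_pow_left₀ (UpperHalfPlane.im_pos _).le h1 2
    _ = _ := by rw [mul_pow, ← Real.exp_nat_mul]; push_cast; ring

lemma Hs_le_exp_dist {w : ℤ × ℤ → ℝ} (hw : ∀ p, 0 ≤ w p ∧ w p ≤ 1) (z z' : UpperHalfPlane) :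
    Hs w z' ≤ Real.exp (2 * dist z z') * Hs w z := by
  rw [Hs, Hs, ← tsum_mul_left]
  refine (summable_Hs hw z').tsum_le_tsum (fun p => ?_) ((summable_Hs hw z).mul_left _)
  split_ifs with h
  · simp
  · rw [mul_left_comm]
    exact mul_le_mul_of_nonneg_left (eterm_le_exp_dist h z z') (hw p).1

lemma exp_sub_one_le {x : ℝ} (hx : 0 ≤ x) (hx1 : x ≤ 2) : Real.exp x - 1 ≤ 9 * x := by
  have h1 : 1 - x ≤ Real.exp (-x) := by linarith [Real.add_one_le_exp (-x)]
  have h2 : Real.exp x * Real.exp (-x) = 1 := by rw [← Real.exp_add]; simp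
  have h3 : Real.exp x ≤ 9 := by
    have : Real.exp x ≤ Real.exp 2 := Real.exp_le_exp.2 hx1
    have h4 : Real.exp 2 = Real.exp 1 ^ 2 := by rw [← Real.exp_nat_mul]; norm_num
    nlinarith [Real.exp_one_lt_d9, Real.exp_pos 1]
  nlinarith [Real.exp_pos x]

lemma Hs_lipschitz {w : ℤ × ℤ → ℝ} (hw : ∀ p, 0 ≤ w p ∧ w p ≤ 1) {z z' : UpperHalfPlane}
    (h : dist z z' ≤ 1) : |Hs w z - Hs w z'| ≤ 18 * dist z z' * Hs w z := by
  have h1 := Hs_le_exp_dist hw z z'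
  have h2 := Hs_le_exp_dist hw z' z
  rw [dist_comm] at h2
  have h3 := exp_sub_one_le (x := 2 * dist z z') (by positivity) (by linarith)
  have h0 := Hs_nonneg hw (z : ℂ)
  have h0' := Hs_nonneg hw (z' : ℂ)
  have h5 : Real.exp (2 * dist z z') * Real.exp (-(2 * dist z z')) = 1 := by
    rw [← Real.exp_add]; simp
  have h6 : 1 - 2 * dist z z' ≤ Real.exp (-(2 * dist z z')) := by
    linarith [Real.add_one_le_exp (-(2 * dist z z'))]
  have h7 : Real.exp (-(2 * dist z z')) * Hs w z ≤ Hs w z' := by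
    have := mul_le_mul_of_nonneg_left h2 (Real.exp_pos (-(2 * dist z z'))).le
    nlinarith
  have hd : 0 ≤ dist z z' := dist_nonneg
  rw [abs_le]
  constructor
  · nlinarith
  · nlinarith [mul_nonneg hd h0]

end FourSq

namespace FourSq

open MeasureTheory Set

/-- Functions on the upper half plane which are `O(1/v)` and Lipschitz with constant `O(1/v)` for
the hyperbolic distance, high in the cusp. -/
def CuspNice (Q : ℂ → ℝ) : Prop :=
  ∃ C : ℝ, 0 < C ∧ ∀ z : UpperHalfPlane, 1 / 2 ≤ z.im → |Q z| ≤ C / z.im ∧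
    ∀ z' : UpperHalfPlane, dist z z' ≤ 1 → |Q z - Q z'| ≤ C * dist z z' / z.im

lemma CuspNice.sub {P Q : ℂ → ℝ} (hP : CuspNice P) (hQ : CuspNice Q) :
    CuspNice fun z => P z - Q z := by
  obtain ⟨C, hC, h1⟩ := hP
  obtain ⟨D, hD, h2⟩ := hQ
  refine ⟨C + D, by positivity, fun z hz => ⟨?_, fun z' hd => ?_⟩⟩
  · rw [add_div]
    exact (abs_sub _ _).trans (add_le_add (h1 z hz).1 (h2 z hz).1)
  · rw [add_mul, add_div, sub_sub_sub_comm]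
    exact (abs_sub _ _).trans (add_le_add ((h1 z hz).2 z' hd) ((h2 z hz).2 z' hd))

lemma cuspNice_Hs {w : ℤ × ℤ → ℝ} (hw : ∀ p, 0 ≤ w p ∧ w p ≤ 1) (k : ℝ) :
    CuspNice fun z => Hs w z / k := by
  obtain ⟨C, hC, h⟩ := Hs_le
  have hk : 0 ≤ |k|⁻¹ := by positivity
  refine ⟨18 * C * |k|⁻¹ + 1, by positivity, fun z hz => ?_⟩
  have hv := z.im_pos
  have h1 := h w hw z hz
  constructor
  · rw [abs_div, abs_of_nonneg (Hs_nonneg hw _), div_eq_mul_inv, add_div]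
    have : 0 ≤ C / z.im * |k|⁻¹ := by positivity
    have h2 := mul_le_mul_of_nonneg_right h1 hk
    have h3 : 18 * C * |k|⁻¹ / z.im = 18 * (C / z.im * |k|⁻¹) := by ring
    have h4 : 0 < 1 / z.im := by positivity
    rw [h3]
    linarith
  · intro z' hd
    have hL := Hs_lipschitz hw hd
    rw [← sub_div, abs_div, div_eq_mul_inv]
    have h2 : 18 * dist z z' * Hs w z ≤ 18 * dist z z' * (C / z.im) :=
      mul_le_mul_of_nonneg_left h1 (by positivity)
    have h3 := mul_le_mul_of_nonneg_right (hL.trans h2) hk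
    refine h3.trans ?_
    have h4 : 0 ≤ dist z z' / z.im := by positivity
    have h5 : (18 * C * |k|⁻¹ + 1) * dist z z' / z.im =
      18 * dist z z' * (C / z.im) * |k|⁻¹ + dist z z' / z.im := by ring
    rw [h5]
    linarith

lemma sq_mul_exp_le {β v : ℝ} (hβ : 0 < β) (hv : 0 < v) :
    v ^ 2 * Real.exp (-(β * v)) ≤ 6 / β ^ 3 / v := by
  have h := Real.pow_div_factorial_le_exp (β * v) (by positivity) 3
  rw [Real.exp_neg, ← div_eq_mul_inv, div_le_iff₀ (Real.exp_pos _)]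
  have h2 : v ^ 2 = 6 / β ^ 3 / v * ((β * v) ^ 3 / (Nat.factorial 3 : ℕ)) := by
    have : ((Nat.factorial 3 : ℕ) : ℝ) = 6 := by norm_num [Nat.factorial]
    rw [this]
    field_simp
  rw [h2]
  exact mul_le_mul_of_nonneg_left h (by positivity)

lemma dist_coe_le_mul {z z' : UpperHalfPlane} (h : dist z z' ≤ 1) :
    ‖(z' : ℂ) - z‖ ≤ z.im * (9 * dist z z') := by
  have h1 := UpperHalfPlane.dist_coe_le z' z
  rw [dist_comm z' z, dist_eq_norm] at h1
  refine h1.trans (mul_le_mul_of_nonneg_left ?_ z.im_pos.le)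
  exact exp_sub_one_le dist_nonneg (by linarith)

lemma cuspNice_of_decay {h : ℂ → ℂ} {K α κ : ℝ} (hK : 0 < K) (hα : 0 < α) (hκ : |κ| ≤ 1)
    (hd : ∀ z : ℂ, 0 < z.im → DifferentiableAt ℂ h z)
    (hb : ∀ z : ℂ, 1 / 10 ≤ z.im → ‖h z‖ ≤ K * Real.exp (-(α * z.im))) :
    CuspNice fun z => z.im ^ 2 * (‖(κ : ℂ) + h z‖ ^ 2 - κ ^ 2) := by
  set β := α / 5 with hβ
  have hβ0 : 0 < β := by positivity
  have hκn : ‖(κ : ℂ)‖ ≤ 1 := by simpa using hκ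
  refine ⟨189 * (2 + 2 * K) * K * (6 / β ^ 3), by positivity, fun z hz => ?_⟩
  have hv := z.im_pos
  set v := z.im with hvdef
  set E := K * Real.exp (-(β * v)) with hE
  have hE0 : 0 < E := by positivity
  have hEK : E ≤ K := mul_le_of_le_one_right hK.le (Real.exp_le_one_iff.2 (by
    have := mul_pos hβ0 hv; linarith))
  have hvE : v ^ 2 * E ≤ K * (6 / β ^ 3) / v := by
    have := mul_le_mul_of_nonneg_left (sq_mul_exp_le hβ0 hv) hK.le
    calc v ^ 2 * E = K * (v ^ 2 * Real.exp (-(β * v))) := by rw [hE]; ring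
      _ ≤ _ := this
      _ = _ := by ring
  have hbE : ∀ w : ℂ, v / 5 ≤ w.im → ‖h w‖ ≤ E := by
    intro w hw
    refine (hb w (by linarith)).trans (mul_le_mul_of_nonneg_left (Real.exp_le_exp.2 ?_) hK.le)
    have := mul_le_mul_of_nonneg_left hw hα.le
    rw [hβ]
    linarith
  have hu : ∀ w : ℂ, v / 5 ≤ w.im → |‖(κ : ℂ) + h w‖ ^ 2 - κ ^ 2| ≤ E * (2 + 2 * K) := by
    intro w hw
    have h1 := hbE w hw
    have h2 : |‖(κ : ℂ) + h w‖ - ‖(κ : ℂ)‖| ≤ ‖h w‖ := by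
      have := abs_norm_sub_norm_le ((κ : ℂ) + h w) κ
      rwa [add_sub_cancel_left] at this
    have h3 : ‖(κ : ℂ) + h w‖ ≤ 1 + ‖h w‖ := (norm_add_le _ _).trans (by linarith)
    have h4 : κ ^ 2 = ‖(κ : ℂ)‖ ^ 2 := by simp
    rw [h4, sq_sub_sq, abs_mul, mul_comm,
      abs_of_nonneg (by positivity : 0 ≤ ‖(κ : ℂ) + h w‖ + ‖(κ : ℂ)‖)]
    exact mul_le_mul (h2.trans h1) (by linarith) (by positivity) hE0.le
  refine ⟨?_, fun z' hdist => ?_⟩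
  · change |v ^ 2 * _| ≤ _
    rw [abs_mul, abs_of_nonneg (sq_nonneg v)]
    have h1 := hu z (by rw [UpperHalfPlane.coe_im]; linarith)
    calc _ ≤ v ^ 2 * (E * (2 + 2 * K)) := mul_le_mul_of_nonneg_left h1 (sq_nonneg v)
      _ = v ^ 2 * E * (2 + 2 * K) := by ring
      _ ≤ K * (6 / β ^ 3) / v * (2 + 2 * K) := mul_le_mul_of_nonneg_right hvE (by positivity)
      _ = (2 + 2 * K) * K * (6 / β ^ 3) / v := by ring
      _ ≤ _ := by
        have h2 : 0 ≤ (2 + 2 * K) * K * (6 / β ^ 3) / v := by positivity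
        have h3 : 189 * (2 + 2 * K) * K * (6 / β ^ 3) / v =
          189 * ((2 + 2 * K) * K * (6 / β ^ 3) / v) := by ring
        rw [h3]
        linarith
  · set d := dist z z' with hdd
    have hd0 : 0 ≤ d := dist_nonneg
    have hn := dist_coe_le_mul hdist
    have hexp : v * 3 / 10 ≤ z'.im := by
      have h1 := UpperHalfPlane.im_le_im_mul_exp_dist z z'
      have h2 : Real.exp (dist z z') ≤ 3 :=
        (Real.exp_le_exp.2 hdist).trans (by linarith [Real.exp_one_lt_d9])
      nlinarith [z'.im_pos]
    have hdiff : |v - z'.im| ≤ v * (9 * d) := by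
      have := Complex.abs_im_le_norm ((z' : ℂ) - z)
      rw [Complex.sub_im, UpperHalfPlane.coe_im, UpperHalfPlane.coe_im, abs_sub_comm] at this
      exact this.trans hn
    have hlip : ‖h z' - h z‖ ≤ E / (v / 10) * ‖(z' : ℂ) - z‖ := by
      have hconv : Convex ℝ {w : ℂ | v * 3 / 10 ≤ w.im} := convex_halfSpace_im_ge _
      refine Convex.norm_image_sub_le_of_norm_deriv_le (𝕜 := ℂ)
        (s := {w : ℂ | v * 3 / 10 ≤ w.im}) (fun w hw => hd w ?_)
        (fun w hw => ?_) hconv ?_ ?_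
      · have : v * 3 / 10 ≤ w.im := hw
        linarith
      · have hw' : v * 3 / 10 ≤ w.im := hw
        have him : ∀ x ∈ Metric.closedBall w (v / 10), v / 5 ≤ x.im := by
          intro x hx
          have h1 := Complex.abs_im_le_norm (x - w)
          rw [mem_closedBall_iff_norm] at hx
          rw [Complex.sub_im] at h1
          linarith [neg_abs_le (x.im - w.im)]
        refine Complex.norm_deriv_le_of_forall_mem_sphere_norm_le (by positivity) ?_ ?_
        · refine DifferentiableOn.diffContOnCl fun x hx => ?_
          refine (hd x ?_).differentiableWithinAt
          have := him x (Metric.closure_ball_subset_closedBall hx)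
          linarith
        · intro x hx
          exact hbE x (him x (Metric.sphere_subset_closedBall hx))
      · change v * 3 / 10 ≤ (z : ℂ).im
        rw [UpperHalfPlane.coe_im]; linarith
      · change v * 3 / 10 ≤ (z' : ℂ).im
        rw [UpperHalfPlane.coe_im]; linarith
    have hlip2 : ‖h z' - h z‖ ≤ 90 * E * d := by
      refine hlip.trans ((mul_le_mul_of_nonneg_left hn (by positivity)).trans (le_of_eq ?_))
      field_simp
      ring
    set u := ‖(κ : ℂ) + h z‖ ^ 2 - κ ^ 2 with hudef
    set u' := ‖(κ : ℂ) + h z'‖ ^ 2 - κ ^ 2 with hudef'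
    have hz5 : v / 5 ≤ (z : ℂ).im := by rw [UpperHalfPlane.coe_im]; linarith
    have hz5' : v / 5 ≤ (z' : ℂ).im := by rw [UpperHalfPlane.coe_im]; linarith
    have hu' := hu z' hz5'
    have huu : |u - u'| ≤ 90 * E * d * (2 + 2 * K) := by
      have e : u - u' = (‖(κ : ℂ) + h z‖ - ‖(κ : ℂ) + h z'‖) *
        (‖(κ : ℂ) + h z‖ + ‖(κ : ℂ) + h z'‖) := by rw [hudef, hudef']; ring
      have h1 : |‖(κ : ℂ) + h z‖ - ‖(κ : ℂ) + h z'‖| ≤ ‖h z' - h z‖ := by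
        have := abs_norm_sub_norm_le ((κ : ℂ) + h z) (κ + h z')
        rwa [add_sub_add_left_eq_sub, norm_sub_rev] at this
      have h3 : ‖(κ : ℂ) + h z‖ ≤ 1 + K :=
        (norm_add_le _ _).trans (by linarith [hbE z hz5])
      have h3' : ‖(κ : ℂ) + h z'‖ ≤ 1 + K :=
        (norm_add_le _ _).trans (by linarith [hbE z' hz5'])
      rw [e, abs_mul, abs_of_nonneg (by positivity : 0 ≤ ‖(κ : ℂ) + h z‖ + ‖(κ : ℂ) + h z'‖)]
      exact mul_le_mul (h1.trans hlip2) (by linarith) (by positivity) (by positivity)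
    have hvv : |v ^ 2 - z'.im ^ 2| ≤ 99 * v ^ 2 * d := by
      rw [sq_sub_sq, abs_mul, abs_of_pos (by have := z'.im_pos; positivity), mul_comm]
      have h1 : v + z'.im ≤ 11 * v := by
        have := (abs_le.1 hdiff).1
        nlinarith
      calc _ ≤ v * (9 * d) * (11 * v) :=
            mul_le_mul hdiff h1 (by have := z'.im_pos; positivity) (by positivity)
        _ = _ := by ring
    have e : v ^ 2 * u - z'.im ^ 2 * u' = v ^ 2 * (u - u') + (v ^ 2 - z'.im ^ 2) * u' := by ring
    change |v ^ 2 * u - z'.im ^ 2 * u'| ≤ _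
    rw [e]
    refine (abs_add_le _ _).trans ?_
    rw [abs_mul, abs_mul, abs_of_nonneg (sq_nonneg v)]
    have h1 := mul_le_mul_of_nonneg_left huu (sq_nonneg v)
    have h2 := mul_le_mul hvv hu' (abs_nonneg _) (by positivity)
    have h3 := mul_le_mul_of_nonneg_right hvE (by positivity : 0 ≤ 189 * (2 + 2 * K) * d)
    calc _ ≤ v ^ 2 * (90 * E * d * (2 + 2 * K)) + 99 * v ^ 2 * d * (E * (2 + 2 * K)) :=
          add_le_add h1 h2
      _ = v ^ 2 * E * (189 * (2 + 2 * K) * d) := by ring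
      _ ≤ _ := h3
      _ = _ := by ring

end FourSq

namespace FourSq

open MeasureTheory Set

lemma CuspNice.congr {P Q : ℂ → ℝ} (hP : CuspNice P) (h : ∀ z : UpperHalfPlane, Q z = P z) :
    CuspNice Q := by
  obtain ⟨C, hC, h1⟩ := hP
  refine ⟨C, hC, fun z hz => ?_⟩
  simpa only [h] using h1 z hz

lemma norm_theta_pow_sub_one : ∃ K : ℝ, 0 < K ∧ ∀ z : ℂ, 1 / 10 ≤ z.im →
    ‖jacobiTheta z ^ 4 - 1‖ ≤ K * Real.exp (-(π * z.im)) := by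
  have he : Real.exp (-π * (1 / 10)) < 1 := Real.exp_lt_one_iff.2 (by
    have := Real.pi_pos; linarith)
  set K := 2 / (1 - Real.exp (-π * (1 / 10))) with hK
  have hK0 : 0 < K := div_pos two_pos (by linarith)
  refine ⟨4 * (1 + K) ^ 3 * K, by positivity, fun z hz => ?_⟩
  have hzi : 0 < z.im := by linarith
  have h1 : ‖jacobiTheta z - 1‖ ≤ K * Real.exp (-(π * z.im)) := by
    have := norm_jacobiTheta_sub_one_le hzi
    rw [neg_mul] at this
    refine this.trans (mul_le_mul_of_nonneg_right ?_ (Real.exp_pos _).le)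
    refine div_le_div_of_nonneg_left (by norm_num) (by linarith) ?_
    have : Real.exp (-(π * z.im)) ≤ Real.exp (-π * (1 / 10)) := by
      apply Real.exp_le_exp.2
      nlinarith [Real.pi_pos]
    linarith
  have h2 : ‖jacobiTheta z‖ ≤ 1 + K := by
    have h3 : K * Real.exp (-(π * z.im)) ≤ K := mul_le_of_le_one_right hK0.le
      (Real.exp_le_one_iff.2 (by have := mul_pos Real.pi_pos hzi; linarith))
    have h4 := norm_add_le (jacobiTheta z - 1) 1
    rw [sub_add_cancel, norm_one] at h4
    linarith
  set t := jacobiTheta z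
  have e : t ^ 4 - 1 = (t ^ 3 + t ^ 2 + t + 1) * (t - 1) := by ring
  rw [e, norm_mul, mul_assoc]
  refine mul_le_mul ?_ h1 (norm_nonneg _) (by positivity)
  have h5 : ‖t ^ 3 + t ^ 2 + t + 1‖ ≤ ‖t‖ ^ 3 + ‖t‖ ^ 2 + ‖t‖ + 1 := by
    refine (norm_add_le _ _).trans (add_le_add ((norm_add_le _ _).trans (add_le_add
      ((norm_add_le _ _).trans ?_) le_rfl)) (by simp))
    rw [norm_pow, norm_pow]
  refine h5.trans ?_
  have hm : 1 ≤ 1 + K := by linarith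
  have i3 := pow_le_pow_left₀ (norm_nonneg t) h2 3
  have i2 : ‖t‖ ^ 2 ≤ (1 + K) ^ 3 := (pow_le_pow_left₀ (norm_nonneg t) h2 2).trans
    (pow_le_pow_right₀ hm (by norm_num))
  have i1 : ‖t‖ ≤ (1 + K) ^ 3 := h2.trans (le_self_pow₀ hm (by norm_num))
  have i0 : 1 ≤ (1 + K) ^ 3 := one_le_pow₀ hm
  linarith

lemma cuspNice_B0 : CuspNice B0 := by
  obtain ⟨K, hK, h⟩ := norm_theta_pow_sub_one
  have h1 := cuspNice_of_decay (h := fun z => jacobiTheta z ^ 4 - 1) (κ := 1) hK Real.pi_pos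
    (by simp) (fun z hz => ((differentiableAt_jacobiTheta hz).pow 4).sub_const 1) h
  refine (h1.sub (cuspNice_Hs w0_mem (π ^ 4 / 48))).congr fun z => ?_
  rw [B0, Gs_w0_eq, Fth, add_div, mul_div_cancel_left₀ _ (by positivity)]
  simp
  ring

lemma cuspNice_B1 : CuspNice B1 := by
  obtain ⟨K, hK, h⟩ := norm_theta_pow_sub_one
  have h1 := cuspNice_of_decay (h := fun z => jacobiTheta (z + 1) ^ 4 - 1) (κ := 1) hK Real.pi_pos
    (by simp) (fun z hz => by
      have : DifferentiableAt ℂ (fun z => jacobiTheta (z + 1)) z :=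
        DifferentiableAt.comp (f := fun z : ℂ => z + 1) (g := jacobiTheta) z
          (differentiableAt_jacobiTheta (by simpa using hz)) (by fun_prop)
      exact (this.pow 4).sub_const 1) (fun z hz => by simpa using h (z + 1) (by simpa using hz))
  refine (h1.sub (cuspNice_Hs w1_mem (π ^ 4 / 48))).congr fun z => ?_
  rw [B1, B0, Gs_w0_add_one, Gs_w1_eq, Fth, add_div, mul_div_cancel_left₀ _ (by positivity)]
  simp
  ring

/-- The theta constant `θ₂`. -/
noncomputable def theta2 (z : ℂ) : ℂ :=
  Complex.exp (π * Complex.I * z / 4) * jacobiTheta₂ (-z / 2) z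

lemma differentiableAt_theta2 {z : ℂ} (hz : 0 < z.im) : DifferentiableAt ℂ theta2 z := by
  have h := (hasFDerivAt_jacobiTheta₂ (-z / 2) hz).differentiableAt
  have h2 : DifferentiableAt ℂ (fun w : ℂ => jacobiTheta₂ (-w / 2) w) z :=
    DifferentiableAt.comp (f := fun w : ℂ => (-w / 2, w))
      (g := fun p : ℂ × ℂ => jacobiTheta₂ p.1 p.2) z h (by fun_prop)
  exact DifferentiableAt.mul (by fun_prop) h2

lemma norm_theta2_le : ∃ K : ℝ, 0 < K ∧ ∀ z : ℂ, 1 / 10 ≤ z.im →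
    ‖theta2 z ^ 4‖ ≤ K * Real.exp (-(π * z.im)) := by
  have hs := summable_pow_mul_jacobiTheta₂_term_bound (1 / 20) (T := 1 / 10) (by norm_num) 0
  simp only [pow_zero, one_mul] at hs
  set f : ℤ → ℝ := fun n => Real.exp (-π * (1 / 10 * n ^ 2 - 2 * (1 / 20) * (|n| : ℤ))) with hf
  have hpos : 0 < ∑' n, f n := hs.tsum_pos (fun n => (Real.exp_pos _).le) 0 (Real.exp_pos _)
  refine ⟨(∑' n, f n) ^ 4, by positivity, fun z hz => ?_⟩
  have hzi : 0 < z.im := by linarith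
  have h1 : ‖jacobiTheta₂ (-z / 2) z‖ ≤ ∑' n, f n := by
    rw [← (hasSum_jacobiTheta₂_term (-z / 2) hzi).tsum_eq]
    refine tsum_of_norm_bounded hs.hasSum fun n => ?_
    refine (norm_jacobiTheta₂_term_le (S := z.im / 2) (T := z.im) hzi ?_ le_rfl n).trans ?_
    · rw [show -z / 2 = ((-1 / 2 : ℝ) : ℂ) * z by push_cast; ring, Complex.im_ofReal_mul, abs_mul,
        abs_of_pos hzi]
      norm_num
      linarith
    · apply Real.exp_le_exp.2
      have h2 : ((|n| : ℤ) : ℝ) ≤ (n : ℝ) ^ 2 := by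
        have : |n| ≤ n ^ 2 := by
          rw [← sq_abs]
          exact Int.le_self_sq _
        exact_mod_cast this
      have h3 : 0 ≤ (z.im - 1 / 10) * ((n : ℝ) ^ 2 - (|n| : ℤ)) :=
        mul_nonneg (by linarith) (by linarith)
      nlinarith [Real.pi_pos, mul_nonneg Real.pi_pos.le h3]
  rw [theta2, mul_pow, norm_mul, norm_pow, norm_pow, mul_comm]
  refine mul_le_mul (pow_le_pow_left₀ (norm_nonneg _) h1 4) (le_of_eq ?_) (by positivity)
    (by positivity)
  rw [Complex.norm_exp, ← Real.exp_nat_mul]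
  congr 1
  simp
  ring

lemma Fth_cusp_one {z : ℂ} (hz : 0 < z.im) :
    Fth (-z⁻¹ + 1) = z.im ^ 2 * ‖theta2 z ^ 4‖ ^ 2 := by
  have hz0 : z ≠ 0 := fun h => by simp [h] at hz
  have hn : ‖z‖ ≠ 0 := norm_ne_zero_iff.2 hz0
  have h1 : jacobiTheta (-z⁻¹ + 1) = jacobiTheta₂ (1 / 2) (-z⁻¹) := by
    rw [jacobiTheta_eq_jacobiTheta₂, jacobiTheta₂, jacobiTheta₂]
    refine tsum_congr fun n => ?_
    rw [jacobiTheta₂_term, jacobiTheta₂_term, Complex.exp_eq_exp_iff_exists_int]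
    have hpar : Even (n ^ 2 - n) := by
      have := Int.even_mul_succ_self (n - 1)
      rw [show (n - 1) * (n - 1 + 1) = n ^ 2 - n by ring] at this
      exact this
    obtain ⟨m, hm⟩ := hpar
    refine ⟨m, ?_⟩
    have hm' : (n : ℂ) ^ 2 - n = m + m := by exact_mod_cast hm
    linear_combination π * Complex.I * hm'
  have h2 := jacobiTheta₂_functional_equation (1 / 2) (-z⁻¹)
  have e1 : (1 / 2 : ℂ) / -z⁻¹ = -z / 2 := by field_simp
  have e2 : (-1 : ℂ) / -z⁻¹ = z := by field_simp
  have e3 : -(π : ℂ) * Complex.I * (1 / 2) ^ 2 / -z⁻¹ = π * Complex.I * z / 4 := by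
    field_simp
    ring
  rw [e1, e2, e3, mul_assoc] at h2
  have h8 : ‖(1 / (-Complex.I * -z⁻¹) ^ (1 / 2 : ℂ) : ℂ)‖ ^ 8 = ‖z‖ ^ 4 := by
    have h3 : ((-Complex.I * -z⁻¹) ^ (1 / 2 : ℂ)) ^ 2 = -Complex.I * -z⁻¹ := by
      rw [← Complex.cpow_nat_mul]
      norm_num
    rw [← norm_pow, show (8 : ℕ) = 2 * 4 by norm_num, pow_mul, div_pow, h3, norm_pow]
    simp
  rw [Fth, h1, h2, norm_mul, mul_pow, h8, ← theta2, norm_pow, Complex.add_im, Complex.one_im,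
    Complex.neg_im, Complex.inv_im, Complex.normSq_eq_norm_sq]
  field_simp
  ring

lemma cuspNice_B2 : CuspNice B2 := by
  obtain ⟨K, hK, h⟩ := norm_theta2_le
  have h1 := cuspNice_of_decay (h := fun z => theta2 z ^ 4) (κ := 0) hK Real.pi_pos
    (by simp) (fun z hz => (differentiableAt_theta2 hz).pow 4) h
  refine (h1.sub (cuspNice_Hs w2_mem (π ^ 4 / 48))).congr fun z => ?_
  rw [B2, B1, B0, Gs_w0_add_one, Gs_w1_neg_inv z.ne_zero, Gs_w2_eq, Fth_cusp_one (by
    simpa using z.im_pos)]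
  simp

end FourSq

namespace FourSq

open MeasureTheory Set

/-- The three transforms of `B0` under the modular group. -/
noncomputable def Bc : Fin 3 → ℂ → ℝ := ![B0, B1, B2]

/-- Every transform of `B0` is, after the substitution `z ↦ g • z`, again one of them. -/
def Permutes (g : Matrix.SpecialLinearGroup (Fin 2) ℤ) : Prop :=
  ∀ i, ∃ j, ∀ z : UpperHalfPlane, Bc i z = Bc j ((g • z : UpperHalfPlane) : ℂ)

lemma Permutes.mul {g h : Matrix.SpecialLinearGroup (Fin 2) ℤ} (hg : Permutes g)
    (hh : Permutes h) : Permutes (g * h) := by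
  intro i
  obtain ⟨j, hj⟩ := hh i
  obtain ⟨k, hk⟩ := hg j
  refine ⟨k, fun z => ?_⟩
  rw [hj, hk, mul_smul]

lemma coe_S_smul (z : UpperHalfPlane) :
    ((ModularGroup.S • z : UpperHalfPlane) : ℂ) = -(z : ℂ)⁻¹ := by
  rw [UpperHalfPlane.modular_S_smul]
  simp [inv_neg]

lemma coe_T_smul (z : UpperHalfPlane) :
    ((ModularGroup.T • z : UpperHalfPlane) : ℂ) = z + 1 := by
  rw [UpperHalfPlane.modular_T_smul]
  simp [add_comm]

lemma permutes_S : Permutes ModularGroup.S := by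
  have h : ∀ z : UpperHalfPlane, 0 < (z : ℂ).im := fun z => z.im_pos
  intro i
  fin_cases i
  · refine ⟨0, fun z => ?_⟩
    rw [coe_S_smul]
    exact (B0_neg_inv (h z)).symm
  · refine ⟨2, fun z => ?_⟩
    rw [coe_S_smul]
    exact (B2_neg_inv _).symm
  · refine ⟨1, fun z => ?_⟩
    rw [coe_S_smul]
    rfl

lemma permutes_T : Permutes ModularGroup.T := by
  have h : ∀ z : UpperHalfPlane, 0 < (z : ℂ).im := fun z => z.im_pos
  intro i
  fin_cases i
  · refine ⟨1, fun z => ?_⟩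
    rw [coe_T_smul]
    exact (B1_add_one _).symm
  · refine ⟨0, fun z => ?_⟩
    rw [coe_T_smul]
    rfl
  · refine ⟨2, fun z => ?_⟩
    rw [coe_T_smul]
    exact (B2_add_one (h z)).symm

lemma permutes_T_inv : Permutes ModularGroup.T⁻¹ := by
  have h : ∀ z : UpperHalfPlane, 0 < (z : ℂ).im := fun z => z.im_pos
  have hT : ∀ z : UpperHalfPlane, (z : ℂ) = ((ModularGroup.T⁻¹ • z : UpperHalfPlane) : ℂ) + 1 :=
    fun z => by rw [← coe_T_smul, smul_inv_smul]
  intro i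
  fin_cases i
  · refine ⟨1, fun z => ?_⟩
    conv_lhs => rw [hT z]
    rfl
  · refine ⟨0, fun z => ?_⟩
    conv_lhs => rw [hT z]
    exact B1_add_one _
  · refine ⟨2, fun z => ?_⟩
    conv_lhs => rw [hT z]
    exact B2_add_one (h _)

lemma permutes_S_inv : Permutes ModularGroup.S⁻¹ := by
  have e : ModularGroup.S⁻¹ = ModularGroup.S * (ModularGroup.S * ModularGroup.S) := by
    rw [inv_eq_iff_mul_eq_one]
    decide
  rw [e]
  exact permutes_S.mul (permutes_S.mul permutes_S)

lemma permutes (g : Matrix.SpecialLinearGroup (Fin 2) ℤ) : Permutes g := by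
  suffices h : Permutes g ∧ Permutes g⁻¹ from h.1
  have hg : g ∈ Subgroup.closure {ModularGroup.S, ModularGroup.T} := by
    simp [SpecialLinearGroup.SL2Z_generators]
  induction hg using Subgroup.closure_induction with
  | mem x hx =>
    rcases hx with rfl | rfl
    · exact ⟨permutes_S, permutes_S_inv⟩
    · exact ⟨permutes_T, permutes_T_inv⟩
  | one =>
    have : Permutes 1 := fun i => ⟨i, fun z => by rw [one_smul]⟩
    exact ⟨this, by rwa [inv_one]⟩
  | mul x y _ _ hx hy => exact ⟨hx.1.mul hy.1, by rw [mul_inv_rev]; exact hy.2.mul hx.2⟩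
  | inv x _ hx => exact ⟨hx.2, by rw [inv_inv]; exact hx.1⟩

lemma B0_bounds : ∃ C : ℝ, 0 < C ∧ (∀ z : UpperHalfPlane, |B0 z| ≤ C) ∧
    (∀ z : UpperHalfPlane, |B0 z| ≤ C / z.im) ∧
    (∀ z z' : UpperHalfPlane, |B0 z - B0 z'| ≤ C * dist z z') ∧
    (∀ z z' : UpperHalfPlane, dist z z' ≤ 1 → |B0 z - B0 z'| ≤ C * dist z z' / z.im) := by
  have hc : ∀ i, CuspNice (Bc i) := by
    intro i
    fin_cases i
    exacts [cuspNice_B0, cuspNice_B1, cuspNice_B2]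
  choose c hc0 hc1 using hc
  set C := ∑ i, c i with hC
  have hle : ∀ i, c i ≤ C := fun i => Finset.single_le_sum (f := c) (fun j _ => (hc0 j).le)
    (Finset.mem_univ i)
  have hCpos : 0 < C := (hc0 0).trans_le (hle 0)
  have key : ∀ z : UpperHalfPlane, |B0 z| ≤ 2 * C ∧
      ∀ z' : UpperHalfPlane, dist z z' ≤ 1 → |B0 z - B0 z'| ≤ 2 * C * dist z z' := by
    intro z
    obtain ⟨g, hg⟩ := ModularGroup.exists_smul_mem_fd z
    have him : 1 / 2 ≤ (g • z).im := by
      have := ModularGroup.three_le_four_mul_im_sq_of_mem_fd hg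
      nlinarith [(g • z).im_pos]
    obtain ⟨j, hj⟩ := permutes g 0
    have hj' : ∀ z : UpperHalfPlane, B0 z = Bc j ((g • z : UpperHalfPlane) : ℂ) := hj
    obtain ⟨h1, h2⟩ := hc1 j (g • z) him
    have aux : ∀ t : ℝ, 0 ≤ t → c j * t / (g • z).im ≤ 2 * C * t := by
      intro t ht
      rw [div_le_iff₀ (g • z).im_pos]
      have e1 := mul_le_mul_of_nonneg_right (hle j) ht
      have e2 : C * t * (1 / 2) ≤ C * t * (g • z).im :=
        mul_le_mul_of_nonneg_left him (mul_nonneg hCpos.le ht)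
      linarith
    refine ⟨?_, fun z' hz' => ?_⟩
    · rw [hj' z]
      refine h1.trans ?_
      simpa using aux 1 zero_le_one
    · rw [hj' z, hj' z']
      have h3 := h2 (g • z') (by rwa [dist_SL_smul])
      rw [dist_SL_smul] at h3
      exact h3.trans (aux _ dist_nonneg)
  refine ⟨4 * C, by positivity, fun z => (key z).1.trans (by linarith), fun z => ?_,
    fun z z' => ?_, fun z z' hd => ?_⟩
  · rcases le_or_gt (1 / 2) z.im with h | h
    · refine (hc1 0 z h).1.trans ?_
      gcongr
      linarith [hle 0]
    · rw [le_div_iff₀ z.im_pos]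
      have := mul_le_mul_of_nonneg_right (key z).1 z.im_pos.le
      nlinarith [mul_pos hCpos z.im_pos]
  · rcases le_or_gt (dist z z') 1 with h | h
    · refine ((key z).2 z' h).trans ?_
      have := mul_nonneg hCpos.le (dist_nonneg (x := z) (y := z'))
      linarith
    · have := abs_sub (B0 z) (B0 z')
      have h1 := (key z).1
      have h2 := (key z').1
      nlinarith
  · have hn := mul_nonneg hCpos.le (dist_nonneg (x := z) (y := z'))
    rcases le_or_gt (1 / 2) z.im with h | h
    · refine ((hc1 0 z h).2 z' hd).trans ?_
      gcongr
      linarith [hle 0]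
    · rw [le_div_iff₀ z.im_pos]
      have := mul_le_mul_of_nonneg_right ((key z).2 z' hd) z.im_pos.le
      nlinarith [mul_nonneg hn z.im_pos.le]

lemma continuousOn_B0 : ContinuousOn B0 {z : ℂ | 0 < z.im} := by
  obtain ⟨C, hC, -, -, h, -⟩ := B0_bounds
  have hl : LipschitzWith ⟨C, hC.le⟩ (fun z : UpperHalfPlane => B0 z) :=
    LipschitzWith.of_dist_le_mul fun z z' => by
      rw [Real.dist_eq]
      exact h z z'
  rw [continuousOn_iff_continuous_domRestrict]
  have h2 : Continuous fun z : {z : ℂ | 0 < z.im} => (⟨z.1, z.2⟩ : UpperHalfPlane) := by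
    rw [UpperHalfPlane.isEmbedding_coe.continuous_iff]
    exact continuous_subtype_val
  exact hl.continuous.comp h2

end FourSq

namespace FourSq

open MeasureTheory Set

lemma integrable_affine_mul_exp {a : ℝ} (ha : 0 < a) (y : ℝ) :
    IntegrableOn (fun h : ℝ => (1 + y * h) * Real.exp (-a * h)) (Ioi 0) := by
  have i0 := exp_neg_integrableOn_Ioi 0 ha
  have i1 := integrableOn_rpow_mul_exp_neg_mul_rpow (s := 1) (p := 1) (b := a) (by norm_num)
    one_pos ha
  simp only [Real.rpow_one] at i1
  refine (i0.add (i1.const_mul y)).congr_fun (fun h _ => ?_) measurableSet_Ioi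
  simp
  ring

lemma integral_affine_mul_cexp {s : ℂ} (hs : 0 < s.re) (y : ℝ) :
    ∫ h : ℝ in Ioi 0, (1 + y * h) * Complex.exp (-s * h) = 1 / s + y / s ^ 2 := by
  have hs0 : s ≠ 0 := fun h => by simp [h] at hs
  have hn : ∀ h : ℝ, ‖Complex.exp (-s * h)‖ = Real.exp (-s.re * h) := fun h => by
    rw [Complex.norm_exp]
    simp
  have hi : IntegrableOn (fun h : ℝ => (1 + y * h) * Complex.exp (-s * h)) (Ioi 0) := by
    refine Integrable.mono (integrable_affine_mul_exp hs y) (by fun_prop)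
      (Filter.Eventually.of_forall fun h => ?_)
    rw [norm_mul, hn, norm_mul, Real.norm_of_nonneg (Real.exp_pos _).le, ← Complex.norm_real]
    push_cast
    rfl
  have hd : ∀ h ∈ Ici (0 : ℝ), HasDerivAt
      (fun h : ℝ => -(Complex.exp (-s * h) * (1 / s + y / s ^ 2 + y / s * h)))
      ((1 + y * h) * Complex.exp (-s * h)) h := by
    intro h _
    have h1 : HasDerivAt (fun h : ℝ => -s * (h : ℂ)) (-s * 1) h :=
      (Complex.ofRealCLM.hasDerivAt (x := h)).const_mul (-s)
    have h2 : HasDerivAt (fun h : ℝ => 1 / s + y / s ^ 2 + y / s * (h : ℂ)) (y / s * 1) h :=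
      ((Complex.ofRealCLM.hasDerivAt (x := h)).const_mul (y / s : ℂ)).const_add _
    have h3 := (h1.cexp.mul h2).neg
    refine h3.congr_deriv ?_
    field_simp
    ring
  have hlim : Filter.Tendsto
      (fun h : ℝ => -(Complex.exp (-s * h) * (1 / s + y / s ^ 2 + y / s * h)))
      Filter.atTop (nhds 0) := by
    rw [tendsto_zero_iff_norm_tendsto_zero]
    have t0 : Filter.Tendsto (fun h : ℝ => Real.exp (-s.re * h)) Filter.atTop (nhds 0) := by
      have := Real.tendsto_exp_neg_atTop_nhds_zero.comp (Filter.tendsto_id.const_mul_atTop hs)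
      refine this.congr fun h => ?_
      simp
    have t1 : Filter.Tendsto (fun h : ℝ => h * Real.exp (-s.re * h)) Filter.atTop (nhds 0) := by
      have := tendsto_rpow_mul_exp_neg_mul_atTop_nhds_zero 1 s.re hs
      simpa using this
    have t2 := (t0.mul_const ‖1 / s + y / s ^ 2‖).add (t1.const_mul ‖(y / s : ℂ)‖)
    rw [zero_mul, mul_zero, add_zero] at t2
    refine squeeze_zero' (Filter.Eventually.of_forall fun _ => norm_nonneg _) ?_ t2
    filter_upwards [Filter.eventually_ge_atTop 0] with h hh
    rw [norm_neg, norm_mul, hn]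
    have := norm_add_le (1 / s + y / s ^ 2) (y / s * h)
    rw [norm_mul, Complex.norm_real, Real.norm_of_nonneg hh] at this
    have h4 := mul_le_mul_of_nonneg_left this (Real.exp_pos (-s.re * h)).le
    linarith
  rw [integral_Ioi_of_hasDerivAt_of_tendsto' hd hi hlim]
  simp

lemma integral_affine_mul_exp_cos {a : ℝ} (ha : 0 < a) (y u : ℝ) :
    ∫ h : ℝ in Ioi 0, (1 + y * h) * Real.exp (-a * h) * Real.cos (h * u) =
      a / (a ^ 2 + u ^ 2) + y * (a ^ 2 - u ^ 2) / (a ^ 2 + u ^ 2) ^ 2 := by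
  have h := integral_affine_mul_cexp (s := a - u * Complex.I) (by simpa using ha) y
  have h2 : ∀ h : ℝ, (1 + y * h) * Complex.exp (-(a - u * Complex.I) * h) =
      (((1 + y * h) * Real.exp (-a * h) : ℝ) : ℂ) *
        Complex.exp (((h * u : ℝ) : ℂ) * Complex.I) := by
    intro h
    push_cast
    rw [mul_assoc, ← Complex.exp_add]
    ring_nf
  simp only [h2] at h
  have hi : IntegrableOn (fun h : ℝ => (((1 + y * h) * Real.exp (-a * h) : ℝ) : ℂ) *
      Complex.exp (((h * u : ℝ) : ℂ) * Complex.I)) (Ioi 0) := by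
    have := (integrable_affine_mul_exp ha y).ofReal (𝕜 := ℂ)
    refine this.mul_bdd (c := 1) (by fun_prop) (Filter.Eventually.of_forall fun x => ?_)
    rw [Complex.norm_exp_ofReal_mul_I]
  have h3 := congrArg Complex.re h
  rw [← RCLike.re_eq_complex_re, ← integral_re hi] at h3
  simp only [RCLike.re_eq_complex_re, Complex.re_ofReal_mul, Complex.exp_ofReal_mul_I_re] at h3
  rw [h3]
  have e1 : (a - u * Complex.I : ℂ) * (a + u * Complex.I) = ((a ^ 2 + u ^ 2 : ℝ) : ℂ) := by
    push_cast
    linear_combination -(u : ℂ) ^ 2 * Complex.I_sq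
  have hpos : 0 < a ^ 2 + u ^ 2 := by positivity
  have hne : (a - u * Complex.I : ℂ) ≠ 0 := fun h0 => by
    have := congrArg Complex.re h0
    simp at this
    linarith
  have hne2 : ((a ^ 2 + u ^ 2 : ℝ) : ℂ) ≠ 0 := by exact_mod_cast hpos.ne'
  have e2 : 1 / (a - u * Complex.I : ℂ) = (a + u * Complex.I) / ((a ^ 2 + u ^ 2 : ℝ) : ℂ) := by
    rw [div_eq_div_iff hne hne2, ← e1]
    ring
  have e3 : (y : ℂ) / (a - u * Complex.I) ^ 2 =
      (y * (a ^ 2 - u ^ 2) : ℝ) / ((a ^ 2 + u ^ 2) ^ 2 : ℝ) +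
        ((2 * y * a * u / (a ^ 2 + u ^ 2) ^ 2 : ℝ) : ℂ) * Complex.I := by
    have : (y : ℂ) / (a - u * Complex.I) ^ 2 = y * (1 / (a - u * Complex.I)) ^ 2 := by
      field_simp
    rw [this, e2]
    have h4 : ((a : ℂ) ^ 2 + (u : ℂ) ^ 2) ≠ 0 := by exact_mod_cast hpos.ne'
    push_cast
    field_simp
    linear_combination (y : ℂ) * (u : ℂ) ^ 2 * Complex.I_sq
  rw [e2, e3, ← Complex.ofReal_div]
  simp only [Complex.add_re, Complex.div_ofReal_re, Complex.ofReal_re,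
    Complex.I_re, Complex.mul_re, Complex.ofReal_im, Complex.I_im]
  ring

lemma integral_shift_pker {y : ℝ} (hy : 0 < y) (b : ℝ) :
    (Integrable fun x : ℝ => ((x + b) ^ 2 + y ^ 2)⁻¹ ^ 2 * pker y x) ∧
    ∫ x : ℝ, ((x + b) ^ 2 + y ^ 2)⁻¹ ^ 2 * pker y x =
      π * (12 * y ^ 2 + b ^ 2) / (2 * y ^ 2 * (4 * y ^ 2 + b ^ 2) ^ 2) := by
  have hrep : ∀ x : ℝ, ((x + b) ^ 2 + y ^ 2)⁻¹ ^ 2 * pker y x = (2 * y ^ 3)⁻¹ *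
      ∫ h : ℝ in Ioi 0, pker y x * ((1 + y * h) * Real.exp (-y * h) * Real.cos (h * (x + b))) := by
    intro x
    have hp : (x + b) ^ 2 + y ^ 2 ≠ 0 := by positivity
    have hp' : y ^ 2 + (x + b) ^ 2 ≠ 0 := by positivity
    rw [integral_const_mul, integral_affine_mul_exp_cos hy]
    field_simp
    ring
  have hprod : Integrable (Function.uncurry fun (x h : ℝ) => pker y x *
      ((1 + y * h) * Real.exp (-y * h) * Real.cos (h * (x + b))))
      (volume.prod (volume.restrict (Ioi 0))) := by
    have := (integrable_pker hy).mul_prod (integrable_affine_mul_exp hy y)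
    refine (this.mul_bdd (g := fun p : ℝ × ℝ => Real.cos (p.2 * (p.1 + b))) (c := 1)
      (by fun_prop) (Filter.Eventually.of_forall fun p => ?_)).congr
      (Filter.Eventually.of_forall fun p => ?_)
    · simpa using Real.abs_cos_le_one _
    · simp only [Function.uncurry]
      ring
  simp only [hrep]
  refine ⟨hprod.integral_prod_left.const_mul _, ?_⟩
  rw [integral_const_mul, integral_integral_swap hprod]
  have hin : ∀ h ∈ Ioi (0 : ℝ), ∫ x : ℝ, pker y x *
      ((1 + y * h) * Real.exp (-y * h) * Real.cos (h * (x + b))) =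
      π * ((1 + y * h) * Real.exp (-(2 * y) * h) * Real.cos (h * b)) := by
    intro h hh
    have e1 : ∀ x : ℝ, Real.cos (h * (x + b)) = Real.cos (h * b) * Real.cos (h * x) -
        Real.sin (h * b) * Real.sin (h * x) := fun x => by
      rw [show h * (x + b) = h * b + h * x by ring, Real.cos_add]
    have hsin : ∫ x : ℝ, Real.sin (h * x) * pker y x = 0 := by
      have h2 := integral_neg_eq_self (fun x : ℝ => Real.sin (h * x) * pker y x) volume
      have h3 : (fun x : ℝ => Real.sin (h * -x) * pker y (-x)) =
          fun x => -(Real.sin (h * x) * pker y x) := by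
        funext x
        simp [pker]
      rw [h3, integral_neg] at h2
      linarith
    have isin : Integrable fun x : ℝ => Real.sin (h * x) * pker y x := by
      refine (integrable_pker hy).bdd_mul (c := 1) (by fun_prop)
        (Filter.Eventually.of_forall fun x => ?_)
      simpa using Real.abs_sin_le_one _
    have e2 : ∀ x : ℝ, pker y x * ((1 + y * h) * Real.exp (-y * h) * Real.cos (h * (x + b))) =
        ((1 + y * h) * Real.exp (-y * h) * Real.cos (h * b)) * (Real.cos (h * x) * pker y x) -
        ((1 + y * h) * Real.exp (-y * h) * Real.sin (h * b)) * (Real.sin (h * x) * pker y x) :=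
      fun x => by
        rw [e1]
        ring
    simp only [e2]
    rw [integral_sub ((integrable_cos_pker hy h).const_mul _) (isin.const_mul _),
      integral_const_mul, integral_const_mul, hsin, integral_cos_pker hy, abs_of_pos hh,
      show -(2 * y) * h = -y * h + -y * h by ring, Real.exp_add]
    ring
  rw [setIntegral_congr_fun measurableSet_Ioi hin, integral_const_mul,
    integral_affine_mul_exp_cos (by positivity)]
  have hp : (2 * y) ^ 2 + b ^ 2 ≠ 0 := by positivity
  have hp' : 4 * y ^ 2 + b ^ 2 ≠ 0 := by positivity
  rw [show (2 * y) ^ 2 + b ^ 2 = 4 * y ^ 2 + b ^ 2 by ring]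
  field_simp
  ring

lemma integral_eterm_pker {y : ℝ} (hy : 0 < y) {p : ℤ × ℤ} (hp : p.1 ≠ 0) :
    (Integrable fun x : ℝ => eterm p (x + y * Complex.I) * pker y x) ∧
    ∫ x : ℝ, eterm p (x + y * Complex.I) * pker y x = π * ((p.1 : ℝ) ^ 2)⁻¹ *
      ((p.2 : ℝ) ^ 2 + 12 * (p.1 * y) ^ 2) / (2 * ((p.2 : ℝ) ^ 2 + 4 * (p.1 * y) ^ 2) ^ 2) := by
  obtain ⟨h1, h2⟩ := integral_shift_pker hy ((p.2 : ℝ) / p.1)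
  have hc : (p.1 : ℝ) ≠ 0 := by exact_mod_cast hp
  have e : ∀ x : ℝ, eterm p (x + y * Complex.I) * pker y x =
      y ^ 2 / (p.1 : ℝ) ^ 4 * (((x + (p.2 : ℝ) / p.1) ^ 2 + y ^ 2)⁻¹ ^ 2 * pker y x) := by
    intro x
    rw [eterm_eq]
    simp only [Complex.add_im, Complex.ofReal_im, Complex.mul_im, Complex.ofReal_re,
      Complex.I_im, Complex.I_re, Complex.add_re, Complex.mul_re]
    have h3 : (x + (p.2 : ℝ) / p.1) ^ 2 + y ^ 2 ≠ 0 := by positivity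
    have h4 : ((p.1 : ℝ) * x + p.2) ^ 2 + (p.1 * y) ^ 2 =
        (p.1 : ℝ) ^ 2 * ((x + (p.2 : ℝ) / p.1) ^ 2 + y ^ 2) := by
      field_simp
    simp only [mul_zero, mul_one, add_zero, zero_add, sub_zero]
    rw [h4]
    field_simp
  simp only [e]
  refine ⟨h1.const_mul _, ?_⟩
  rw [integral_const_mul, h2]
  have h5 : 4 * y ^ 2 + ((p.2 : ℝ) / p.1) ^ 2 ≠ 0 := by positivity
  have h6 : (p.2 : ℝ) ^ 2 + 4 * (p.1 * y) ^ 2 = (p.1 : ℝ) ^ 2 *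
    (4 * y ^ 2 + ((p.2 : ℝ) / p.1) ^ 2) := by
    field_simp
    ring
  have h7 : (p.2 : ℝ) ^ 2 + 12 * (p.1 * y) ^ 2 =
      (p.1 : ℝ) ^ 2 * (12 * y ^ 2 + ((p.2 : ℝ) / p.1) ^ 2) := by
    field_simp
    ring
  rw [h6, h7]
  field_simp

end FourSq

namespace FourSq

open MeasureTheory Set

/-- The main part of the Poisson integral of a lattice term. -/
noncomputable def pterm (y : ℝ) (p : ℤ × ℤ) : ℝ :=
  ((p.1 : ℝ) ^ 2)⁻¹ * ((p.2 : ℝ) ^ 2 + 12 * (p.1 * y) ^ 2) /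
    (2 * ((p.2 : ℝ) ^ 2 + 4 * (p.1 * y) ^ 2) ^ 2)

lemma integral_eterm_pker_eq {y : ℝ} (hy : 0 < y) (p : ℤ × ℤ) :
    (Integrable fun x : ℝ => eterm p (x + y * Complex.I) * pker y x) ∧
    ∫ x : ℝ, eterm p (x + y * Complex.I) * pker y x =
      π * (pterm y p + if p.1 = 0 then y ^ 2 / (p.2 : ℝ) ^ 4 else 0) := by
  by_cases hp : p.1 = 0
  · have e : ∀ x : ℝ, eterm p (x + y * Complex.I) * pker y x = y ^ 2 / (p.2 : ℝ) ^ 4 *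
      pker y x := by
      intro x
      rw [eterm_eq, hp]
      simp
      ring_nf
      simp
    simp only [e, if_pos hp]
    refine ⟨(integrable_pker hy).const_mul _, ?_⟩
    rw [integral_const_mul, integral_pker hy, pterm, hp]
    simp
    ring
  · obtain ⟨h1, h2⟩ := integral_eterm_pker hy hp
    refine ⟨h1, ?_⟩
    rw [h2, if_neg hp, pterm, add_zero]
    ring

lemma hasSum_fst_zero {f : ℤ → ℝ} {s : ℝ} (hf : HasSum f s) :
    HasSum (fun p : ℤ × ℤ => if p.1 = 0 then f p.2 else 0) s := by
  rw [← (Prod.mk_right_injective (0 : ℤ)).hasSum_iff]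
  · simpa [Function.comp_def] using hf
  · rintro ⟨a, b⟩ h
    refine if_neg fun ha : a = 0 => h ⟨b, by rw [ha]⟩

lemma hasSum_snd_zero {f : ℤ → ℝ} {s : ℝ} (hf : HasSum f s) :
    HasSum (fun p : ℤ × ℤ => if p.2 = 0 then f p.1 else 0) s := by
  have := (Equiv.prodComm ℤ ℤ).hasSum_iff.2 (hasSum_fst_zero hf)
  exact this

lemma hasSum_odd_even_sq : HasSum (fun p : ℤ × ℤ => w0 p *
    (((p.1 : ℝ) ^ 2)⁻¹ * ((p.2 : ℝ) ^ 2)⁻¹ / 2)) (π ^ 4 / 48) := by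
  obtain ⟨f, hf⟩ : ∃ f : ℤ → ℝ, f = fun d : ℤ => if Odd d then 1 / (d : ℝ) ^ 2 else 0 := ⟨_, rfl⟩
  obtain ⟨g, hg⟩ : ∃ g : ℤ → ℝ, g = fun d : ℤ => if Odd d then 0 else 1 / (d : ℝ) ^ 2 := ⟨_, rfl⟩
  have hfs : HasSum f (π ^ 2 / 4) := hf ▸ hasSum_int_odd_two
  have hgs : HasSum g (π ^ 2 / 12) := hg ▸ hasSum_int_even_two
  have h0 : 0 ≤ f := fun d => by
    rw [hf]
    simp only [Pi.zero_apply]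
    positivity
  have h1 : 0 ≤ g := fun d => by
    rw [hg]
    simp only [Pi.zero_apply]
    positivity
  have a := hfs.mul hgs (hfs.summable.mul_of_nonneg hgs.summable h0 h1)
  have b := hgs.mul hfs (hgs.summable.mul_of_nonneg hfs.summable h1 h0)
  have c := (a.add b).div_const 2
  rw [show (π ^ 2 / 4 * (π ^ 2 / 12) + π ^ 2 / 12 * (π ^ 2 / 4)) / 2 = π ^ 4 / 48 by ring] at c
  suffices hfun : (fun p : ℤ × ℤ => (f p.1 * g p.2 + g p.1 * f p.2) / 2) =
      (fun p : ℤ × ℤ => w0 p * (((p.1 : ℝ) ^ 2)⁻¹ * ((p.2 : ℝ) ^ 2)⁻¹ / 2)) by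
    rw [← hfun]
    exact c
  funext p
  by_cases h1 : Odd p.1 <;> by_cases h2 : Odd p.2 <;> simp [w0, Int.odd_add, h1, h2, hf, hg]

lemma min_one_sq_le {s θ : ℝ} (hs : 0 < s) (h0 : 0 ≤ θ) (h1 : θ ≤ 2) : s ^ 2 / (1 + s ^ 2) ≤
    s ^ θ := by
  rcases le_total s 1 with h | h
  · refine (div_le_self (sq_nonneg _) (by nlinarith)).trans ?_
    rw [← Real.rpow_natCast]
    exact Real.rpow_le_rpow_of_exponent_ge hs h (by exact_mod_cast h1)
  · refine ((div_le_one (by positivity)).2 (by linarith)).trans (Real.one_le_rpow h h0)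

lemma abs_pterm_sub_le {y η : ℝ} (hy : 0 < y) (hη : 0 ≤ η) (hη1 : η ≤ 1) {p : ℤ × ℤ}
    (h1 : p.1 ≠ 0) (h2 : p.2 ≠ 0) :
    |pterm y p - ((p.1 : ℝ) ^ 2)⁻¹ * ((p.2 : ℝ) ^ 2)⁻¹ / 2| ≤
      2 * y ^ (1 - η) * (|(p.1 : ℝ)| ^ (-1 - η) * |(p.2 : ℝ)| ^ (-3 + η)) := by
  have hc : 0 < |(p.1 : ℝ)| := abs_pos.2 (by exact_mod_cast h1)
  have hd : 0 < |(p.2 : ℝ)| := abs_pos.2 (by exact_mod_cast h2)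
  rw [pterm, ← sq_abs (p.1 : ℝ), ← sq_abs (p.2 : ℝ), mul_pow, ← sq_abs (p.1 : ℝ)]
  set c := |(p.1 : ℝ)|
  set d := |(p.2 : ℝ)|
  have e : (c ^ 2)⁻¹ * (d ^ 2 + 12 * (c ^ 2 * y ^ 2)) / (2 * (d ^ 2 + 4 * (c ^ 2 * y ^ 2)) ^ 2) -
      (c ^ 2)⁻¹ * (d ^ 2)⁻¹ / 2 = 2 * (c ^ 2)⁻¹ * (d ^ 2)⁻¹ * (c * y) ^ 2 *
        (d ^ 2 - 4 * (c * y) ^ 2)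
        / (d ^ 2 + 4 * (c * y) ^ 2) ^ 2 := by
    have : d ^ 2 + 4 * (c ^ 2 * y ^ 2) ≠ 0 := by positivity
    have : d ^ 2 + 4 * (c * y) ^ 2 ≠ 0 := by positivity
    field_simp
    ring
  have hm := min_one_sq_le (s := c * y / d) (θ := 1 - η) (by positivity) (by linarith) (by linarith)
  rw [Real.div_rpow (by positivity) hd.le, Real.mul_rpow hc.le hy.le] at hm
  have hrhs : 2 * y ^ (1 - η) * (c ^ (-1 - η) * d ^ (-3 + η)) =
      2 * (c ^ 2)⁻¹ * (d ^ 2)⁻¹ * (c ^ (1 - η) * y ^ (1 - η) / d ^ (1 - η)) := by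
    have hc1 : c ^ (-1 - η) = (c ^ 2)⁻¹ * c ^ (1 - η) := by
      rw [← Real.rpow_natCast, ← Real.rpow_neg hc.le, ← Real.rpow_add hc]
      congr 1
      push_cast
      ring
    have hd1 : d ^ (-3 + η) = (d ^ 2)⁻¹ * (d ^ (1 - η))⁻¹ := by
      rw [← Real.rpow_natCast, ← Real.rpow_neg hd.le, ← Real.rpow_neg hd.le, ← Real.rpow_add hd]
      congr 1
      push_cast
      ring
    rw [hc1, hd1]
    ring
  rw [e, hrhs]
  have hfin : |2 * (c ^ 2)⁻¹ * (d ^ 2)⁻¹ * (c * y) ^ 2 * (d ^ 2 - 4 * (c * y) ^ 2)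
        / (d ^ 2 + 4 * (c * y) ^ 2) ^ 2| ≤ 2 * (c ^ 2)⁻¹ * (d ^ 2)⁻¹ *
        ((c * y / d) ^ 2 / (1 + (c * y / d) ^ 2)) := by
    have e2 : (c * y / d) ^ 2 / (1 + (c * y / d) ^ 2) = (c * y) ^ 2 / (d ^ 2 + (c * y) ^ 2) := by
      field_simp
    rw [e2, abs_div, abs_mul,
      abs_of_nonneg (by positivity : 0 ≤ 2 * (c ^ 2)⁻¹ * (d ^ 2)⁻¹ * (c * y) ^ 2),
      abs_of_nonneg (by positivity : 0 ≤ (d ^ 2 + 4 * (c * y) ^ 2) ^ 2), mul_div_assoc, mul_assoc,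
      ← mul_div_assoc ((c * y) ^ 2)]
    refine mul_le_mul_of_nonneg_left ?_ (by positivity)
    have h3 : |d ^ 2 - 4 * (c * y) ^ 2| ≤ d ^ 2 + 4 * (c * y) ^ 2 := by
      rw [abs_le]
      constructor <;> nlinarith [sq_nonneg d, sq_nonneg (c * y)]
    rw [div_le_div_iff₀ (by positivity) (by positivity), mul_assoc]
    refine mul_le_mul_of_nonneg_left ?_ (by positivity)
    have h4 : d ^ 2 + (c * y) ^ 2 ≤ d ^ 2 + 4 * (c * y) ^ 2 := by nlinarith [sq_nonneg (c * y)]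
    calc _ ≤ (d ^ 2 + 4 * (c * y) ^ 2) * (d ^ 2 + 4 * (c * y) ^ 2) :=
          mul_le_mul h3 h4 (by positivity) (by positivity)
      _ = _ := by ring
  exact hfin.trans (mul_le_mul_of_nonneg_left hm (by positivity))

/-- The Poisson average of the Eisenstein series at small height. -/
lemma integral_Gs_pker {η : ℝ} (hη : 0 < η) (hη1 : η < 1) : ∃ C : ℝ, 0 < C ∧
    ∀ y : ℝ, 0 < y → y ≤ 1 →
      |(∫ x : ℝ, Gs w0 (x + y * Complex.I) * pker y x) - π * (π ^ 4 / 48) * (3 / (8 * y ^ 2) + 1)| ≤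
        C * y ^ (1 - η) := by
  have hκ : (0 : ℝ) ≤ π ^ 4 / 48 := by positivity
  have hK : Summable fun p : ℤ × ℤ => |(p.1 : ℝ)| ^ (-1 - η) * |(p.2 : ℝ)| ^ (-3 + η) := by
    have h1 := Real.summable_abs_int_rpow (b := 1 + η) (by linarith)
    have h2 := Real.summable_abs_int_rpow (b := 3 - η) (by linarith)
    have := h1.mul_of_nonneg h2 (fun _ => by positivity) (fun _ => by positivity)
    rw [show -1 - η = -(1 + η) by ring, show -3 + η = -(3 - η) by ring]
    exact this
  set K := ∑' p : ℤ × ℤ, |(p.1 : ℝ)| ^ (-1 - η) * |(p.2 : ℝ)| ^ (-3 + η) with hKdef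
  have hK0 : 0 ≤ K := tsum_nonneg fun p => by positivity
  refine ⟨π * (2 * K + π ^ 4 / 48) + 1, by positivity, fun y hy hy1 => ?_⟩
  set D : ℤ × ℤ → ℝ := fun p => if p.1 = 0 ∨ p.2 = 0 then 0 else
    w0 p * (pterm y p - ((p.1 : ℝ) ^ 2)⁻¹ * ((p.2 : ℝ) ^ 2)⁻¹ / 2) with hD
  have hDle : ∀ p, ‖D p‖ ≤
      2 * y ^ (1 - η) * (|(p.1 : ℝ)| ^ (-1 - η) * |(p.2 : ℝ)| ^ (-3 + η)) := by
    intro p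
    simp only [hD]
    split_ifs with h
    · rw [norm_zero]
      positivity
    · push Not at h
      rw [norm_mul, Real.norm_eq_abs, Real.norm_eq_abs, abs_of_nonneg (w0_mem p).1]
      exact (mul_le_of_le_one_left (abs_nonneg _) (w0_mem p).2).trans
        (abs_pterm_sub_le hy hη.le hη1.le h.1 h.2)
  have hDs : Summable D := Summable.of_norm_bounded (hK.mul_left _) hDle
  have hDb : |∑' p, D p| ≤ 2 * y ^ (1 - η) * K :=
    tsum_of_norm_bounded (hK.hasSum.mul_left (2 * y ^ (1 - η))) hDle
  have hA := hasSum_fst_zero (hasSum_int_odd_four.mul_left (y ^ 2))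
  have hB := hasSum_snd_zero (hasSum_int_odd_four.mul_left (3 / (8 * y ^ 2)))
  have hsum := ((((hA.add hB).add hasSum_odd_even_sq).add hDs.hasSum).mul_left π)
  have hterm : ∀ p : ℤ × ℤ, π * ((((if p.1 = 0 then y ^ 2 * (if Odd p.2 then 1 / (p.2 : ℝ) ^ 4
      else 0) else 0) + if p.2 = 0 then 3 / (8 * y ^ 2) * (if Odd p.1 then 1 / (p.1 : ℝ) ^ 4
      else 0) else 0) + w0 p * (((p.1 : ℝ) ^ 2)⁻¹ * ((p.2 : ℝ) ^ 2)⁻¹ / 2)) + D p) =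
      w0 p * ∫ x : ℝ, eterm p (x + y * Complex.I) * pker y x := by
    intro p
    rw [(integral_eterm_pker_eq hy p).2]
    by_cases h1 : p.1 = 0
    · by_cases h2 : p.2 = 0
      · simp [hD, h1, h2, w0]
      · by_cases ho : Odd p.2 <;> simp [hD, h1, h2, w0, pterm, ho]
        simp [div_eq_mul_inv]
    · by_cases h2 : p.2 = 0
      · have : (p.1 : ℝ) ≠ 0 := by exact_mod_cast h1
        by_cases ho : Odd p.1
        · simp [hD, h1, h2, w0, pterm, ho]
          field_simp
          norm_num
        · simp [hD, h1, h2, w0, pterm, ho]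
      · simp only [hD, h1, h2, if_false, or_self]
        ring
  simp only [hterm] at hsum
  have hint := hasSum_integral_of_summable_integral_norm (μ := volume)
    (F := fun (p : ℤ × ℤ) (x : ℝ) => w0 p * (eterm p (x + y * Complex.I) * pker y x))
    (fun p => (integral_eterm_pker_eq hy p).1.const_mul _) (by
      refine hsum.summable.congr fun p => ?_
      rw [← integral_const_mul]
      refine integral_congr_ae (Filter.Eventually.of_forall fun x => ?_)
      simp only
      rw [Real.norm_of_nonneg]
      exact mul_nonneg (w0_mem p).1 (mul_nonneg (eterm_nonneg _ _) (pker_pos hy x).le))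
  simp only [integral_const_mul] at hint
  have heq := hint.unique hsum
  have hG : ∀ x : ℝ, ∑' p : ℤ × ℤ, w0 p * (eterm p (x + y * Complex.I) * pker y x) =
      Gs w0 (x + y * Complex.I) * pker y x := by
    intro x
    rw [Gs, ← tsum_mul_right]
    exact tsum_congr fun p => by ring
  simp only [hG] at heq
  rw [heq]
  have hy2 : y ^ 2 ≤ y ^ (1 - η) := by
    rw [← Real.rpow_natCast]
    exact Real.rpow_le_rpow_of_exponent_ge hy hy1 (by push_cast; linarith)
  have hyp : 0 ≤ y ^ (1 - η) := by positivity
  calc _ = |π * (y ^ 2 * (π ^ 4 / 48) + ∑' p, D p)| := by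
        congr 1
        ring
    _ ≤ π * (y ^ (1 - η) * (π ^ 4 / 48) + 2 * y ^ (1 - η) * K) := by
        rw [abs_mul, abs_of_pos Real.pi_pos]
        refine mul_le_mul_of_nonneg_left ((abs_add_le _ _).trans (add_le_add ?_ hDb))
          Real.pi_pos.le
        rw [abs_of_nonneg (by positivity)]
        exact mul_le_mul_of_nonneg_right hy2 hκ
    _ ≤ _ := by linarith

end FourSq

namespace FourSq

open MeasureTheory Set

/-- Boundedness and hyperbolic Lipschitz continuity, both decaying towards the cusp `i∞`. -/
structure Tame (F : ℝ → ℝ → ℝ) (C : ℝ) : Prop where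
  pos : 0 < C
  cont : ContinuousOn (fun p : ℝ × ℝ => F p.1 p.2) {p | 0 < p.2}
  bdd : ∀ x v, 0 < v → |F x v| ≤ C
  decay : ∀ x v, 0 < v → |F x v| ≤ C / v
  lip : ∀ x x' v v' D, 0 < v → v ≤ v' → 0 ≤ D → (x - x') ^ 2 + (v - v') ^ 2 ≤ D ^ 2 * (v * v') →
    |F x v - F x' v'| ≤ C * D ∧ |F x v - F x' v'| ≤ C * D / v

lemma Tame.neg {F : ℝ → ℝ → ℝ} {C : ℝ} (h : Tame F C) : Tame (fun x v => F (-x) v) C where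
  pos := h.pos
  cont := h.cont.comp (f := fun p : ℝ × ℝ => (-p.1, p.2)) (by fun_prop) fun p hp => hp
  bdd x v hv := h.bdd _ v hv
  decay x v hv := h.decay _ v hv
  lip x x' v v' D hv hvv hD hle := h.lip _ _ v v' D hv hvv hD (by
    rw [← neg_sub_neg] at hle
    convert hle using 2
    ring)

/-- `B0` in real coordinates. -/
noncomputable def Bf (x v : ℝ) : ℝ := B0 (x + v * Complex.I)

lemma exists_tame_Bf : ∃ C, Tame Bf C := by
  obtain ⟨C, hC, h1, h2, h3, h4⟩ := B0_bounds
  let Z : ∀ x v : ℝ, 0 < v → UpperHalfPlane := fun x v hv => ⟨x + v * Complex.I, by simpa using hv⟩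
  have him : ∀ x v hv, (Z x v hv).im = v := fun x v hv => by
    change ((x : ℂ) + v * Complex.I).im = v
    simp
  have hB : ∀ x v hv, B0 (Z x v hv : ℂ) = Bf x v := fun x v hv => rfl
  refine ⟨2 * C, by positivity, ?_, fun x v hv => ?_, fun x v hv => ?_, ?_⟩
  · exact continuousOn_B0.comp (f := fun p : ℝ × ℝ => (p.1 : ℂ) + p.2 * Complex.I)
      (by fun_prop) fun p hp => by simpa using hp
  · rw [← hB x v hv]
    exact (h1 _).trans (by linarith)
  · rw [← hB x v hv]
    refine (h2 _).trans ?_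
    rw [him _ _ hv]
    gcongr
    linarith
  · intro x x' v v' D hv hvv hD hle
    have hv' : 0 < v' := hv.trans_le hvv
    have hdist : dist (Z x v hv) (Z x' v' hv') ≤ D := by
      refine (UpperHalfPlane.dist_le_dist_coe_div_sqrt _ _).trans ?_
      rw [him _ _ hv, him _ _ hv', div_le_iff₀ (by positivity), ← Real.sqrt_sq hD,
        ← Real.sqrt_mul (sq_nonneg D),
        dist_eq_norm, Complex.norm_def]
      apply Real.sqrt_le_sqrt
      refine le_trans (le_of_eq ?_) hle
      change Complex.normSq (((x : ℂ) + v * Complex.I) - (x' + v' * Complex.I)) = _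
      rw [Complex.normSq_apply]
      simp
      ring
    have hCD := mul_le_mul_of_nonneg_left hdist hC.le
    have hCD0 : 0 ≤ C * D := by positivity
    rw [← hB x v hv, ← hB x' v' hv']
    refine ⟨(h3 _ _).trans (by linarith), ?_⟩
    rcases le_or_gt D 1 with hD1 | hD1
    · refine (h4 _ _ (hdist.trans hD1)).trans ?_
      rw [him _ _ hv]
      gcongr
      linarith
    · have a1 := h2 (Z x v hv)
      have a2 := h2 (Z x' v' hv')
      rw [him _ _ hv] at a1
      rw [him _ _ hv'] at a2
      have a3 : C / v' ≤ C / v := by gcongr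
      have a4 : C / v ≤ C * D / v := by
        gcongr
        nlinarith
      have := abs_sub (B0 (Z x v hv)) (B0 (Z x' v' hv'))
      calc _ ≤ C / v + C / v := by linarith
        _ ≤ C * D / v + C * D / v := by linarith
        _ = _ := by ring

lemma Bf_add_two (x v : ℝ) : Bf (x + 2) v = Bf x v := by
  rw [Bf, Bf, ← B0_add_two (x + v * Complex.I)]
  congr 1
  push_cast
  ring

lemma le_mul_rpow_of_le {a M v θ : ℝ} (hv : 0 < v) (hM : 0 ≤ M) (h0 : 0 ≤ θ) (h1 : θ ≤ 1)
    (ha : a ≤ M) (hb : a ≤ M / v) : a ≤ M * v ^ (-θ) := by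
  rcases le_total v 1 with h | h
  · exact ha.trans (le_mul_of_one_le_right hM
      (Real.one_le_rpow_of_pos_of_le_one_of_nonpos hv h (by linarith)))
  · refine hb.trans ?_
    rw [div_eq_mul_inv, ← Real.rpow_neg_one]
    exact mul_le_mul_of_nonneg_left (Real.rpow_le_rpow_of_exponent_le h (by linarith)) hM

lemma Tame.le_inv {F : ℝ → ℝ → ℝ} {C : ℝ} (h : Tame F C) (x : ℝ) {v : ℝ} (hv : 0 < v) :
    |F x v| ≤ 2 * C * (1 + v)⁻¹ := by
  have h1 := h.bdd x v hv
  have h2 := h.decay x v hv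
  rw [le_div_iff₀ hv] at h2
  rw [← div_eq_mul_inv, le_div_iff₀ (by linarith)]
  linarith

lemma integrable_inv_one_add_mul_sq {y : ℝ} (hy : 0 < y) :
    Integrable fun u : ℝ => (1 + y * u ^ 2)⁻¹ := by
  have := integrable_inv_one_add_sq.comp_mul_left' (Real.sqrt_pos.2 hy).ne'
  refine this.congr (Filter.Eventually.of_forall fun u => ?_)
  simp only [mul_pow, Real.sq_sqrt hy.le]

lemma Tame.integrableOn {F : ℝ → ℝ → ℝ} {C : ℝ} (h : Tame F C) {y : ℝ} (hy : 0 < y) :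
    IntegrableOn (fun u : ℝ => F u (y * u ^ 2)) (Ioi 0) := by
  refine Integrable.mono' ((integrable_inv_one_add_mul_sq hy).integrableOn.const_mul (2 * C)) ?_ ?_
  · refine ContinuousOn.aestronglyMeasurable ?_ measurableSet_Ioi
    exact h.cont.comp (f := fun u : ℝ => (u, y * u ^ 2)) (by fun_prop)
      fun u (hu : 0 < u) => by simp only [mem_ofPred_eq]; positivity
  · refine (ae_restrict_iff' measurableSet_Ioi).2 (Filter.Eventually.of_forall fun u hu => ?_)
    have hu : 0 < u := hu
    exact h.le_inv u (by positivity)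

lemma Tame.integrableOn_inv {F : ℝ → ℝ → ℝ} {C : ℝ} (h : Tame F C) {y : ℝ} (hy : 0 < y) :
    IntegrableOn (fun u : ℝ => F (u / (1 + (y * u) ^ 2)) (y * u ^ 2 / (1 + (y * u) ^ 2)) *
      (y / (1 + (y * u) ^ 2))) (Ioi 0) := by
  have hi := (integrable_inv_one_add_mul_sq (pow_pos hy 2)).integrableOn (s := Ioi 0)
  refine Integrable.mono' (hi.const_mul (C * y)) ?_ ?_
  · refine ContinuousOn.aestronglyMeasurable ?_ measurableSet_Ioi
    have hne : ∀ u : ℝ, 1 + (y * u) ^ 2 ≠ 0 := fun u => by positivity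
    refine ContinuousOn.mul ?_ (Continuous.continuousOn (by fun_prop (disch := exact hne _)))
    exact h.cont.comp (f := fun u : ℝ => (u / (1 + (y * u) ^ 2), y * u ^ 2 / (1 + (y * u) ^ 2)))
      (Continuous.continuousOn (by fun_prop (disch := exact hne _)))
      fun u (hu : 0 < u) => by simp only [mem_ofPred_eq]; positivity
  · refine (ae_restrict_iff' measurableSet_Ioi).2 (Filter.Eventually.of_forall fun u hu => ?_)
    have hu : 0 < u := hu
    have h1 := h.bdd (u / (1 + (y * u) ^ 2)) (y * u ^ 2 / (1 + (y * u) ^ 2)) (by positivity)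
    rw [norm_mul, Real.norm_eq_abs, Real.norm_of_nonneg (by positivity), ← mul_pow, mul_assoc,
      ← div_eq_mul_inv]
    exact mul_le_mul_of_nonneg_right h1 (by positivity)

lemma Tame.pointwise_small {F : ℝ → ℝ → ℝ} {C : ℝ} (h : Tame F C) {y u η : ℝ} (hy : 0 < y)
    (hu : 0 < u) (hη : 0 ≤ η) (hη1 : η ≤ 1) (hs : y * u ≤ 1) :
    |F (u / (1 + (y * u) ^ 2)) (y * u ^ 2 / (1 + (y * u) ^ 2)) * (y / (1 + (y * u) ^ 2)) -
      y * F u (y * u ^ 2)| ≤ 2 * C * y ^ (1 + η) * u ^ (2 * η - 1) + C * y ^ 2 := by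
  have hC := h.pos
  set s := y * u with hsdef
  have hs0 : 0 < s := by positivity
  have hw : 0 < y * u ^ 2 := by positivity
  have hle : y * u ^ 2 / (1 + s ^ 2) ≤ y * u ^ 2 := div_le_self hw.le (by nlinarith)
  have hp : 0 < y * u ^ 2 / (1 + s ^ 2) := by positivity
  obtain ⟨l1, l2⟩ := h.lip (u / (1 + s ^ 2)) u (y * u ^ 2 / (1 + s ^ 2)) (y * u ^ 2) s hp hle
    hs0.le (le_of_eq (by rw [hsdef]; field_simp; ring))
  have l2' : C * s / (y * u ^ 2 / (1 + s ^ 2)) ≤ 2 * C * s / (y * u ^ 2) := by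
    rw [div_div_eq_mul_div]
    gcongr ?_ / _
    have hs2 : s ^ 2 ≤ 1 := pow_le_one₀ hs0.le hs
    nlinarith [mul_le_mul_of_nonneg_left hs2 (mul_pos hC hs0).le]
  have l3 := le_mul_rpow_of_le (θ := 1 - η) hw (M := 2 * C * s) (by positivity) (by linarith)
    (by linarith) (l1.trans (by nlinarith [mul_pos hC hs0])) (l2.trans l2')
  have l4 := h.decay (u / (1 + s ^ 2)) _ hp
  set P := F (u / (1 + s ^ 2)) (y * u ^ 2 / (1 + s ^ 2))
  have e : P * (y / (1 + s ^ 2)) - y * F u (y * u ^ 2) =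
      y * (P - F u (y * u ^ 2)) - P * (y * s ^ 2 / (1 + s ^ 2)) := by
    field_simp
    ring
  rw [e]
  refine (abs_sub _ _).trans (add_le_add ?_ ?_)
  · rw [abs_mul, abs_of_pos hy]
    refine (mul_le_mul_of_nonneg_left l3 hy.le).trans (le_of_eq ?_)
    have e1 : (y * u ^ 2) ^ (-(1 - η)) = y ^ (-(1 - η)) * u ^ (2 * η - 2) := by
      rw [Real.mul_rpow hy.le (by positivity), ← Real.rpow_natCast, ← Real.rpow_mul hu.le]
      congr 2
      push_cast
      ring
    have e2 : y ^ (1 + η) = y ^ 2 * y ^ (-(1 - η)) := by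
      rw [← Real.rpow_natCast, ← Real.rpow_add hy]
      congr 1
      push_cast
      ring
    have e3 : u ^ (2 * η - 1) = u * u ^ (2 * η - 2) := by
      nth_rewrite 2 [← Real.rpow_one u]
      rw [← Real.rpow_add hu]
      congr 1
      ring
    rw [e1, e2, e3, hsdef]
    ring
  · rw [abs_mul, abs_of_nonneg (by positivity : 0 ≤ y * s ^ 2 / (1 + s ^ 2))]
    refine (mul_le_mul_of_nonneg_right l4 (by positivity)).trans (le_of_eq ?_)
    rw [hsdef]
    field_simp

lemma Tame.pointwise_large {F : ℝ → ℝ → ℝ} {C : ℝ} (h : Tame F C) {y u : ℝ} (hy : 0 < y)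
    (hu : 0 < u) :
    |F (u / (1 + (y * u) ^ 2)) (y * u ^ 2 / (1 + (y * u) ^ 2)) * (y / (1 + (y * u) ^ 2)) -
      y * F u (y * u ^ 2)| ≤ 2 * C * u ^ (-2 : ℝ) := by
  have l1 := h.decay (u / (1 + (y * u) ^ 2)) (y * u ^ 2 / (1 + (y * u) ^ 2)) (by positivity)
  have l2 := h.decay u (y * u ^ 2) (by positivity)
  have hr : u ^ (-2 : ℝ) = (u ^ 2)⁻¹ := by
    rw [Real.rpow_neg hu.le]
    norm_cast
  refine (abs_sub _ _).trans ?_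
  rw [abs_mul, abs_mul, abs_of_pos hy,
    abs_of_nonneg (by positivity : 0 ≤ y / (1 + (y * u) ^ 2)), hr]
  calc _ ≤ C / (y * u ^ 2 / (1 + (y * u) ^ 2)) * (y / (1 + (y * u) ^ 2)) + y *
    (C / (y * u ^ 2)) := by
        gcongr
    _ = _ := by
        field_simp
        ring

/-- Replacing the geodesic by the parabola `v = y u²`. -/
lemma Tame.parabola {F : ℝ → ℝ → ℝ} {C : ℝ} (h : Tame F C) {η : ℝ} (hη : 0 < η) (hη1 : η < 1) :
    ∃ K : ℝ, 0 < K ∧ ∀ y : ℝ, 0 < y → y ≤ 1 →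
      |(∫ u in Ioi (0 : ℝ), F (u / (1 + (y * u) ^ 2)) (y * u ^ 2 / (1 + (y * u) ^ 2)) *
        (y / (1 + (y * u) ^ 2))) - y * ∫ u in Ioi (0 : ℝ), F u (y * u ^ 2)| ≤ K * y ^ (1 - η) := by
  have hC := h.pos
  refine ⟨C / η + 3 * C, by positivity, fun y hy hy1 => ?_⟩
  have hi1 := h.integrableOn_inv hy
  have hi2 := (h.integrableOn hy).const_mul y
  have hyi : 0 < y⁻¹ := by positivity
  have hi3 : IntegrableOn (fun u => F (u / (1 + (y * u) ^ 2)) (y * u ^ 2 / (1 + (y * u) ^ 2)) *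
      (y / (1 + (y * u) ^ 2)) - y * F u (y * u ^ 2)) (Ioi 0) := hi1.sub hi2
  rw [← integral_const_mul, ← integral_sub hi1 hi2, ← Ioc_union_Ioi_eq_Ioi hyi.le,
    setIntegral_union (Ioc_disjoint_Ioi le_rfl) measurableSet_Ioi
      (hi3.mono_set Ioc_subset_Ioi_self) (hi3.mono_set (Ioi_subset_Ioi hyi.le))]
  have j1 : IntervalIntegrable (fun u : ℝ => 2 * C * y ^ (1 + η) * u ^ (2 * η - 1) + C * y ^ 2)
      volume 0 y⁻¹ :=
    ((intervalIntegral.intervalIntegrable_rpow' (by linarith)).const_mul _).add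
      intervalIntegrable_const
  have b1 := norm_integral_le_of_norm_le (μ := volume.restrict (Ioc 0 y⁻¹)) j1.1
    (f := fun u => F (u / (1 + (y * u) ^ 2)) (y * u ^ 2 / (1 + (y * u) ^ 2)) *
      (y / (1 + (y * u) ^ 2)) - y * F u (y * u ^ 2))
    ((ae_restrict_iff' measurableSet_Ioc).2 (Filter.Eventually.of_forall fun u hu =>
      h.pointwise_small hy hu.1 hη.le hη1.le (by
        have := mul_le_mul_of_nonneg_left hu.2 hy.le
        rwa [mul_inv_cancel₀ hy.ne'] at this)))
  have b2 := norm_integral_le_of_norm_le (μ := volume.restrict (Ioi y⁻¹))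
    ((integrableOn_Ioi_rpow_of_lt (by norm_num : (-2 : ℝ) < -1) hyi).const_mul (2 * C))
    (f := fun u => F (u / (1 + (y * u) ^ 2)) (y * u ^ 2 / (1 + (y * u) ^ 2)) *
      (y / (1 + (y * u) ^ 2)) - y * F u (y * u ^ 2))
    ((ae_restrict_iff' measurableSet_Ioi).2 (Filter.Eventually.of_forall fun u hu =>
      h.pointwise_large hy (hyi.trans hu)))
  have e0 : ∫ u in Ioc 0 y⁻¹, (2 * C * y ^ (1 + η) * u ^ (2 * η - 1) + C * y ^ 2) =
      2 * C * y ^ (1 + η) * ((y⁻¹ ^ (2 * η - 1 + 1) - 0 ^ (2 * η - 1 + 1)) / (2 * η - 1 + 1)) +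
      (y⁻¹ - 0) • (C * y ^ 2) := by
    rw [← intervalIntegral.integral_of_le hyi.le, intervalIntegral.integral_add
      ((intervalIntegral.intervalIntegrable_rpow' (by linarith)).const_mul _)
      intervalIntegrable_const, intervalIntegral.integral_const_mul,
      integral_rpow (Or.inl (by linarith)), intervalIntegral.integral_const]
  rw [integral_const_mul, integral_Ioi_rpow_of_lt (by norm_num) hyi] at b2
  have e1 : y ^ (1 + η) * y⁻¹ ^ (2 * η) = y ^ (1 - η) := by
    rw [Real.inv_rpow hy.le, ← Real.rpow_neg hy.le, ← Real.rpow_add hy]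
    congr 1
    ring
  have e2 : y⁻¹ ^ (-1 : ℝ) = y := by
    rw [Real.rpow_neg_one, inv_inv]
  have hy3 : y ≤ y ^ (1 - η) := by
    nth_rewrite 1 [← Real.rpow_one y]
    exact Real.rpow_le_rpow_of_exponent_ge hy hy1 (by linarith)
  have e3 : 2 * C * y ^ (1 + η) *
    ((y⁻¹ ^ (2 * η - 1 + 1) - 0 ^ (2 * η - 1 + 1)) / (2 * η - 1 + 1)) +
      (y⁻¹ - 0) • (C * y ^ 2) = C / η * y ^ (1 - η) + C * y := by
    rw [sub_add_cancel, Real.zero_rpow (by positivity), ← e1, smul_eq_mul]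
    field_simp
    ring
  have e4 : 2 * C * (-y⁻¹ ^ ((-2 : ℝ) + 1) / (-2 + 1)) = 2 * C * y := by
    rw [show (-2 : ℝ) + 1 = -1 by norm_num, e2]
    ring
  rw [e0, e3] at b1
  rw [e4] at b2
  refine (abs_add_le _ _).trans ?_
  calc _ ≤ C / η * y ^ (1 - η) + C * y + 2 * C * y := add_le_add b1 b2
    _ ≤ _ := by nlinarith

end FourSq

namespace FourSq

open MeasureTheory Set

/-- Mean value over a horocycle segment of length two. -/
noncomputable def horo (F : ℝ → ℝ → ℝ) (v : ℝ) : ℝ := (∫ u in (0 : ℝ)..2, F u v) / 2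

lemma Tame.continuous_slice {F : ℝ → ℝ → ℝ} {C : ℝ} (h : Tame F C) {v : ℝ} (hv : 0 < v) :
    Continuous fun u => F u v :=
  h.cont.comp_continuous (f := fun u : ℝ => (u, v)) (by fun_prop) fun _ => hv

lemma abs_horo_le {F : ℝ → ℝ → ℝ} {v M : ℝ} (h : ∀ u, |F u v| ≤ M) : |horo F v| ≤ M := by
  have := intervalIntegral.norm_integral_le_of_norm_le_const (a := 0) (b := 2)
    (f := fun u => F u v) fun u _ => h u
  rw [horo, abs_div, abs_two, div_le_iff₀ two_pos]
  simpa using this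

lemma continuousOn_of_sq_lip {f : ℝ → ℝ} {C : ℝ}
    (h : ∀ v v' D, 0 < v → v ≤ v' → 0 ≤ D → (v - v') ^ 2 ≤ D ^ 2 * (v * v') →
      |f v - f v'| ≤ C * D) : ContinuousOn f (Ioi 0) := by
  have key : ∀ v v', 0 < v → 0 < v' → |f v - f v'| ≤ C * (|v - v'| / √(v * v')) := by
    intro v v' hv hv'
    have hD : (|v - v'| / √(v * v')) ^ 2 * (v * v') = (v - v') ^ 2 := by
      rw [div_pow, sq_abs, Real.sq_sqrt (by positivity)]
      field_simp
    rcases le_total v v' with hle | hle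
    · exact h v v' _ hv hle (by positivity) hD.ge
    · rw [abs_sub_comm]
      refine h v' v _ hv' hle (by positivity) (le_of_eq ?_)
      rw [mul_comm v' v, hD]
      ring
  intro v hv
  have hv : 0 < v := hv
  refine ContinuousAt.continuousWithinAt ?_
  rw [ContinuousAt, tendsto_iff_norm_sub_tendsto_zero]
  have ht : Filter.Tendsto (fun w : ℝ => C * (|w - v| / √(w * v))) (nhds v)
      (nhds (C * (|v - v| / √(v * v)))) := by
    refine ContinuousAt.tendsto (f := fun w : ℝ => C * (|w - v| / √(w * v))) ?_
    refine ContinuousAt.mul continuousAt_const (ContinuousAt.div (by fun_prop) (by fun_prop) ?_)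
    positivity
  rw [sub_self, abs_zero, zero_div, mul_zero] at ht
  refine squeeze_zero' (Filter.Eventually.of_forall fun _ => norm_nonneg _) ?_ ht
  filter_upwards [lt_mem_nhds hv] with w hw
  exact key w v hw hv

lemma Tame.horo {F : ℝ → ℝ → ℝ} {C : ℝ} (h : Tame F C) : Tame (fun _ => horo F) C := by
  have hsub : ∀ v v' M, 0 < v → 0 < v' → (∀ u, |F u v - F u v'| ≤ M) →
      |FourSq.horo F v - FourSq.horo F v'| ≤ M := by
    intro v v' M hv hv' hM
    have := abs_horo_le (F := fun u _ => F u v - F u v') (v := 0) hM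
    rwa [FourSq.horo, intervalIntegral.integral_sub ((h.continuous_slice hv).intervalIntegrable _ _)
      ((h.continuous_slice hv').intervalIntegrable _ _), sub_div] at this
  have hlip : ∀ v v' D, 0 < v → v ≤ v' → 0 ≤ D → (v - v') ^ 2 ≤ D ^ 2 * (v * v') →
      ∀ u, |F u v - F u v'| ≤ C * D ∧ |F u v - F u v'| ≤ C * D / v := fun v v' D hv hvv hD hle u =>
    h.lip u u v v' D hv hvv hD (by simpa using hle)
  refine ⟨h.pos, ?_, fun _ v hv => abs_horo_le fun u => h.bdd u v hv,
    fun _ v hv => abs_horo_le fun u => h.decay u v hv, fun x x' v v' D hv hvv hD hle => ?_⟩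
  · refine (continuousOn_of_sq_lip (C := C) fun v v' D hv hvv hD hle =>
      hsub v v' _ hv (hv.trans_le hvv) fun u => (hlip v v' D hv hvv hD hle u).1).comp
      continuous_snd.continuousOn fun p hp => hp
  · have hle' : (v - v') ^ 2 ≤ D ^ 2 * (v * v') := by nlinarith [sq_nonneg (x - x')]
    exact ⟨hsub v v' _ hv (hv.trans_le hvv) fun u => (hlip v v' D hv hvv hD hle' u).1,
      hsub v v' _ hv (hv.trans_le hvv) fun u => (hlip v v' D hv hvv hD hle' u).2⟩

lemma Tame.block {F : ℝ → ℝ → ℝ} {C : ℝ} (h : Tame F C) (hper : ∀ x v, F (x + 2) v = F x v)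
    {η : ℝ} (hη : 0 ≤ η) (hη1 : η ≤ 1) {y : ℝ} (hy : 0 < y) {k : ℕ} (hk : 1 ≤ k) :
    |∫ u in (2 * k : ℝ)..(2 * k + 2), (F u (y * u ^ 2) - FourSq.horo F (y * u ^ 2))| ≤
      8 * C * y ^ (-η) * (k : ℝ) ^ (-1 - 2 * η) := by
  have hk0 : (0 : ℝ) < k := by exact_mod_cast hk
  set w := y * (2 * k : ℝ) ^ 2 with hw
  have hw0 : 0 < w := by positivity
  have hC := h.pos
  have hbd : ∀ G : ℝ → ℝ → ℝ, Tame G C → ∀ u, (2 * k : ℝ) ≤ u → u ≤ 2 * k + 2 →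
      |G u (y * u ^ 2) - G u w| ≤ C * (2 / k) * w ^ (-η) := by
    intro G hG u hu1 hu2
    have hu : 0 < u := by linarith
    have hle : w ≤ y * u ^ 2 := by
      rw [hw]
      gcongr
    obtain ⟨l1, l2⟩ := hG.lip u u w (y * u ^ 2) (2 / k) hw0 hle (by positivity) (by
      have e : (2 / k : ℝ) ^ 2 * (w * (y * u ^ 2)) = (4 * u * y) ^ 2 := by
        rw [hw]
        field_simp
        ring
      rw [e, sub_self, zero_pow two_ne_zero, zero_add, ← neg_sub, neg_sq]
      refine pow_le_pow_left₀ (by linarith) ?_ 2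
      have : y * u ^ 2 - w = y * ((u - 2 * k) * (u + 2 * k)) := by
        rw [hw]
        ring
      rw [this, mul_comm (4 * u) y]
      refine mul_le_mul_of_nonneg_left ?_ hy.le
      nlinarith)
    rw [abs_sub_comm] at l1 l2
    exact le_mul_rpow_of_le hw0 (by positivity) hη hη1 l1 l2
  have hpt : ∀ u ∈ uIoc (2 * k : ℝ) (2 * k + 2),
      ‖(F u (y * u ^ 2) - FourSq.horo F (y * u ^ 2)) - (F u w - FourSq.horo F w)‖ ≤
        2 * (C * (2 / k) * w ^ (-η)) := by
    intro u hu
    rw [uIoc_of_le (by linarith)] at hu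
    have a1 := hbd F h u hu.1.le hu.2
    have a2 := hbd _ h.horo u hu.1.le hu.2
    rw [show (F u (y * u ^ 2) - FourSq.horo F (y * u ^ 2)) - (F u w - FourSq.horo F w) =
      (F u (y * u ^ 2) - F u w) - (FourSq.horo F (y * u ^ 2) - FourSq.horo F w) by ring]
    exact (abs_sub _ _).trans (by linarith)
  have hper' : Function.Periodic (fun u => F u w) 2 := fun x => hper x w
  have hzero : ∫ u in (2 * k : ℝ)..(2 * k + 2), (F u w - FourSq.horo F w) = 0 := by
    rw [intervalIntegral.integral_sub ((h.continuous_slice hw0).intervalIntegrable _ _)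
      intervalIntegrable_const, hper'.intervalIntegral_add_eq (2 * k) 0, zero_add,
      intervalIntegral.integral_const, FourSq.horo, smul_eq_mul]
    ring
  have hci : ∀ G : ℝ → ℝ → ℝ, Tame G C →
      IntervalIntegrable (fun u : ℝ => G u (y * u ^ 2)) volume (2 * k : ℝ) (2 * k + 2) := by
    intro G hG
    refine (intervalIntegrable_iff_integrableOn_Ioc_of_le (by linarith)).2
      ((hG.integrableOn hy).mono_set fun u hu => ?_)
    have : (2 * k : ℝ) < u := hu.1
    exact (by positivity : (0 : ℝ) ≤ 2 * k).trans_lt this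
  have hint := intervalIntegral.norm_integral_le_of_norm_le_const hpt
  rw [intervalIntegral.integral_sub ((hci F h).sub (hci _ h.horo))
    (((h.continuous_slice hw0).intervalIntegrable _ _).sub intervalIntegrable_const), hzero,
    sub_zero] at hint
  refine hint.trans ?_
  have e1 : w ^ (-η) ≤ y ^ (-η) * (k : ℝ) ^ (-2 * η) := by
    have : (k : ℝ) ^ (-2 * η) = ((k : ℝ) ^ 2) ^ (-η) := by
      rw [← Real.rpow_natCast, ← Real.rpow_mul hk0.le]
      congr 1
      push_cast
      ring
    rw [this, ← Real.mul_rpow hy.le (by positivity)]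
    refine Real.rpow_le_rpow_of_nonpos (by positivity) ?_ (by linarith)
    rw [hw]
    gcongr
    linarith
  have e2 : (k : ℝ) ^ (-1 - 2 * η) = (k : ℝ)⁻¹ * (k : ℝ) ^ (-2 * η) := by
    rw [← Real.rpow_neg_one, ← Real.rpow_add hk0]
    congr 1
    ring
  rw [add_sub_cancel_left, abs_two, e2]
  calc 2 * (C * (2 / k) * w ^ (-η)) * 2 ≤ 2 * (C * (2 / k) * (y ^ (-η) * (k : ℝ) ^ (-2 * η)))
    * 2 := by
        gcongr
    _ = _ := by
        field_simp
        ring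

lemma Tame.average {F : ℝ → ℝ → ℝ} {C : ℝ} (h : Tame F C) (hper : ∀ x v, F (x + 2) v = F x v)
    {η : ℝ} (hη : 0 < η) (hη1 : η < 1) :
    ∃ K : ℝ, 0 < K ∧ ∀ y : ℝ, 0 < y → y ≤ 1 →
      |(∫ u in Ioi (0 : ℝ), F u (y * u ^ 2)) - ∫ u in Ioi (0 : ℝ), FourSq.horo F (y * u ^ 2)| ≤
        K * y ^ (-η) := by
  have hC := h.pos
  have hsum : Summable fun k : ℕ => (k : ℝ) ^ (-1 - 2 * η) :=
    Real.summable_nat_rpow.2 (by linarith)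
  have hS0 : 0 ≤ ∑' k : ℕ, (k : ℝ) ^ (-1 - 2 * η) := tsum_nonneg fun k => by positivity
  refine ⟨4 * C + 8 * C * ∑' k : ℕ, (k : ℝ) ^ (-1 - 2 * η), by positivity, fun y hy hy1 => ?_⟩
  have hi1 := h.integrableOn hy
  have hi2 := h.horo.integrableOn hy
  rw [← integral_sub hi1 hi2]
  set T : ℝ → ℝ := fun u => F u (y * u ^ 2) - FourSq.horo F (y * u ^ 2)
  have hT : IntegrableOn T (Ioi 0) := hi1.sub hi2
  have htend : Filter.Tendsto (fun N : ℕ => ∫ u in (0 : ℝ)..(2 * N), T u) Filter.atTop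
      (nhds (∫ u in Ioi (0 : ℝ), T u)) :=
    intervalIntegral_tendsto_integral_Ioi 0 hT
      (tendsto_natCast_atTop_atTop.const_mul_atTop two_pos)
  have hyη : 1 ≤ y ^ (-η) := Real.one_le_rpow_of_pos_of_le_one_of_nonpos hy hy1 (by linarith)
  have hblk : ∀ k : ℕ, |∫ u in (2 * k : ℝ)..(2 * (k + 1 : ℕ)), T u| ≤
      (if k = 0 then 4 * C else 0) + 8 * C * y ^ (-η) * (k : ℝ) ^ (-1 - 2 * η) := by
    intro k
    rw [show (2 * (k + 1 : ℕ) : ℝ) = 2 * k + 2 by push_cast; ring]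
    rcases Nat.eq_zero_or_pos k with rfl | hk
    · have := intervalIntegral.norm_integral_le_of_norm_le_const (a := 0) (b := 2) (f := T)
        (C := 2 * C) fun u hu => by
          rw [uIoc_of_le zero_le_two] at hu
          have hu0 : 0 < u := hu.1
          have a1 := h.bdd u (y * u ^ 2) (by positivity)
          have a2 := h.horo.bdd u (y * u ^ 2) (by positivity)
          exact (abs_sub _ _).trans (by linarith)
      rw [if_pos rfl, Nat.cast_zero, mul_zero, zero_add, Real.zero_rpow (by linarith), mul_zero,
        add_zero]
      refine this.trans (le_of_eq ?_)
      rw [sub_zero, abs_two]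
      ring
    · rw [if_neg hk.ne', zero_add]
      exact h.block hper hη.le hη1.le hy hk
  refine le_of_tendsto htend.abs (Filter.Eventually.of_forall fun N => ?_)
  have hii : ∀ k < N, IntervalIntegrable T volume (2 * k : ℝ) (2 * (k + 1 : ℕ)) := by
    intro k _
    refine (intervalIntegrable_iff_integrableOn_Ioc_of_le (by push_cast; linarith)).2
      (hT.mono_set fun u hu => ?_)
    exact (by positivity : (0 : ℝ) ≤ 2 * k).trans_lt hu.1
  have hadj := intervalIntegral.sum_integral_adjacent_intervals (a := fun k : ℕ => (2 * k : ℝ)) hii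
  rw [Nat.cast_zero, mul_zero] at hadj
  rw [← hadj]
  refine (Finset.abs_sum_le_sum_abs _ _).trans ((Finset.sum_le_sum fun k _ => hblk k).trans ?_)
  rw [Finset.sum_add_distrib, ← Finset.mul_sum]
  have s1 : ∑ k ∈ Finset.range N, (if k = 0 then 4 * C else 0) ≤ 4 * C := by
    rw [Finset.sum_ite_eq']
    split_ifs <;> linarith
  have s2 := hsum.sum_le_tsum (Finset.range N) fun k _ => by positivity
  calc _ ≤ 4 * C + 8 * C * y ^ (-η) * ∑' k : ℕ, (k : ℝ) ^ (-1 - 2 * η) := by gcongr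
    _ ≤ 4 * C * y ^ (-η) + 8 * C * y ^ (-η) * ∑' k : ℕ, (k : ℝ) ^ (-1 - 2 * η) := by
        exact add_le_add_left (le_mul_of_one_le_right (by positivity) hyη) _
    _ = _ := by ring

lemma integral_comp_mul_sq (f : ℝ → ℝ) {y : ℝ} (hy : 0 < y) :
    ∫ u in Ioi (0 : ℝ), f (y * u ^ 2) = (√y)⁻¹ / 2 * ∫ v in Ioi (0 : ℝ), f v *
      v ^ (-1 / 2 : ℝ) := by
  have h1 := integral_comp_rpow_Ioi_of_pos (g := fun v : ℝ => f v * v ^ (-1 / 2 : ℝ)) two_pos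
  have h2 := integral_comp_mul_left_Ioi (fun u : ℝ => f (u ^ 2)) 0 (Real.sqrt_pos.2 hy)
  have h3 : ∫ x in Ioi (0 : ℝ),
    (2 * x ^ ((2 : ℝ) - 1)) • (f (x ^ (2 : ℝ)) * (x ^ (2 : ℝ)) ^ (-1 / 2 : ℝ)) =
      2 * ∫ x in Ioi (0 : ℝ), f (x ^ 2) := by
    rw [← integral_const_mul]
    refine setIntegral_congr_fun measurableSet_Ioi fun x hx => ?_
    have hx : 0 < x := hx
    have e1 : (x ^ 2) ^ (-1 / 2 : ℝ) = x⁻¹ := by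
      rw [← Real.rpow_two, ← Real.rpow_mul hx.le, ← Real.rpow_neg_one]
      norm_num
    have e2 : x ^ ((2 : ℝ) - 1) = x := by
      rw [show (2 : ℝ) - 1 = 1 by norm_num, Real.rpow_one]
    simp only [e1, e2, Real.rpow_two, smul_eq_mul]
    field_simp
  rw [← h1, h3]
  simp only [mul_pow, Real.sq_sqrt hy.le, mul_zero, smul_eq_mul] at h2
  rw [h2]
  ring

lemma integral_pker_inversion {F G : ℝ → ℝ → ℝ} {y : ℝ}
    (hFG : ∀ x, 0 < x → F x y = G (x / (x ^ 2 + y ^ 2)) (y / (x ^ 2 + y ^ 2))) :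
    ∫ x in Ioi (0 : ℝ), F x y * pker y x =
      ∫ u in Ioi (0 : ℝ), G (u / (1 + (y * u) ^ 2)) (y * u ^ 2 / (1 + (y * u) ^ 2)) *
        (y / (1 + (y * u) ^ 2)) := by
  rw [← integral_comp_rpow_Ioi (fun x => F x y * pker y x) (p := -1) (by norm_num)]
  refine setIntegral_congr_fun measurableSet_Ioi fun u hu => ?_
  have hu : 0 < u := hu
  have e1 : u ^ ((-1 : ℝ) - 1) = (u ^ 2)⁻¹ := by
    rw [show (-1 : ℝ) - 1 = -2 by norm_num, Real.rpow_neg hu.le]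
    norm_cast
  have e2 : u⁻¹ / (u⁻¹ ^ 2 + y ^ 2) = u / (1 + (y * u) ^ 2) := by
    field_simp
  have e3 : y / (u⁻¹ ^ 2 + y ^ 2) = y * u ^ 2 / (1 + (y * u) ^ 2) := by
    field_simp
  simp only [e1, Real.rpow_neg_one, smul_eq_mul, hFG u⁻¹ (inv_pos.2 hu), pker, e2, e3, abs_neg,
    abs_one]
  field_simp

lemma Bf_inversion (x : ℝ) {y : ℝ} (hy : 0 < y) :
    Bf x y = Bf (-(x / (x ^ 2 + y ^ 2))) (y / (x ^ 2 + y ^ 2)) := by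
  have hz : 0 < ((x : ℂ) + y * Complex.I).im := by simpa using hy
  rw [Bf, Bf, ← B0_neg_inv hz]
  congr 1
  have hne : (x : ℂ) + y * Complex.I ≠ 0 := fun h => by simp [h] at hz
  have hs : (x : ℝ) ^ 2 + y ^ 2 ≠ 0 := by positivity
  have hs' : (x : ℂ) ^ 2 + y ^ 2 ≠ 0 := by exact_mod_cast hs
  have hI := Complex.I_sq
  push_cast
  rw [neg_eq_iff_eq_neg]
  refine inv_eq_of_mul_eq_one_left ?_
  field_simp
  linear_combination (-(y : ℂ) ^ 2) * hI

lemma horo_neg {F : ℝ → ℝ → ℝ} (hper : ∀ x v, F (x + 2) v = F x v) (v : ℝ) :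
    horo (fun x v => F (-x) v) v = horo F v := by
  have hper' : Function.Periodic (fun u => F u v) 2 := fun x => hper x v
  rw [horo, horo, intervalIntegral.integral_comp_neg (fun u => F u v)]
  have := hper'.intervalIntegral_add_eq (-2) 0
  norm_num at this ⊢
  exact this

lemma integral_B0_pker {η : ℝ} (hη : 0 < η) (hη1 : η < 1) :
    ∃ K : ℝ, 0 < K ∧ ∀ y : ℝ, 0 < y → y ≤ 1 →
      |(∫ x : ℝ, Bf x y * pker y x) - √y * ∫ v in Ioi (0 : ℝ), horo Bf v * v ^ (-1 / 2 : ℝ)| ≤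
        K * y ^ (1 - η) := by
  obtain ⟨C, hB⟩ := exists_tame_Bf
  have hper : ∀ x v, (fun x v => Bf (-x) v) (x + 2) v = (fun x v => Bf (-x) v) x v := fun x v => by
    have := Bf_add_two (-(x + 2)) v
    simp only
    rw [← this]
    ring_nf
  have half : ∀ F G : ℝ → ℝ → ℝ, Tame G C → (∀ x v, G (x + 2) v = G x v) →
      (∀ v, horo G v = horo Bf v) →
      (∀ x y, 0 < y → F x y = G (x / (x ^ 2 + y ^ 2)) (y / (x ^ 2 + y ^ 2))) →
      ∃ K : ℝ, 0 < K ∧ ∀ y : ℝ, 0 < y → y ≤ 1 →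
        |(∫ x in Ioi (0 : ℝ), F x y * pker y x) -
          √y / 2 * ∫ v in Ioi (0 : ℝ), horo Bf v * v ^ (-1 / 2 : ℝ)| ≤ K * y ^ (1 - η) := by
    intro F G hG hGper hh hFG
    obtain ⟨K1, hK1, h1⟩ := hG.parabola hη hη1
    obtain ⟨K2, hK2, h2⟩ := hG.average hGper hη hη1
    refine ⟨K1 + K2, by positivity, fun y hy hy1 => ?_⟩
    have a1 := h1 y hy hy1
    have a2 := h2 y hy hy1
    rw [← integral_pker_inversion (fun x _ => hFG x y hy)] at a1
    simp only [hh] at a2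
    rw [integral_comp_mul_sq _ hy] at a2
    have a3 := mul_le_mul_of_nonneg_left a2 hy.le
    rw [← abs_of_pos hy, ← abs_mul, abs_of_pos hy, mul_sub] at a3
    have e1 : y * ((√y)⁻¹ / 2 * ∫ v in Ioi (0 : ℝ), horo Bf v * v ^ (-1 / 2 : ℝ)) =
        √y / 2 * ∫ v in Ioi (0 : ℝ), horo Bf v * v ^ (-1 / 2 : ℝ) := by
      have : y * (√y)⁻¹ = √y := by
        rw [← div_eq_mul_inv, Real.div_sqrt]
      linear_combination (1 / 2 * ∫ v in Ioi (0 : ℝ), horo Bf v * v ^ (-1 / 2 : ℝ)) * this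
    have e2 : y * (K2 * y ^ (-η)) = K2 * y ^ (1 - η) := by
      rw [sub_eq_add_neg, Real.rpow_add hy, Real.rpow_one]
      ring
    rw [e1, e2] at a3
    refine (abs_sub_le _ _ _).trans ((add_le_add a1 a3).trans (le_of_eq (by ring)))
  obtain ⟨K1, hK1, h1⟩ := half Bf (fun x v => Bf (-x) v) hB.neg hper (horo_neg Bf_add_two)
    fun x y hy => Bf_inversion x hy
  obtain ⟨K2, hK2, h2⟩ := half (fun x v => Bf (-x) v) Bf hB Bf_add_two (fun _ => rfl)
    fun x y hy => by
      have := Bf_inversion (-x) hy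
      simp only [neg_sq, neg_div, neg_neg] at this
      exact this
  refine ⟨K1 + K2, by positivity, fun y hy hy1 => ?_⟩
  have hint : Integrable fun x => Bf x y * pker y x := by
    refine (integrable_pker hy).bdd_mul (c := C) (hB.continuous_slice hy).aestronglyMeasurable ?_
    exact Filter.Eventually.of_forall fun x => hB.bdd x y hy
  have hsplit : ∫ x : ℝ, Bf x y * pker y x = (∫ x in Ioi (0 : ℝ), Bf x y * pker y x) +
      ∫ x in Ioi (0 : ℝ), Bf (-x) y * pker y x := by
    rw [← integral_add_compl (s := Ioi 0) measurableSet_Ioi hint, compl_Ioi]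
    congr 1
    have := integral_comp_neg_Ioi 0 fun x => Bf x y * pker y x
    rw [neg_zero] at this
    rw [← this]
    simp only [pker, neg_sq]
  have a1 := h1 y hy hy1
  have a2 := h2 y hy hy1
  rw [hsplit]
  have e : ((∫ x in Ioi (0 : ℝ), Bf x y * pker y x) + ∫ x in Ioi (0 : ℝ), Bf (-x) y * pker y x) -
      √y * ∫ v in Ioi (0 : ℝ), horo Bf v * v ^ (-1 / 2 : ℝ) =
      ((∫ x in Ioi (0 : ℝ), Bf x y * pker y x) -
          √y / 2 * ∫ v in Ioi (0 : ℝ), horo Bf v * v ^ (-1 / 2 : ℝ)) +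
      ((∫ x in Ioi (0 : ℝ), Bf (-x) y * pker y x) -
          √y / 2 * ∫ v in Ioi (0 : ℝ), horo Bf v * v ^ (-1 / 2 : ℝ)) := by ring
  rw [e]
  refine (abs_add_le _ _).trans ((add_le_add a1 a2).trans (le_of_eq (by ring)))

end FourSq

namespace FourSq

open MeasureTheory Set

lemma hasSum_integral_step_two {f : ℝ → ℝ} (hf : Integrable f) (e : ℝ) :
    HasSum (fun k : ℤ => ∫ t in (2 * k + e : ℝ)..(2 * k + e + 2), f t) (∫ t, f t) := by
  have h := ((hf.comp_mul_left' (two_ne_zero (α := ℝ))).hasSum_intervalIntegral (e / 2)).mul_left 2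
  rw [Measure.integral_comp_mul_left, abs_of_pos (by positivity), smul_eq_mul,
    mul_inv_cancel_left₀ two_ne_zero] at h
  suffices hfun : (fun k : ℤ => 2 * ∫ x in (e / 2 + k : ℝ)..(e / 2 + k + 1), f (2 * x)) =
      fun k : ℤ => ∫ t in (2 * k + e : ℝ)..(2 * k + e + 2), f t from hfun ▸ h
  funext k
  rw [intervalIntegral.integral_comp_mul_left _ two_ne_zero, smul_eq_mul,
    mul_inv_cancel_left₀ two_ne_zero]
  congr 1 <;> ring

lemma hasSum_integral_step {f : ℝ → ℝ} (hf : Integrable f) (e : ℝ) (n : ℕ) :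
    HasSum (fun k : ℤ => ∫ t in (2 * k + e : ℝ)..(2 * k + e + 2 * n), f t) (n * ∫ t, f t) := by
  induction n with
  | zero => simp [hasSum_zero]
  | succ n ih =>
    have h := ih.add (hasSum_integral_step_two hf (e + 2 * n))
    rw [← add_one_mul, ← Nat.cast_succ] at h
    suffices hfun : (fun k : ℤ => (∫ t in (2 * k + e : ℝ)..(2 * k + e + 2 * n), f t) +
        ∫ t in (2 * k + (e + 2 * n) : ℝ)..(2 * k + (e + 2 * n) + 2), f t) =
        fun k : ℤ => ∫ t in (2 * k + e : ℝ)..(2 * k + e + 2 * (n + 1 : ℕ)), f t from hfun ▸ h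
    funext k
    rw [← add_assoc, intervalIntegral.integral_add_adjacent_intervals hf.intervalIntegrable
      hf.intervalIntegrable]
    congr 1
    push_cast
    ring

lemma hasSum_integral_unfold {f : ℝ → ℝ} (hf : Integrable f) (e : ℝ) {c : ℤ} (hc : c ≠ 0) :
    HasSum (fun k : ℤ => ∫ x in (0 : ℝ)..2, f (c * x + (2 * k + e))) (∫ t, f t) := by
  have hc' : (c : ℝ) ≠ 0 := by exact_mod_cast hc
  simp only [intervalIntegral.integral_comp_mul_add _ hc', mul_zero, zero_add, smul_eq_mul]
  obtain ⟨n, rfl | rfl⟩ := c.eq_nat_or_neg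
  · have h := (hasSum_integral_step hf e n).mul_left ((n : ℝ)⁻¹)
    push_cast at hc' ⊢
    rw [inv_mul_cancel_left₀ hc'] at h
    suffices hfun : (fun k : ℤ => (n : ℝ)⁻¹ * ∫ t in (2 * k + e : ℝ)..(2 * k + e + 2 * n), f t) =
        fun k : ℤ => (n : ℝ)⁻¹ * ∫ t in (2 * k + e : ℝ)..(n * 2 + (2 * k + e)), f t from hfun ▸ h
    funext k
    congr 2
    ring
  · have h := (hasSum_integral_step hf (e - 2 * n) n).mul_left ((n : ℝ)⁻¹)
    push_cast at hc' ⊢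
    rw [inv_mul_cancel_left₀ (neg_ne_zero.1 hc')] at h
    suffices hfun : (fun k : ℤ => (n : ℝ)⁻¹ *
      ∫ t in (2 * k + (e - 2 * n) : ℝ)..(2 * k + (e - 2 * n) + 2 * n), f t) =
        fun k : ℤ => (-(n : ℝ))⁻¹ * ∫ t in (2 * k + e : ℝ)..(-n * 2 + (2 * k + e)),
          f t from hfun ▸ h
    funext k
    rw [intervalIntegral.integral_symm, inv_neg, mul_neg, neg_mul]
    congr 3 <;> ring

lemma integrable_inv_sq : Integrable fun t : ℝ => ((1 + t ^ 2) ^ 2)⁻¹ := by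
  refine integrable_inv_one_add_sq.mono' ?_ (Filter.Eventually.of_forall fun t => ?_)
  · refine Continuous.aestronglyMeasurable ?_
    have : ∀ t : ℝ, (1 + t ^ 2) ^ 2 ≠ 0 := fun t => by positivity
    fun_prop (disch := exact this _)
  · rw [Real.norm_of_nonneg (by positivity)]
    apply inv_anti₀ (by positivity)
    nlinarith [sq_nonneg t]

lemma integral_quartic {v a : ℝ} (hv : 0 < v) (ha : a ≠ 0) :
    (Integrable fun t : ℝ => v ^ 2 / (t ^ 2 + (a * v) ^ 2) ^ 2) ∧
    ∫ t : ℝ, v ^ 2 / (t ^ 2 + (a * v) ^ 2) ^ 2 =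
      (∫ t : ℝ, ((1 + t ^ 2) ^ 2)⁻¹) / v * (|a| ^ 3)⁻¹ := by
  have ha' : 0 < |a| := abs_pos.2 ha
  have hav : (|a| * v)⁻¹ ≠ 0 := by positivity
  have e : ∀ t : ℝ, v ^ 2 / (t ^ 2 + (a * v) ^ 2) ^ 2 =
      v ^ 2 / (|a| * v) ^ 4 * ((1 + ((|a| * v)⁻¹ * t) ^ 2) ^ 2)⁻¹ := by
    intro t
    rw [← sq_abs (a * v), abs_mul, abs_of_pos hv]
    field_simp
    ring
  simp only [e]
  refine ⟨(integrable_inv_sq.comp_mul_left' hav).const_mul _, ?_⟩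
  rw [integral_const_mul, Measure.integral_comp_mul_left (fun t : ℝ => ((1 + t ^ 2) ^ 2)⁻¹),
    inv_inv, abs_mul, abs_abs, abs_of_pos hv, smul_eq_mul]
  field_simp

lemma hasSum_w0_iff (c : ℤ) (g : ℤ → ℝ) (s : ℝ) :
    HasSum (fun d : ℤ => w0 (c, d) * g d) s ↔ HasSum (fun k : ℤ => g (2 * k + (c + 1))) s := by
  have hinj : Function.Injective fun k : ℤ => 2 * k + (c + 1) := fun a b h => by
    simp only at h
    omega
  rw [← hinj.hasSum_iff]
  · suffices hfun : (fun d : ℤ => w0 (c, d) * g d) ∘ (fun k : ℤ => 2 * k + (c + 1)) =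
        fun k : ℤ => g (2 * k + (c + 1)) by rw [hfun]
    funext k
    have : Odd (c + (2 * k + (c + 1))) := ⟨k + c, by ring⟩
    simp [w0, this]
  · intro d hd
    have : ¬Odd (c + d) := fun ⟨m, hm⟩ => hd ⟨m - c, by simp only; omega⟩
    simp [w0, this]

lemma exists_integral_Hs : ∃ c : ℝ, ∀ v : ℝ, 0 < v →
    ∫ x in (0 : ℝ)..2, Hs w0 (x + v * Complex.I) = c / v := by
  set I0 : ℝ := ∫ t : ℝ, ((1 + t ^ 2) ^ 2)⁻¹ with hI0
  have hsum : Summable fun c : ℤ => if c = 0 then 0 else (|(c : ℝ)| ^ 3)⁻¹ := by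
    have h := (Real.summable_one_div_int_pow (p := 3)).2 (by norm_num)
    refine h.abs.congr fun c => ?_
    split_ifs with hc
    · simp [hc]
    · rw [abs_div, abs_one, abs_pow, one_div]
  refine ⟨I0 * ∑' c : ℤ, if c = 0 then 0 else (|(c : ℝ)| ^ 3)⁻¹, fun v hv => ?_⟩
  set F : ℤ × ℤ → ℝ → ℝ := fun p x => if p.1 = 0 then 0 else w0 p * eterm p (x + v * Complex.I)
    with hF
  have hF0 : ∀ p x, 0 ≤ F p x := fun p x => by
    simp only [hF]
    split_ifs
    exacts [le_rfl, mul_nonneg (w0_mem p).1 (eterm_nonneg p _)]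
  have he : ∀ (p : ℤ × ℤ) (x : ℝ), eterm p (x + v * Complex.I) =
      v ^ 2 / ((p.1 * x + p.2) ^ 2 + (p.1 * v) ^ 2) ^ 2 := fun p x => by
    rw [eterm_eq]
    simp
  have hcont : ∀ p, Continuous (F p) := by
    intro p
    simp only [hF]
    split_ifs with hp
    · exact continuous_const
    · simp only [he]
      have hp' : (p.1 : ℝ) ≠ 0 := by exact_mod_cast hp
      have : ∀ x : ℝ, ((p.1 * x + p.2) ^ 2 + (p.1 * v) ^ 2) ^ 2 ≠ 0 := fun x => by positivity
      fun_prop (disch := exact this _)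
  have hfib : ∀ c : ℤ, HasSum (fun d : ℤ => ∫ x in (0 : ℝ)..2, F (c, d) x)
      (I0 / v * if c = 0 then 0 else (|(c : ℝ)| ^ 3)⁻¹) := by
    intro c
    simp only [hF]
    split_ifs with hc
    · simp [hasSum_zero]
    · have hc' : (c : ℝ) ≠ 0 := by exact_mod_cast hc
      obtain ⟨h1, h2⟩ := integral_quartic hv hc'
      simp only [intervalIntegral.integral_const_mul]
      rw [hasSum_w0_iff c (fun d => ∫ x in (0 : ℝ)..2, eterm (c, d) (x + v * Complex.I)), ← h2]
      have h3 := hasSum_integral_unfold h1 (c + 1) hc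
      simp only [he]
      push_cast
      exact h3
  have hIs : Summable fun p => ∫ x in (0 : ℝ)..2, F p x := by
    refine (summable_prod_of_nonneg fun p => ?_).2 ⟨fun c => (hfib c).summable, ?_⟩
    · exact intervalIntegral.integral_nonneg zero_le_two fun x _ => hF0 p x
    · simp only [(hfib _).tsum_eq]
      exact hsum.mul_left _
  have hswap := hasSum_integral_of_summable_integral_norm (μ := volume.restrict (Ioc (0 : ℝ) 2))
    (F := F) (fun p => ((hcont p).intervalIntegrable 0 2).1) (by
      refine hIs.congr fun p => ?_
      rw [intervalIntegral.integral_of_le zero_le_two]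
      exact integral_congr_ae (Filter.Eventually.of_forall fun x =>
        (Real.norm_of_nonneg (hF0 p x)).symm))
  have e1 : ∫ x in (0 : ℝ)..2, Hs w0 (x + v * Complex.I) = ∑' p, ∫ x in (0 : ℝ)..2, F p x := by
    simp only [intervalIntegral.integral_of_le (zero_le_two (α := ℝ))]
    exact hswap.tsum_eq.symm
  rw [e1, hIs.tsum_prod]
  simp only [(hfib _).tsum_eq]
  rw [tsum_mul_left]
  ring

/-- The positive-frequency part of the constant term of `Fth`. -/
noncomputable def Apos (v : ℝ) : ℝ := v ^ 2 * ∑' n : ℕ, r4 (n + 1) ^ 2 *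
    Real.exp (-(2 * π * v) * (n + 1))

lemma summable_r4_sq_exp {a : ℝ} (ha : 0 < a) : Summable fun n : ℕ => r4 n ^ 2 *
    Real.exp (-a * n) := by
  have h := (summable_r4_pow 2 ha).mul_left 8
  refine Summable.of_nonneg_of_le (fun n => by positivity) (fun n => ?_) h
  have h1 := r4_le n
  have h2 := r4_nonneg n
  have h3 := Real.exp_pos (-a * n)
  calc r4 n ^ 2 * Real.exp (-a * n) = r4 n * (r4 n * Real.exp (-a * n)) := by ring
    _ ≤ (8 * (n + 1) ^ 2) * (r4 n * Real.exp (-a * n)) := by gcongr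
    _ = _ := by ring

lemma continuous_Fth_slice {v : ℝ} (hv : 0 < v) : Continuous fun x : ℝ =>
    Fth (x + v * Complex.I) := by
  have h1 : ∀ x : ℝ, ContinuousAt jacobiTheta (x + v * Complex.I) := fun x =>
    (differentiableAt_jacobiTheta (by simpa using hv)).continuousAt
  have h2 : Continuous fun x : ℝ => jacobiTheta (x + v * Complex.I) :=
    continuous_iff_continuousAt.2 fun x =>
      ContinuousAt.comp (f := fun x : ℝ => (x : ℂ) + v * Complex.I) (h1 x) (by fun_prop)
  simp only [Fth]
  fun_prop

lemma exists_horo_Bf : ∃ c : ℝ, ∀ v : ℝ, 0 < v → horo Bf v = Apos v - c / v := by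
  obtain ⟨c, hc⟩ := exists_integral_Hs
  refine ⟨c / 2 / (π ^ 4 / 48), fun v hv => ?_⟩
  have hz : ∀ x : ℝ, 0 < ((x : ℂ) + v * Complex.I).im := fun x => by simpa using hv
  obtain ⟨C, hB⟩ := exists_tame_Bf
  have hG : ∀ x : ℝ, Gs w0 (x + v * Complex.I) = Hs w0 (x + v * Complex.I) + π ^ 4 / 48 *
    v ^ 2 := by
    intro x
    have := Gs_w0_eq ⟨x + v * Complex.I, hz x⟩
    have him : (⟨x + v * Complex.I, hz x⟩ : UpperHalfPlane).im = v := by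
      change ((x : ℂ) + v * Complex.I).im = v
      simp
    rw [him] at this
    exact this
  have hFc := continuous_Fth_slice hv
  have hHB : ∀ x : ℝ, Hs w0 (x + v * Complex.I) =
      π ^ 4 / 48 * (Fth (x + v * Complex.I) - Bf x v - v ^ 2) := by
    intro x
    rw [Bf, B0, hG]
    field_simp
    ring
  have hHc : Continuous fun x : ℝ => Hs w0 (x + v * Complex.I) := by
    simp only [hHB]
    have := hB.continuous_slice hv
    fun_prop
  have hI := hc v hv
  have hBf : ∀ x : ℝ, Bf x v = Fth (x + v * Complex.I) - (π ^ 4 / 48)⁻¹ *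
    Hs w0 (x + v * Complex.I) -
      v ^ 2 := by
    intro x
    rw [hHB]
    field_simp
    ring
  have hT := summable_r4_sq_exp (a := 2 * π * v) (by positivity)
  have htail := hT.tsum_eq_zero_add
  rw [horo]
  simp only [hBf]
  rw [intervalIntegral.integral_sub ((hFc.intervalIntegrable _ _).sub
    ((hHc.intervalIntegrable _ _).const_mul _)) intervalIntegrable_const,
    intervalIntegral.integral_sub (hFc.intervalIntegrable _ _)
    ((hHc.intervalIntegrable _ _).const_mul _), intervalIntegral.integral_const_mul, hI,
    integral_Fth_period hv, intervalIntegral.integral_const, Apos, htail, r4_zero]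
  simp
  ring

end FourSq

namespace FourSq

open MeasureTheory Set Filter Asymptotics

lemma abs_Apos_le {v : ℝ} (hv : 1 ≤ v) : |Apos v| ≤ 2 * Real.exp (2 * π) * Apos 1 *
    Real.exp (-1 * v) := by
  have hT : ∀ a : ℝ, 0 < a → Summable fun n : ℕ => r4 (n + 1) ^ 2 *
    Real.exp (-(2 * π * a) * (n + 1)) := by
    intro a ha
    have := (summable_nat_add_iff 1).2 (summable_r4_sq_exp (a := 2 * π * a) (by positivity))
    simpa only [Nat.cast_add, Nat.cast_one] using this
  have hle : ∀ n : ℕ, r4 (n + 1) ^ 2 * Real.exp (-(2 * π * v) * (n + 1)) ≤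
      Real.exp (-(2 * π) * (v - 1)) * (r4 (n + 1) ^ 2 * Real.exp (-(2 * π * 1) * (n + 1))) := by
    intro n
    rw [mul_left_comm, ← Real.exp_add]
    gcongr
    have : 0 ≤ 2 * π * (v - 1) * n := by
      have := sub_nonneg.2 hv
      positivity
    linarith
  have h1 := (hT v (by linarith)).tsum_le_tsum hle ((hT 1 one_pos).mul_left _)
  rw [tsum_mul_left] at h1
  have h0 : 0 ≤ Apos v := mul_nonneg (sq_nonneg _) (tsum_nonneg fun n => by positivity)
  have h2 : v ^ 2 ≤ 2 * Real.exp v := by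
    have := Real.quadratic_le_exp_of_nonneg (x := v) (by linarith)
    linarith
  have hA : 0 ≤ Apos 1 := mul_nonneg (sq_nonneg _) (tsum_nonneg fun n => by positivity)
  have e1 : ∑' n : ℕ, r4 (n + 1) ^ 2 * Real.exp (-(2 * π * 1) * (n + 1)) = Apos 1 := by simp [Apos]
  rw [e1] at h1
  rw [abs_of_nonneg h0, Apos]
  have h3 : Real.exp v * Real.exp (-(2 * π) * (v - 1)) ≤ Real.exp (2 * π) * Real.exp (-1 * v) := by
    rw [← Real.exp_add, ← Real.exp_add]
    apply Real.exp_le_exp.2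
    nlinarith [Real.pi_gt_three]
  calc _ ≤ (2 * Real.exp v) * (Real.exp (-(2 * π) * (v - 1)) * Apos 1) := by gcongr
    _ = 2 * Apos 1 * (Real.exp v * Real.exp (-(2 * π) * (v - 1))) := by ring
    _ ≤ 2 * Apos 1 * (Real.exp (2 * π) * Real.exp (-1 * v)) := by gcongr
    _ = _ := by ring

lemma Apos_isBigO_top (a : ℝ) : (fun t : ℝ => (Apos t : ℂ)) =O[atTop] (· ^ (-a) : ℝ → ℝ) := by
  refine IsBigO.trans (IsBigO.of_bound (2 * Real.exp (2 * π) * Apos 1) ?_)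
    (isLittleO_exp_neg_mul_rpow_atTop one_pos (-a)).isBigO
  filter_upwards [eventually_ge_atTop 1] with v hv
  rw [Complex.norm_real, Real.norm_eq_abs, Real.norm_of_nonneg (Real.exp_pos _).le]
  exact abs_Apos_le hv

/-- `Apos` with its polar part at `0` removed. -/
noncomputable def Areg (c t : ℝ) : ℂ :=
  (Apos t : ℂ) - (c : ℂ) • indicator (Ioc 0 1) (fun t : ℝ => (t : ℂ) ^ (-1 : ℂ)) t

lemma Areg_isBigO_top (c a : ℝ) : Areg c =O[atTop] (· ^ (-a) : ℝ → ℝ) := by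
  refine (Apos_isBigO_top a).congr' ?_ EventuallyEq.rfl
  filter_upwards [eventually_gt_atTop 1] with t ht
  rw [Areg, indicator_of_notMem (fun h => by linarith [h.2])]
  simp

lemma continuousOn_horo_Bf : ContinuousOn (horo Bf) (Ioi 0) := by
  obtain ⟨C, hB⟩ := exists_tame_Bf
  exact hB.horo.cont.comp (f := fun v : ℝ => ((0 : ℝ), v)) (by fun_prop) fun v hv => hv

section

variable {c : ℝ} (hc : ∀ v : ℝ, 0 < v → horo Bf v = Apos v - c / v)
include hc

lemma locallyIntegrableOn_Apos : LocallyIntegrableOn (fun t : ℝ => (Apos t : ℂ)) (Ioi 0) := by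
  refine ContinuousOn.locallyIntegrableOn ?_ measurableSet_Ioi
  refine Complex.continuous_ofReal.comp_continuousOn ?_
  have : ContinuousOn (fun v => horo Bf v + c / v) (Ioi 0) :=
    continuousOn_horo_Bf.add (continuousOn_const.div continuousOn_id fun v hv => (ne_of_gt hv))
  refine this.congr fun v hv => ?_
  change Apos v = horo Bf v + c / v
  rw [hc v hv]
  ring

lemma Apos_isBigO_zero :
    (fun t : ℝ => (Apos t : ℂ)) =O[nhdsWithin 0 (Ioi 0)] (· ^ (-1 : ℝ) : ℝ → ℝ) := by
  obtain ⟨C, hB⟩ := exists_tame_Bf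
  refine IsBigO.of_bound (C + |c|) ?_
  filter_upwards [Ioo_mem_nhdsGT one_pos] with v hv
  have hv0 : 0 < v := hv.1
  rw [Complex.norm_real, Real.norm_eq_abs, Real.norm_of_nonneg (by positivity), Real.rpow_neg_one]
  have h1 := hB.horo.decay 0 v hv0
  have h2 : Apos v = horo Bf v + c / v := by
    rw [hc v hv0]
    ring
  rw [h2]
  refine (abs_add_le _ _).trans ?_
  rw [abs_div, abs_of_pos hv0, add_mul, ← div_eq_mul_inv, ← div_eq_mul_inv]
  linarith

lemma Areg_eq_horo {t : ℝ} (ht : t ∈ Ioc (0 : ℝ) 1) : Areg c t = horo Bf t := by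
  rw [Areg, indicator_of_mem ht, hc t ht.1, Complex.cpow_neg_one, smul_eq_mul, div_eq_mul_inv]
  push_cast
  rfl

lemma locallyIntegrableOn_Areg : LocallyIntegrableOn (Areg c) (Ioi 0) := by
  refine (locallyIntegrableOn_Apos hc).sub (LocallyIntegrableOn.smul (c := (c : ℂ)) ?_)
  have h : LocallyIntegrableOn (fun t : ℝ => (t : ℂ) ^ (-1 : ℂ)) (Ioi 0) := by
    refine ContinuousOn.locallyIntegrableOn (fun t ht => ?_) measurableSet_Ioi
    exact (Complex.continuousAt_ofReal_cpow_const t _ (Or.inr (ne_of_gt ht))).continuousWithinAt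
  exact fun x hx => by
    obtain ⟨s, hs, hi⟩ := h x hx
    exact ⟨s, hs, hi.indicator measurableSet_Ioc⟩

lemma Areg_isBigO_zero : Areg c =O[nhdsWithin 0 (Ioi 0)] (· ^ (-0 : ℝ) : ℝ → ℝ) := by
  obtain ⟨C, hB⟩ := exists_tame_Bf
  refine IsBigO.of_bound C ?_
  filter_upwards [Ioo_mem_nhdsGT one_pos] with v hv
  rw [Areg_eq_horo hc ⟨hv.1, hv.2.le⟩, Complex.norm_real, neg_zero, Real.rpow_zero,
    norm_one, mul_one]
  exact hB.horo.bdd 0 v hv.1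

lemma differentiableAt_mellin_Areg {w : ℂ} (hw : 0 < w.re) :
    DifferentiableAt ℂ (mellin (Areg c)) w :=
  mellin_differentiableAt_of_isBigO_rpow (locallyIntegrableOn_Areg hc)
    (Areg_isBigO_top c (w.re + 1))
    (by linarith) (Areg_isBigO_zero hc) hw

lemma mellin_Areg_eq {w : ℂ} (hw : 1 < w.re) :
    mellin (Areg c) w = mellin (fun t => (Apos t : ℂ)) w - c / (w - 1) := by
  have h1 := mellinConvergent_of_isBigO_rpow (locallyIntegrableOn_Apos hc)
    (Apos_isBigO_top (w.re + 1)) (by linarith) (Apos_isBigO_zero hc) hw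
  have h2 := hasMellin_cpow_Ioc (-1) (s := w) (by simp; linarith)
  have h3 := hasMellin_const_smul h2.1 (c : ℂ)
  have h4 := (hasMellin_sub h1 h3.1).2
  rw [h3.2, h2.2] at h4
  rw [div_eq_mul_one_div, ← smul_eq_mul, sub_eq_add_neg w]
  exact h4

lemma integral_horo_eq_mellin :
    ((∫ v in Ioi (0 : ℝ), horo Bf v * v ^ (-1 / 2 : ℝ) : ℝ) : ℂ) = mellin (Areg c) (1 / 2) -
      2 * c := by
  have hconv := mellinConvergent_of_isBigO_rpow (s := 1 / 2) (locallyIntegrableOn_Areg hc)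
    (Areg_isBigO_top c 1) (by norm_num) (Areg_isBigO_zero hc) (by norm_num)
  have hI : IntegrableOn (fun t : ℝ => (c : ℂ) * (t : ℂ) ^ (-3 / 2 : ℂ)) (Ioi 1) :=
    (integrableOn_Ioi_cpow_of_lt (by norm_num) one_pos).const_mul _
  have hI' : ∫ t in Ioi (1 : ℝ), (c : ℂ) * (t : ℂ) ^ (-3 / 2 : ℂ) = 2 * c := by
    rw [integral_const_mul, integral_Ioi_cpow_of_lt (by norm_num) one_pos]
    norm_num
    ring
  rw [← hI', mellin, ← integral_complex_ofReal]
  have e : ∫ t in Ioi (1 : ℝ), (c : ℂ) * (t : ℂ) ^ (-3 / 2 : ℂ) =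
      ∫ t in Ioi (0 : ℝ), indicator (Ioi 1) (fun t : ℝ => (c : ℂ) * (t : ℂ) ^ (-3 / 2 : ℂ)) t := by
    rw [setIntegral_indicator measurableSet_Ioi, Ioi_inter_Ioi]
    norm_num
  rw [e, ← integral_sub hconv]
  · refine setIntegral_congr_fun measurableSet_Ioi fun t ht => ?_
    have ht : 0 < t := ht
    have htc : (t : ℂ) ≠ 0 := by exact_mod_cast ht.ne'
    have e2 : ((t ^ (-1 / 2 : ℝ) : ℝ) : ℂ) = (t : ℂ) ^ (1 / 2 - 1 : ℂ) := by
      rw [Complex.ofReal_cpow ht.le]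
      norm_num
    have e3 : (t : ℂ) ^ (-3 / 2 : ℂ) = (t : ℂ) ^ (1 / 2 - 1 : ℂ) / t := by
      rw [show (-3 / 2 : ℂ) = (1 / 2 - 1) - 1 by norm_num, Complex.cpow_sub (1 / 2 - 1) 1 htc,
        Complex.cpow_one]
    simp only [smul_eq_mul, Complex.ofReal_mul, e2]
    rcases le_or_gt t 1 with h | h
    · rw [indicator_of_notMem (by simpa using h), Areg_eq_horo hc ⟨ht, h⟩, sub_zero, mul_comm]
    · rw [indicator_of_mem (by simpa using h), Areg,
        indicator_of_notMem (fun h' => by linarith [h'.2]),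
        hc t ht, e3]
      push_cast
      simp only [smul_zero, sub_zero]
      ring
  · rw [integrable_indicator_iff measurableSet_Ioi, IntegrableOn,
      Measure.restrict_restrict measurableSet_Ioi,
      Ioi_inter_Ioi, sup_eq_left.2 zero_le_one]
    exact hI

end

lemma mellin_Apos {w : ℂ} (hw : 3 < w.re) :
    mellin (fun t => (Apos t : ℂ)) w =
      Complex.Gamma (w + 2) * (2 * π : ℂ) ^ (-(w + 2)) * (64 * ∑' n, dser (w + 2) n) := by
  have hs5 : 5 < (w + 2).re := by simp; linarith
  set s := w + 2 with hs
  have hsum := dser_summable hs5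
  have hnorm : ∀ n : ℕ, ‖dser s n‖ = (rho n : ℝ) ^ 2 * (n : ℝ) ^ (-s.re) := by
    intro n
    rcases Nat.eq_zero_or_pos n with rfl | hn
    · simp [dser, rho_zero]
    · rw [dser, norm_mul, norm_pow, Complex.norm_natCast, Complex.norm_natCast_cpow_of_pos hn]
      simp
  have hd0 : dser s 0 = 0 := by simp [dser, rho_zero]
  have h1 := hasSum_mellin (s := s) (a := fun n : ℕ => ((r4 (n + 1) ^ 2 : ℝ) : ℂ))
    (p := fun n : ℕ => 2 * π * (n + 1))
    (F := fun t => ((∑' n : ℕ, r4 (n + 1) ^ 2 * Real.exp (-(2 * π * t) * (n + 1)) : ℝ) : ℂ))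
    (fun n => Or.inr (by positivity)) (by linarith) (fun t ht => by
      have ht : 0 < t := ht
      have := (summable_nat_add_iff 1).2 (summable_r4_sq_exp (a := 2 * π * t) (by positivity))
      simp only [Nat.cast_add, Nat.cast_one] at this
      have h := Complex.hasSum_ofReal.2 this.hasSum
      suffices hfun :
        (fun n : ℕ => ((r4 (n + 1) ^ 2 * Real.exp (-(2 * π * t) * (n + 1)) : ℝ) : ℂ)) =
          fun n : ℕ => ((r4 (n + 1) ^ 2 : ℝ) : ℂ) * (Real.exp (-(2 * π * (n + 1)) * t) : ℝ) from
        hfun ▸ h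
      funext n
      rw [Complex.ofReal_mul]
      congr 3
      ring) (by
      have h := (((summable_nat_add_iff 1).2 hsum).mul_left (64 * (2 * π) ^ (-s.re)))
      refine h.congr fun n => ?_
      rw [hnorm, Complex.norm_real, Real.norm_of_nonneg (sq_nonneg _), r4_eq n.succ_ne_zero,
        Real.mul_rpow (x := 2 * π) (y := n + 1) (by positivity) (by positivity),
        Real.rpow_neg (x := 2 * π) (by positivity), Real.rpow_neg (by positivity)]
      push_cast
      field_simp
      norm_num
      ring)
  have h2 : (fun t : ℝ => (Apos t : ℂ)) = fun t : ℝ => (t : ℂ) ^ (2 : ℂ) •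
      ((∑' n : ℕ, r4 (n + 1) ^ 2 * Real.exp (-(2 * π * t) * (n + 1)) : ℝ) : ℂ) := by
    funext t
    rw [Apos, smul_eq_mul]
    norm_cast
  rw [h2, mellin_cpow_smul, ← hs, ← h1.tsum_eq, hsum.of_norm.tsum_eq_zero_add, hd0, zero_add,
    ← tsum_mul_left, ← tsum_mul_left]
  congr 1
  funext n
  have hn : (0 : ℝ) < n + 1 := by positivity
  rw [dser, r4_eq n.succ_ne_zero]
  push_cast
  have e1 : ((2 : ℂ) * π * (n + 1)) ^ s = (2 * π : ℂ) ^ s * ((n : ℂ) + 1) ^ s := by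
    have := Complex.mul_cpow_ofReal_nonneg (a := 2 * π) (b := n + 1) (by positivity) hn.le s
    push_cast at this
    exact this
  rw [e1, Complex.cpow_neg, Complex.cpow_neg]
  ring

end FourSq

namespace FourSq

open MeasureTheory Set Filter

/-- The completed Dirichlet series of `r4²` times `ζ(2 w + 2)` and a factor at two, from the
Mellin side. -/
noncomputable def mellinSide (c : ℝ) (w : ℂ) : ℂ :=
  (mellin (Areg c) w + c / (w - 1)) * riemannZeta (2 * w + 2) * (1 + 2 * 2 ^ (-(w + 2)))

/-- The same function from the Euler product side. -/
noncomputable def eulerSide (w : ℂ) : ℂ :=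
  Complex.Gamma (w + 2) * (2 * π : ℂ) ^ (-(w + 2)) * (64 * (riemannZeta (w + 2) *
    riemannZeta (w + 1) ^ 2 * riemannZeta w * ((1 + 8 * 2 ^ (-(w + 2))) * (1 - 2 * 2 ^ (-(w + 2))) *
      (1 - 4 * 2 ^ (-(w + 2))))))

lemma differentiableAt_eulerSide {w : ℂ} (hw : 0 < w.re) (hw1 : w ≠ 1) :
    DifferentiableAt ℂ eulerSide w := by
  have hz : ∀ k : ℕ, w + k ≠ 1 → DifferentiableAt ℂ (fun w => riemannZeta (w + k)) w := fun k hk =>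
    (differentiableAt_riemannZeta hk).comp w (by fun_prop)
  have h2 : DifferentiableAt ℂ (fun w => riemannZeta (w + 2)) w := by
    have := hz 2 fun h => by
      have := congrArg Complex.re h
      simp at this
      linarith
    simpa using this
  have h1 : DifferentiableAt ℂ (fun w => riemannZeta (w + 1)) w := by
    have := hz 1 fun h => by
      have := congrArg Complex.re h
      simp at this
      linarith
    simpa using this
  have h0 : DifferentiableAt ℂ riemannZeta w := differentiableAt_riemannZeta hw1
  have hG : DifferentiableAt ℂ (fun w => Complex.Gamma (w + 2)) w := by
    refine (Complex.differentiableAt_Gamma (w + 2) fun m h => ?_).comp w (by fun_prop)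
    have := congrArg Complex.re h
    simp at this
    have hm : (0 : ℝ) ≤ m := m.cast_nonneg
    linarith
  have hp : ∀ a : ℂ, a ≠ 0 → DifferentiableAt ℂ (fun w => a ^ (-(w + 2))) w := fun a ha =>
    DifferentiableAt.const_cpow (by fun_prop) (Or.inl ha)
  have hp2 := hp 2 two_ne_zero
  have hpi := hp (2 * π) (by exact_mod_cast Real.two_pi_pos.ne')
  unfold eulerSide
  fun_prop

section

variable {c : ℝ} (hc : ∀ v : ℝ, 0 < v → horo Bf v = Apos v - c / v)
include hc

lemma differentiableAt_mellinSide {w : ℂ} (hw : 0 < w.re) (hw1 : w ≠ 1) :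
    DifferentiableAt ℂ (mellinSide c) w := by
  have h1 := differentiableAt_mellin_Areg hc hw
  have h2 : DifferentiableAt ℂ (fun w => riemannZeta (2 * w + 2)) w := by
    refine (differentiableAt_riemannZeta fun h => ?_).comp w (by fun_prop)
    have := congrArg Complex.re h
    simp at this
    linarith
  have h3 : DifferentiableAt ℂ (fun w : ℂ => (2 : ℂ) ^ (-(w + 2))) w :=
    DifferentiableAt.const_cpow (by fun_prop) (Or.inl two_ne_zero)
  have h4 : w - 1 ≠ 0 := sub_ne_zero.2 hw1
  unfold mellinSide
  fun_prop (disch := exact h4)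

lemma mellinSide_eq_of_three_lt {w : ℂ} (hw : 3 < w.re) : mellinSide c w = eulerSide w := by
  have he := dser_euler (s := w + 2) (by simp; linarith)
  have hx : 1 + 2 * (2 : ℂ) ^ (-(w + 2)) ≠ 0 := by
    intro h
    have h1 : (2 : ℂ) * 2 ^ (-(w + 2)) = -1 := by linear_combination h
    have h2 := congrArg norm h1
    have h3 := Complex.norm_cpow_eq_rpow_re_of_pos (x := 2) two_pos (-(w + 2))
    rw [Complex.ofReal_ofNat] at h3
    rw [norm_mul, norm_neg, norm_one, Complex.norm_ofNat, h3] at h2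
    have h4 : (2 : ℝ) ^ (-(w + 2)).re ≤ 2 ^ (-2 : ℝ) :=
      Real.rpow_le_rpow_of_exponent_le one_le_two (by simp; linarith)
    have h5 : (2 : ℝ) ^ (-2 : ℝ) = 1 / 4 := by
      rw [Real.rpow_neg two_pos.le]
      norm_num
    rw [h5] at h4
    generalize (2 : ℝ) ^ (-(w + 2)).re = q at h2 h4
    linarith
  rw [twoFac, show 2 * (w + 2) - 2 = 2 * w + 2 by ring, show w + 2 - 1 = w + 1 by ring,
    show w + 2 - 2 = w by ring] at he
  rw [mellinSide, eulerSide, mellin_Areg_eq hc (by linarith), mellin_Apos hw, sub_add_cancel]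
  have he' : (∑' n, dser (w + 2) n) * riemannZeta (2 * w + 2) * (1 + 2 * 2 ^ (-(w + 2))) =
      riemannZeta (w + 2) * riemannZeta (w + 1) ^ 2 * riemannZeta w *
        ((1 + 8 * 2 ^ (-(w + 2))) * (1 - 2 * 2 ^ (-(w + 2))) * (1 - 4 * 2 ^ (-(w + 2)))) := by
    rw [he]
    field_simp
  rw [← he']
  ring

lemma mellinSide_eq_half : mellinSide c (1 / 2) = eulerSide (1 / 2) := by
  set U : Set ℂ := {w | 0 < w.re} ∩ {w | 0 < w.im}
  have hUo : IsOpen U := (isOpen_lt continuous_const Complex.continuous_re).inter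
    (isOpen_lt continuous_const Complex.continuous_im)
  have hUc : IsPreconnected U :=
    ((convex_halfSpace_re_gt 0).inter (convex_halfSpace_im_gt 0)).isPreconnected
  have hne : ∀ w ∈ U, w ≠ 1 := fun w hw h => by
    have := hw.2
    simp [h] at this
  have h1 : AnalyticOnNhd ℂ (mellinSide c) U := DifferentiableOn.analyticOnNhd
    (fun w hw => (differentiableAt_mellinSide hc hw.1 (hne w hw)).differentiableWithinAt) hUo
  have h2 : AnalyticOnNhd ℂ eulerSide U := DifferentiableOn.analyticOnNhd
    (fun w hw => (differentiableAt_eulerSide hw.1 (hne w hw)).differentiableWithinAt) hUo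
  have hmem : (4 + Complex.I : ℂ) ∈ U := by
    constructor <;> simp
  have heq : mellinSide c =ᶠ[nhds (4 + Complex.I)] eulerSide := by
    have : {w : ℂ | 3 < w.re} ∈ nhds (4 + Complex.I) :=
      (isOpen_lt continuous_const Complex.continuous_re).mem_nhds (by simp; norm_num)
    filter_upwards [this] with w hw
    exact mellinSide_eq_of_three_lt hc hw
  have hU := h1.eqOn_of_preconnected_of_eventuallyEq h2 hUc hmem heq
  have hpath : Tendsto (fun t : ℝ => (1 / 2 : ℂ) + t * Complex.I) (nhdsWithin 0 (Ioi 0))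
    (nhds (1 / 2)) := by
    have : Continuous fun t : ℝ => (1 / 2 : ℂ) + t * Complex.I := by fun_prop
    have h := this.tendsto 0
    simp only [Complex.ofReal_zero, zero_mul, add_zero] at h
    exact h.mono_left nhdsWithin_le_nhds
  have hhalf : (0 : ℝ) < (1 / 2 : ℂ).re := by norm_num
  have hhalf1 : (1 / 2 : ℂ) ≠ 1 := by norm_num
  have t1 := (differentiableAt_mellinSide hc hhalf hhalf1).continuousAt.tendsto.comp hpath
  have t2 := (differentiableAt_eulerSide hhalf hhalf1).continuousAt.tendsto.comp hpath
  refine tendsto_nhds_unique_of_eventuallyEq t1 t2 ?_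
  filter_upwards [self_mem_nhdsWithin] with t ht
  have ht : 0 < t := ht
  refine hU ⟨?_, ?_⟩
  · simp
  · simpa using ht

end

lemma ofReal_rzeta (x : ℝ) : (rzeta x : ℂ) = riemannZeta x := by
  rw [rzeta, ← Complex.conj_eq_iff_re, ← riemannZeta_conj, Complex.conj_ofReal]

lemma rzeta_three_ne_zero : rzeta 3 ≠ 0 := by
  intro h
  have := ofReal_rzeta 3
  rw [h] at this
  exact riemannZeta_ne_zero_of_one_le_re (s := (3 : ℝ)) (by simp) (by simpa using this.symm)

lemma two_rpow_neg_five_halves : (2 : ℝ) ^ (-5 / 2 : ℝ) = √2 / 8 := by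
  rw [show (-5 / 2 : ℝ) = 1 / 2 + (-3 : ℤ) by norm_num, Real.rpow_add two_pos, ← Real.sqrt_eq_rpow,
    Real.rpow_intCast]
  norm_num
  ring

lemma integral_horo_Bf : ∫ v in Ioi (0 : ℝ), horo Bf v * v ^ (-1 / 2 : ℝ) =
    Real.Gamma (5 / 2) * (2 * π) ^ (-5 / 2 : ℝ) * (2 * π ^ 2 * C4') := by
  obtain ⟨c, hc⟩ := exists_horo_Bf
  set J := ∫ v in Ioi (0 : ℝ), horo Bf v * v ^ (-1 / 2 : ℝ)
  have h1 := integral_horo_eq_mellin hc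
  have h2 := mellinSide_eq_half hc
  have hx : (2 : ℂ) ^ (-(1 / 2 + 2) : ℂ) = ((√2 / 8 : ℝ) : ℂ) := by
    rw [← two_rpow_neg_five_halves, Complex.ofReal_cpow two_pos.le]
    norm_num
  have hp : (2 * π : ℂ) ^ (-(1 / 2 + 2) : ℂ) = (((2 * π) ^ (-5 / 2 : ℝ) : ℝ) : ℂ) := by
    rw [Complex.ofReal_cpow Real.two_pi_pos.le]
    push_cast
    norm_num
  have hG : Complex.Gamma (1 / 2 + 2) = (Real.Gamma (5 / 2) : ℂ) := by
    rw [← Complex.Gamma_ofReal]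
    norm_num
  have hJ : mellin (Areg c) (1 / 2) + c / (1 / 2 - 1) = (J : ℂ) := by
    rw [h1]
    ring
  have z0 : riemannZeta (2 * (1 / 2) + 2) = (rzeta 3 : ℂ) := by
    rw [ofReal_rzeta]
    norm_num
  have z1 : riemannZeta (1 / 2 + 2) = (rzeta (5 / 2) : ℂ) := by
    rw [ofReal_rzeta]
    norm_num
  have z2 : riemannZeta (1 / 2 + 1) = (rzeta (3 / 2) : ℂ) := by
    rw [ofReal_rzeta]
    norm_num
  have z3 : riemannZeta (1 / 2) = (rzeta (1 / 2) : ℂ) := by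
    rw [ofReal_rzeta]
    norm_num
  rw [mellinSide, eulerSide, hx, hp, hG, hJ, z0, z1, z2, z3] at h2
  rw [C4']
  generalize (2 * π) ^ (-5 / 2 : ℝ) = q at h2 ⊢
  generalize Real.Gamma (5 / 2) = g at h2 ⊢
  generalize rzeta (5 / 2) = u at h2 ⊢
  norm_cast at h2
  have hs : √2 ^ 2 = 2 := Real.sq_sqrt two_pos.le
  have h3 := rzeta_three_ne_zero
  have hq : 1 + 2 * (√2 / 8) ≠ 0 := by positivity
  have key : (1 + 8 * (√2 / 8)) * (1 - 2 * (√2 / 8)) * (1 - 4 * (√2 / 8)) =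
      (9 * √2 - 8) / 14 * (1 + 2 * (√2 / 8)) := by
    ring_nf
    have h3' : √2 ^ 3 = 2 * √2 := by rw [pow_succ, hs]
    rw [h3', hs]
    ring
  rw [key] at h2
  have : J * rzeta 3 = g * q * (64 * (u *
      rzeta (3 / 2) ^ 2 * rzeta (1 / 2) * ((9 * √2 - 8) / 14))) := by
    apply mul_right_cancel₀ hq
    rw [h2]
    ring
  rw [eq_div_of_mul_eq h3 this]
  field_simp
  ring

end FourSq

namespace FourSq

open MeasureTheory Set

lemma Fth_le (x : ℝ) {y : ℝ} (hy : 0 < y) : ‖Fth (x + y * Complex.I)‖ ≤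
    y ^ 2 * ∑' p : ℕ × ℕ, r4 p.1 * r4 p.2 * Real.exp (-(π * y) * (p.1 + p.2)) := by
  have hc : ∀ p : ℕ × ℕ, 0 ≤ r4 p.1 * r4 p.2 * Real.exp (-(π * y) * (p.1 + p.2)) := fun p =>
    mul_nonneg (mul_nonneg (r4_nonneg _) (r4_nonneg _)) (Real.exp_pos _).le
  rw [Real.norm_of_nonneg (by unfold Fth; positivity), Fth_eq x hy]
  refine mul_le_mul_of_nonneg_left ?_ (sq_nonneg y)
  exact (hasSum_norm_theta x hy).summable.tsum_le_tsum
    (fun p => mul_le_of_le_one_right (hc p) (Real.cos_le_one _)) (summable_r4_pair (by positivity))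

/-- The coefficient of `√y` in the weighted mean of `Fth` at height `y`. -/
noncomputable def sqrtCoeff : ℝ :=
  π⁻¹ * (Real.Gamma (5 / 2) * (2 * π) ^ (-5 / 2 : ℝ) * (2 * π ^ 2 * C4'))

lemma tsum_r4_max {η : ℝ} (hη : 0 < η) (hη1 : η < 1) : ∃ C : ℝ, 0 < C ∧ ∀ y : ℝ, 0 < y → y ≤ 1 →
    |y ^ 2 * (∑' p : ℕ × ℕ, r4 p.1 * r4 p.2 * Real.exp (-(2 * π * y) * (max p.1 p.2 : ℕ))) -
      (3 / (8 * y ^ 2) + 1 + sqrtCoeff * √y)| ≤ C * y ^ (1 - η) := by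
  obtain ⟨C1, hC1, h1⟩ := integral_Gs_pker hη hη1
  obtain ⟨C2, hC2, h2⟩ := integral_B0_pker hη hη1
  obtain ⟨C, hB⟩ := exists_tame_Bf
  refine ⟨π⁻¹ * (C2 + (π ^ 4 / 48)⁻¹ * C1), by positivity, fun y hy hy1 => ?_⟩
  have a1 := h1 y hy hy1
  have a2 := h2 y hy hy1
  rw [integral_horo_Bf] at a2
  have hBi : Integrable fun x => Bf x y * pker y x :=
    (integrable_pker hy).bdd_mul (c := C) (hB.continuous_slice hy).aestronglyMeasurable
      (Filter.Eventually.of_forall fun x => hB.bdd x y hy)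
  have hFi : Integrable fun x : ℝ => Fth (x + y * Complex.I) * pker y x :=
    (integrable_pker hy).bdd_mul (continuous_Fth_slice hy).aestronglyMeasurable
      (Filter.Eventually.of_forall fun x => Fth_le x hy)
  have hG : ∀ x : ℝ, Gs w0 (x + y * Complex.I) * pker y x = π ^ 4 / 48 *
      (Fth (x + y * Complex.I) * pker y x - Bf x y * pker y x) := by
    intro x
    rw [Bf, B0]
    field_simp
    ring
  simp only [hG] at a1
  rw [integral_const_mul, integral_sub hFi hBi, integral_Fth_pker hy] at a1
  set T := ∑' p : ℕ × ℕ, r4 p.1 * r4 p.2 * Real.exp (-(2 * π * y) * (max p.1 p.2 : ℕ))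
  set I := ∫ x : ℝ, Bf x y * pker y x
  have hsum : y ^ 2 * T - (3 / (8 * y ^ 2) + 1 + sqrtCoeff * √y) = π⁻¹ * ((I - √y *
      (Real.Gamma (5 / 2) * (2 * π) ^ (-5 / 2 : ℝ) * (2 * π ^ 2 * C4'))) + (π ^ 4 / 48)⁻¹ *
      (π ^ 4 / 48 * (π * y ^ 2 * T - I) - π * (π ^ 4 / 48) * (3 / (8 * y ^ 2) + 1))) := by
    rw [sqrtCoeff]
    field_simp
    ring
  rw [hsum, abs_mul, abs_of_pos (inv_pos.2 Real.pi_pos), mul_assoc π⁻¹]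
  refine mul_le_mul_of_nonneg_left ((abs_add_le _ _).trans ?_) (inv_pos.2 Real.pi_pos).le
  rw [abs_mul, abs_of_pos (by positivity : (0 : ℝ) < (π ^ 4 / 48)⁻¹), add_mul]
  refine add_le_add a2 ?_
  rw [mul_assoc (π ^ 4 / 48)⁻¹]
  exact mul_le_mul_of_nonneg_left a1 (by positivity)

end FourSq

namespace FourSq

/-- Exchange of summation for sums of the form `∑ g N * #{i | k i ≤ N}` with weights `c i`. -/
lemma hasSum_layer {ι : Type*} {c : ι → ℝ} {k : ι → ℕ} {g G A : ℕ → ℝ} {s : ℝ}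
    (hc : ∀ i, 0 ≤ c i) (hg : ∀ n, 0 ≤ g n) (hG : ∀ m, HasSum (fun j => g (j + m)) (G m))
    (hA : ∀ N, HasSum (fun i => if k i ≤ N then c i else 0) (A N))
    (hs : HasSum (fun i => c i * G (k i)) s) : HasSum (fun N => A N * g N) s := by
  set F : ι × ℕ → ℝ := fun p => (if k p.1 ≤ p.2 then c p.1 else 0) * g p.2 with hF
  have hF0 : 0 ≤ F := fun p => mul_nonneg (by split_ifs; exacts [hc _, le_rfl]) (hg _)
  have hrow : ∀ i, HasSum (fun N => F (i, N)) (c i * G (k i)) := by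
    intro i
    have h := (hG (k i)).mul_left (c i)
    rw [← (add_left_injective (k i)).hasSum_iff (f := fun N => F (i, N))]
    · suffices hfun : ((fun N => F (i, N)) ∘ fun j => j + k i) = _ from hfun ▸ h
      funext j
      simp [hF]
    · intro N hN
      have : ¬ k i ≤ N := fun h => hN ⟨N - k i, by simp; omega⟩
      simp [hF, this]
  have hsum : Summable F := by
    rw [summable_prod_of_nonneg hF0]
    refine ⟨fun i => (hrow i).summable, ?_⟩
    simp only [(hrow _).tsum_eq]
    exact hs.summable
  have htot : ∑' p, F p = s := by
    rw [hsum.tsum_prod' fun i => (hrow i).summable]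
    simp only [(hrow _).tsum_eq]
    exact hs.tsum_eq
  have hswap : HasSum (fun p : ℕ × ι => F (p.2, p.1)) s := by
    have h := hsum.hasSum
    rw [htot, ← (Equiv.prodComm ℕ ι).hasSum_iff] at h
    exact h
  exact hswap.prod_fiberwise fun N => (hA N).mul_right (g N)

/-- The number of lattice points in the ball of squared radius `N` in dimension four. -/
noncomputable def latCount (N : ℕ) : ℝ := ∑ m ∈ Finset.range (N + 1), r4 m

lemma hasSum_latCount (N : ℕ) : HasSum (fun m => if m ≤ N then r4 m else 0) (latCount N) := by
  have h := hasSum_sum_of_ne_finset_zero (L := .unconditional _)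
    (f := fun m => if m ≤ N then r4 m else 0)
    (s := Finset.range (N + 1)) fun m hm => by
      rw [Finset.mem_range] at hm
      rw [if_neg (by omega)]
  rwa [Finset.sum_congr rfl fun m hm => if_pos (by rw [Finset.mem_range] at hm; omega)] at h

lemma hasSum_latCount_sq (N : ℕ) :
    HasSum (fun p : ℕ × ℕ => if max p.1 p.2 ≤ N then r4 p.1 * r4 p.2 else 0) (latCount N ^ 2) := by
  have h := hasSum_sum_of_ne_finset_zero (L := .unconditional _)
    (f := fun p : ℕ × ℕ => if max p.1 p.2 ≤ N then r4 p.1 * r4 p.2 else 0)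
    (s := Finset.range (N + 1) ×ˢ Finset.range (N + 1)) fun p hp => by
      rw [Finset.mem_product, Finset.mem_range, Finset.mem_range] at hp
      rw [if_neg (by omega)]
  rwa [Finset.sum_congr rfl fun p hp => if_pos (by
    rw [Finset.mem_product, Finset.mem_range, Finset.mem_range] at hp; omega), Finset.sum_product,
    ← Finset.sum_mul_sum, ← sq] at h

lemma finite_sq_sum_eq (k m : ℕ) : Finite {v : Fin k → ℤ // (∑ i, (v i) ^ 2) = (m : ℤ)} := by
  refine Set.Finite.subset (Fintype.piFinset fun _ : Fin k => Finset.Icc (-m : ℤ) m).finite_toSet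
    fun v hv => ?_
  rw [Finset.mem_coe, Fintype.mem_piFinset]
  intro i
  have hv : (∑ i, (v i) ^ 2) = (m : ℤ) := hv
  have h1 : v i ^ 2 ≤ m := hv ▸ Finset.single_le_sum (f := fun i => v i ^ 2)
    (fun i _ => sq_nonneg _) (Finset.mem_univ i)
  rw [Finset.mem_Icc, ← abs_le]
  calc |v i| ≤ |v i| ^ 2 := Int.le_self_sq _
    _ ≤ m := by rwa [sq_abs]

lemma Sk_natCast (k n : ℕ) : Sk k n = ∑ m ∈ Finset.range (n + 1), rk k m := by
  have := finite_sq_sum_eq k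
  rw [← Fin.sum_univ_eq_sum_range, Sk]
  simp only [rk]
  rw [← Nat.card_sigma]
  refine Nat.card_congr ⟨fun v => ⟨⟨(∑ i, (v.1 i) ^ 2).toNat, ?_⟩, v.1, ?_⟩,
    fun p => ⟨p.2.1, ?_⟩, fun v => rfl, ?_⟩
  · have h : ∑ i, (v.1 i) ^ 2 ≤ (n : ℤ) := by exact_mod_cast v.2
    omega
  · have : 0 ≤ ∑ i, (v.1 i) ^ 2 := Finset.sum_nonneg fun i _ => sq_nonneg _
    simp [this]
  · have h := p.2.2
    have h2 : ((p.1 : ℕ) : ℤ) ≤ n := by have := p.1.2; omega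
    rw [← h] at h2
    exact_mod_cast h2
  · rintro ⟨⟨m, hm⟩, v, hv⟩
    have : m = (∑ i, (v i) ^ 2).toNat := by
      have hv : ∑ i, v i ^ 2 = (m : ℤ) := hv
      rw [hv, Int.toNat_natCast]
    subst this
    rfl

lemma Vk_four : Vk 4 = π ^ 2 / 2 := by
  rw [Vk, show ((4 : ℕ) : ℝ) / 2 = (2 : ℕ) by norm_num, Real.rpow_natCast,
    Real.Gamma_nat_eq_factorial]
  norm_num

lemma Pk_four (n : ℕ) : Pk 4 n = latCount n - π ^ 2 / 2 * n ^ 2 := by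
  rw [Pk, Vk_four, Sk_natCast, show ((4 : ℕ) : ℝ) / 2 = (2 : ℕ) by norm_num, Real.rpow_natCast,
    latCount]
  push_cast
  rfl

end FourSq

namespace FourSq

/-- The geometric sum `∑ exp (-t n)`. -/
noncomputable def geo (t : ℝ) : ℝ := (1 - Real.exp (-t))⁻¹

lemma exp_neg_lt_one {t : ℝ} (ht : 0 < t) : Real.exp (-t) < 1 := by
  rw [Real.exp_lt_one_iff]
  linarith

lemma hasSum_choose_exp (k : ℕ) {t : ℝ} (ht : 0 < t) :
    HasSum (fun n : ℕ => ((n + k).choose k : ℝ) * Real.exp (-t * n)) (geo t ^ (k + 1)) := by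
  have h := hasSum_choose_mul_geometric_of_norm_lt_one k (r := Real.exp (-t)) (by
    rw [Real.norm_of_nonneg (Real.exp_pos _).le]
    exact exp_neg_lt_one ht)
  rw [one_div, ← inv_pow] at h
  suffices hfun : (fun n : ℕ => ((n + k).choose k : ℝ) * Real.exp (-t * n)) = _ from hfun ▸ h
  funext n
  rw [mul_comm (-t), Real.exp_nat_mul]

lemma cast_choose_add (n k : ℕ) :
    ((n + k).choose k : ℝ) = (n + k).factorial / (n.factorial * k.factorial) := by
  rw [← Nat.choose_symm_add, Nat.cast_add_choose]

lemma hasSum_exp {t : ℝ} (ht : 0 < t) : HasSum (fun n : ℕ => Real.exp (-t * n)) (geo t) := by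
  simpa using hasSum_choose_exp 0 ht

lemma hasSum_id_exp {t : ℝ} (ht : 0 < t) :
    HasSum (fun n : ℕ => (n : ℝ) * Real.exp (-t * n)) (geo t ^ 2 - geo t) := by
  have h := (hasSum_choose_exp 1 ht).sub (hasSum_exp ht)
  suffices hfun : (fun n : ℕ => (n : ℝ) * Real.exp (-t * n)) = _ from hfun ▸ h
  funext n
  simp
  ring

lemma hasSum_sq_exp {t : ℝ} (ht : 0 < t) :
    HasSum (fun n : ℕ => (n : ℝ) ^ 2 * Real.exp (-t * n))
      (2 * geo t ^ 3 - 3 * geo t ^ 2 + geo t) := by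
  have h := (((hasSum_choose_exp 2 ht).mul_left 2).sub ((hasSum_choose_exp 1 ht).mul_left 3)).add
    (hasSum_exp ht)
  suffices hfun : (fun n : ℕ => (n : ℝ) ^ 2 * Real.exp (-t * n)) = _ from hfun ▸ h
  funext n
  have hn : (n.factorial : ℝ) ≠ 0 := by exact_mod_cast n.factorial_ne_zero
  simp only [cast_choose_add, Nat.factorial]
  push_cast
  field_simp
  ring

lemma hasSum_pow_four_exp {t : ℝ} (ht : 0 < t) :
    HasSum (fun n : ℕ => (n : ℝ) ^ 4 * Real.exp (-t * n))
      (24 * geo t ^ 5 - 60 * geo t ^ 4 + 50 * geo t ^ 3 - 15 * geo t ^ 2 + geo t) := by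
  have h :=
    (((((hasSum_choose_exp 4 ht).mul_left 24).sub ((hasSum_choose_exp 3 ht).mul_left 60)).add
    ((hasSum_choose_exp 2 ht).mul_left 50)).sub ((hasSum_choose_exp 1 ht).mul_left 15)).add
    (hasSum_exp ht)
  suffices hfun : (fun n : ℕ => (n : ℝ) ^ 4 * Real.exp (-t * n)) = _ from hfun ▸ h
  funext n
  have hn : (n.factorial : ℝ) ≠ 0 := by exact_mod_cast n.factorial_ne_zero
  simp only [cast_choose_add, Nat.factorial]
  push_cast
  field_simp
  ring

/-- The weighted theta series `∑ n ^ k * r4 n * exp (-t n)`. -/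
noncomputable def thetaSum (k : ℕ) (t : ℝ) : ℝ := ∑' n : ℕ, (n : ℝ) ^ k * r4 n * Real.exp (-t * n)

lemma summable_thetaSum (k : ℕ) {t : ℝ} (ht : 0 < t) :
    Summable fun n : ℕ => (n : ℝ) ^ k * r4 n * Real.exp (-t * n) := by
  refine Summable.of_nonneg_of_le (fun n => by have := r4_nonneg n; positivity) (fun n => ?_)
    (summable_r4_pow k ht)
  have := r4_nonneg n
  gcongr
  linarith

lemma hasSum_thetaSum (k : ℕ) {t : ℝ} (ht : 0 < t) :
    HasSum (fun n : ℕ => (n : ℝ) ^ k * r4 n * Real.exp (-t * n)) (thetaSum k t) :=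
  (summable_thetaSum k ht).hasSum

lemma exp_shift (t : ℝ) (j m : ℕ) :
    Real.exp (-t * (j + m : ℕ)) = Real.exp (-t * j) * Real.exp (-t * m) := by
  rw [← Real.exp_add]
  push_cast
  ring_nf

lemma summable_r4_max {a : ℝ} (ha : 0 < a) :
    Summable fun p : ℕ × ℕ => r4 p.1 * r4 p.2 * Real.exp (-a * (max p.1 p.2 : ℕ)) := by
  refine Summable.of_nonneg_of_le
    (fun p => mul_nonneg (mul_nonneg (r4_nonneg _) (r4_nonneg _)) (Real.exp_pos _).le) (fun p => ?_)
    (summable_r4_pair (half_pos ha))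
  refine mul_le_mul_of_nonneg_left ?_ (mul_nonneg (r4_nonneg _) (r4_nonneg _))
  rw [Real.exp_le_exp]
  have h1 : (p.1 : ℝ) ≤ (max p.1 p.2 : ℕ) := by exact_mod_cast le_max_left _ _
  have h2 : (p.2 : ℝ) ≤ (max p.1 p.2 : ℕ) := by exact_mod_cast le_max_right _ _
  nlinarith

lemma hasSum_latCount_sq_exp {t : ℝ} (ht : 0 < t) :
    HasSum (fun N : ℕ => latCount N ^ 2 * Real.exp (-t * N)) (geo t *
      ∑' p : ℕ × ℕ, r4 p.1 * r4 p.2 * Real.exp (-t * (max p.1 p.2 : ℕ))) := by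
  refine hasSum_layer (c := fun p : ℕ × ℕ => r4 p.1 * r4 p.2) (k := fun p => max p.1 p.2)
    (G := fun m => geo t * Real.exp (-t * m))
    (fun p => mul_nonneg (r4_nonneg _) (r4_nonneg _)) (fun n => (Real.exp_pos _).le) (fun m => ?_)
    hasSum_latCount_sq ?_
  · simp only [exp_shift]
    exact (hasSum_exp ht).mul_right _
  · have h := (summable_r4_max ht).hasSum.mul_left (geo t)
    suffices hfun :
      (fun p : ℕ × ℕ => r4 p.1 * r4 p.2 * (geo t * Real.exp (-t * (max p.1 p.2 : ℕ)))) = _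
      from hfun ▸ h
    funext p
    ring

lemma hasSum_latCount_mul_exp {t : ℝ} (ht : 0 < t) :
    HasSum (fun N : ℕ => latCount N * ((N : ℝ) ^ 2 * Real.exp (-t * N)))
      (geo t * thetaSum 2 t + 2 * (geo t ^ 2 - geo t) * thetaSum 1 t +
        (2 * geo t ^ 3 - 3 * geo t ^ 2 + geo t) * thetaSum 0 t) := by
  refine hasSum_layer (c := r4) (k := fun m => m)
    (G := fun m => (2 * geo t ^ 3 - 3 * geo t ^ 2 + geo t + 2 * m * (geo t ^ 2 - geo t) +
      (m : ℝ) ^ 2 * geo t) * Real.exp (-t * m))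
    r4_nonneg (fun n => by positivity) (fun m => ?_) hasSum_latCount ?_
  · have h := (((hasSum_sq_exp ht).add ((hasSum_id_exp ht).mul_left (2 * (m : ℝ)))).add
      ((hasSum_exp ht).mul_left ((m : ℝ) ^ 2))).mul_right (Real.exp (-t * m))
    suffices hfun : (fun j : ℕ => ((j + m : ℕ) : ℝ) ^ 2 * Real.exp (-t * (j + m : ℕ))) = _
      from hfun ▸ h
    funext j
    rw [exp_shift]
    push_cast
    ring
  · have h := (((hasSum_thetaSum 2 ht).mul_left (geo t)).add
      ((hasSum_thetaSum 1 ht).mul_left (2 * (geo t ^ 2 - geo t)))).add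
      ((hasSum_thetaSum 0 ht).mul_left (2 * geo t ^ 3 - 3 * geo t ^ 2 + geo t))
    suffices hfun : (fun m : ℕ => r4 m * ((2 * geo t ^ 3 - 3 * geo t ^ 2 + geo t +
      2 * m * (geo t ^ 2 - geo t) + (m : ℝ) ^ 2 * geo t) * Real.exp (-t * m))) = _ from hfun ▸ h
    funext m
    ring

end FourSq

namespace FourSq

open Set

lemma jacobiTheta_pow_four {t : ℝ} (ht : 0 < t) :
    jacobiTheta (Complex.I * (t / π : ℝ)) ^ 4 = (thetaSum 0 t : ℂ) := by
  have hτ : 0 < (Complex.I * ((t / π : ℝ) : ℂ)).im := by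
    simp
    positivity
  refine (hasSum_theta_pow 4 hτ).unique ?_
  have h := Complex.hasSum_ofReal.2 (hasSum_thetaSum 0 ht)
  suffices hfun : (fun n : ℕ => (rk 4 n : ℂ) * Complex.exp (π * Complex.I * n *
    (Complex.I * (t / π : ℝ)))) = _ from hfun ▸ h
  funext n
  have hp : (π : ℂ) ≠ 0 := by exact_mod_cast Real.pi_ne_zero
  have he : (π * Complex.I * n * (Complex.I * (t / π : ℝ)) : ℂ) = ((-t * n : ℝ) : ℂ) := by
    push_cast
    field_simp
    rw [Complex.I_sq]
    ring
  rw [he, ← Complex.ofReal_exp]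
  push_cast
  ring

lemma thetaSum_zero_inv {t : ℝ} (ht : 0 < t) :
    thetaSum 0 t = π ^ 2 / t ^ 2 * thetaSum 0 (π ^ 2 / t) := by
  have hτ : 0 < (Complex.I * ((t / π : ℝ) : ℂ)).im := by
    simp
    positivity
  have h := jacobiTheta_S_smul ⟨Complex.I * (t / π : ℝ), hτ⟩
  rw [coe_S_smul] at h
  change jacobiTheta (-(Complex.I * (t / π : ℝ))⁻¹) =
    (-Complex.I * (Complex.I * (t / π : ℝ))) ^ (1 / 2 : ℂ) *
      jacobiTheta (Complex.I * (t / π : ℝ)) at h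
  have e1 : (-(Complex.I * ((t / π : ℝ) : ℂ))⁻¹) = Complex.I * (π ^ 2 / t / π : ℝ) := by
    rw [mul_inv, Complex.inv_I, neg_mul, neg_neg, ← Complex.ofReal_inv]
    congr 2
    field_simp
  have e2 : -Complex.I * (Complex.I * ((t / π : ℝ) : ℂ)) = (t / π : ℝ) := by
    linear_combination (-((t / π : ℝ) : ℂ)) * Complex.I_sq
  have h4 := congrArg (· ^ 4) h
  beta_reduce at h4
  rw [e1, e2, mul_pow, jacobiTheta_pow_four ht, jacobiTheta_pow_four (by positivity),
    ← Complex.cpow_nat_mul] at h4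
  rw [show ((4 : ℕ) : ℂ) * (1 / 2) = (2 : ℕ) by norm_num, Complex.cpow_natCast] at h4
  have h5 : thetaSum 0 (π ^ 2 / t) = (t / π) ^ 2 * thetaSum 0 t := by exact_mod_cast h4
  rw [h5]
  field_simp

lemma hasDerivAt_thetaSum (k : ℕ) {t : ℝ} (ht : 0 < t) :
    HasDerivAt (thetaSum k) (-thetaSum (k + 1) t) t := by
  have h := hasDerivAt_tsum_of_isPreconnected (summable_thetaSum (k + 1) (half_pos ht))
    (isOpen_Ioi (a := t / 2)) isPreconnected_Ioi
    (g := fun (n : ℕ) (t : ℝ) => (n : ℝ) ^ k * r4 n * Real.exp (-t * n))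
    (g' := fun (n : ℕ) (t : ℝ) => -((n : ℝ) ^ (k + 1) * r4 n * Real.exp (-t * n)))
    (fun n y _ => by
      have h1 : HasDerivAt (fun t : ℝ => -t * n) (-n : ℝ) y := by
        simpa using (hasDerivAt_id y).neg.mul_const (n : ℝ)
      have h2 := h1.exp.const_mul ((n : ℝ) ^ k * r4 n)
      have e : (n : ℝ) ^ k * r4 n * (Real.exp (-y * n) * -n) =
        -((n : ℝ) ^ (k + 1) * r4 n * Real.exp (-y * n)) := by ring
      rwa [e] at h2)
    (fun n y hy => by
      have hy : t / 2 < y := hy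
      have := r4_nonneg n
      rw [norm_neg, Real.norm_of_nonneg (by positivity)]
      gcongr)
    (show t ∈ Ioi (t / 2) by simpa using ht) (summable_thetaSum k ht)
    (show t ∈ Ioi (t / 2) by simpa using ht)
  rwa [tsum_neg] at h

lemma hasDerivAt_thetaSum_inv (k : ℕ) {t : ℝ} (ht : 0 < t) :
    HasDerivAt (fun t => thetaSum k (π ^ 2 / t))
      (π ^ 2 / t ^ 2 * thetaSum (k + 1) (π ^ 2 / t)) t := by
  have h1 : HasDerivAt (fun t : ℝ => π ^ 2 / t) (-(π ^ 2 / t ^ 2)) t := by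
    have := (hasDerivAt_inv ht.ne').const_mul (π ^ 2)
    simpa [div_eq_mul_inv] using this
  have h2 := (hasDerivAt_thetaSum k (t := π ^ 2 / t) (by positivity)).comp t h1
  rwa [neg_mul_neg, mul_comm] at h2

lemma hasDerivAt_const_div_pow (a : ℝ) (k : ℕ) {t : ℝ} (ht : 0 < t) :
    HasDerivAt (fun t => a / t ^ k) (-(k * a / t ^ (k + 1))) t := by
  have h := ((hasDerivAt_pow k t).inv (by positivity)).const_mul a
  have e : a * (-(k * t ^ (k - 1)) / (t ^ k) ^ 2) = -(k * a / t ^ (k + 1)) := by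
    rcases k with _ | k
    · simp
    · simp only [Nat.add_sub_cancel]
      field_simp
      ring
  rw [e] at h
  exact h

lemma thetaSum_one_inv {t : ℝ} (ht : 0 < t) :
    thetaSum 1 t = 2 * π ^ 2 / t ^ 3 * thetaSum 0 (π ^ 2 / t) -
      π ^ 4 / t ^ 4 * thetaSum 1 (π ^ 2 / t) := by
  have h1 := hasDerivAt_thetaSum 0 ht
  have h2 := (hasDerivAt_const_div_pow (π ^ 2) 2 ht).mul (hasDerivAt_thetaSum_inv 0 ht)
  have heq : thetaSum 0 =ᶠ[nhds t] fun t => π ^ 2 / t ^ 2 * thetaSum 0 (π ^ 2 / t) := by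
    filter_upwards [lt_mem_nhds ht] with u hu using thetaSum_zero_inv hu
  have h3 := h1.unique (h2.congr_of_eventuallyEq heq)
  have h4 : thetaSum 1 t = -(-thetaSum (0 + 1) t) := by ring_nf
  rw [h4, h3]
  push_cast
  field_simp
  ring

lemma thetaSum_two_inv {t : ℝ} (ht : 0 < t) :
    thetaSum 2 t = 6 * π ^ 2 / t ^ 4 * thetaSum 0 (π ^ 2 / t) -
      6 * π ^ 4 / t ^ 5 * thetaSum 1 (π ^ 2 / t) + π ^ 6 / t ^ 6 * thetaSum 2 (π ^ 2 / t) := by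
  have h1 := hasDerivAt_thetaSum 1 ht
  have h2 := ((hasDerivAt_const_div_pow (2 * π ^ 2) 3 ht).mul (hasDerivAt_thetaSum_inv 0 ht)).sub
    ((hasDerivAt_const_div_pow (π ^ 4) 4 ht).mul (hasDerivAt_thetaSum_inv 1 ht))
  have heq : thetaSum 1 =ᶠ[nhds t] fun t => 2 * π ^ 2 / t ^ 3 * thetaSum 0 (π ^ 2 / t) -
      π ^ 4 / t ^ 4 * thetaSum 1 (π ^ 2 / t) := by
    filter_upwards [lt_mem_nhds ht] with u hu using thetaSum_one_inv hu
  have h3 := h1.unique (h2.congr_of_eventuallyEq heq)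
  have h4 : thetaSum 2 t = -(-thetaSum (1 + 1) t) := by ring_nf
  rw [h4, h3]
  push_cast
  field_simp
  ring

lemma abs_thetaSum_sub_le (k : ℕ) {s : ℝ} (hs : 1 ≤ s) :
    |thetaSum k s - 0 ^ k| ≤ Real.exp 1 * thetaSum k 1 * Real.exp (-s) := by
  have h1 := hasSum_thetaSum k (t := s) (by linarith)
  have h2 := hasSum_thetaSum k one_pos
  rw [← hasSum_nat_add_iff' 1] at h1 h2
  have e : ∀ u : ℝ, ∑ i ∈ Finset.range 1, (i : ℝ) ^ k * r4 i * Real.exp (-u * i) = 0 ^ k := by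
    intro u
    simp [r4_zero]
  rw [e] at h1 h2
  have h0 : ∀ u : ℝ, ∀ n : ℕ, 0 ≤ ((n + 1 : ℕ) : ℝ) ^ k * r4 (n + 1) *
    Real.exp (-u * (n + 1 : ℕ)) :=
    fun u n => by have := r4_nonneg (n + 1); positivity
  rw [abs_of_nonneg (h1.nonneg (h0 s))]
  have h3 := h2.mul_left (Real.exp (1 - s))
  have h4 : thetaSum k s - 0 ^ k ≤ Real.exp (1 - s) * (thetaSum k 1 - 0 ^ k) := by
    refine hasSum_le (fun n => ?_) h1 h3
    rw [mul_left_comm, ← Real.exp_add]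
    have := r4_nonneg (n + 1)
    refine mul_le_mul_of_nonneg_left (Real.exp_le_exp.2 ?_) (by positivity)
    push_cast
    have hn : (0 : ℝ) ≤ n := n.cast_nonneg
    nlinarith
  have h5 : (0 : ℝ) ≤ 0 ^ k := by positivity
  have h6 := Real.exp_pos (1 - s)
  calc _ ≤ _ := h4
    _ ≤ Real.exp (1 - s) * thetaSum k 1 := by nlinarith
    _ = _ := by rw [sub_eq_add_neg, Real.exp_add]; ring

end FourSq

namespace FourSq

/-- `f X = O(X ^ a)` uniformly for `X ≥ 2`. -/
def Big (a : ℝ) (f : ℝ → ℝ) : Prop := ∃ C : ℝ, 0 < C ∧ ∀ X : ℝ, 2 ≤ X → |f X| ≤ C * X ^ a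

lemma Big.congr {a : ℝ} {f g : ℝ → ℝ} (h : Big a f) (hfg : ∀ X, 2 ≤ X → g X = f X) : Big a g := by
  obtain ⟨C, hC, h⟩ := h
  exact ⟨C, hC, fun X hX => hfg X hX ▸ h X hX⟩

lemma Big.mono {a b : ℝ} {f : ℝ → ℝ} (h : Big a f) (hab : a ≤ b) : Big b f := by
  obtain ⟨C, hC, h⟩ := h
  refine ⟨C, hC, fun X hX => (h X hX).trans ?_⟩
  have : 1 ≤ X := by linarith
  gcongr

lemma Big.add {a : ℝ} {f g : ℝ → ℝ} (hf : Big a f) (hg : Big a g) : Big a fun X => f X + g X := by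
  obtain ⟨C, hC, h⟩ := hf
  obtain ⟨D, hD, k⟩ := hg
  refine ⟨C + D, by positivity, fun X hX => (abs_add_le _ _).trans ?_⟩
  rw [add_mul]
  exact add_le_add (h X hX) (k X hX)

lemma Big.mul {a b : ℝ} {f g : ℝ → ℝ} (hf : Big a f) (hg : Big b g) :
    Big (a + b) fun X => f X * g X := by
  obtain ⟨C, hC, h⟩ := hf
  obtain ⟨D, hD, k⟩ := hg
  refine ⟨C * D, by positivity, fun X hX => ?_⟩
  have hX0 : 0 < X := by linarith
  rw [abs_mul, Real.rpow_add hX0, mul_mul_mul_comm]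
  exact mul_le_mul (h X hX) (k X hX) (abs_nonneg _) (by positivity)

lemma Big.const_mul {a : ℝ} {f : ℝ → ℝ} (hf : Big a f) (c : ℝ) : Big a fun X => c * f X := by
  obtain ⟨C, hC, h⟩ := hf
  refine ⟨(|c| + 1) * C, by positivity, fun X hX => ?_⟩
  have h1 := h X hX
  rw [abs_mul, mul_assoc]
  have h2 := abs_nonneg (f X)
  have h3 := abs_nonneg c
  nlinarith

lemma big_rpow (a : ℝ) : Big a fun X => X ^ a := by
  refine ⟨1, one_pos, fun X hX => ?_⟩
  have hX0 : 0 < X := by linarith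
  rw [abs_of_pos (by positivity), one_mul]

lemma big_npow (n : ℕ) : Big n fun X => X ^ n := by
  simpa only [Real.rpow_natCast] using big_rpow n

lemma big_inv : Big (-1) fun X => X⁻¹ := by
  simpa only [Real.rpow_neg_one] using big_rpow (-1)

lemma abs_geo_sub_le {t : ℝ} (ht : 0 < t) (ht1 : t ≤ 1) :
    |geo t - 1 / 2 - t⁻¹ - t / 12| ≤ 2 * t ^ 3 := by
  have h := Real.exp_bound (x := -t) (by rw [abs_neg, abs_of_pos ht]; exact ht1) (n := 5)
    (by norm_num)
  rw [abs_neg, abs_of_pos ht] at h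
  simp only [Finset.sum_range_succ, Finset.sum_range_zero, Nat.factorial] at h
  set R := Real.exp (-t) - (1 - t + t ^ 2 / 2 - t ^ 3 / 6 + t ^ 4 / 24) with hR
  have hRb : |R| ≤ t ^ 5 / 100 := by
    rw [hR]
    refine (le_of_eq ?_).trans (h.trans (le_of_eq ?_))
    · congr 1
      push_cast
      ring
    · norm_num
      ring
  have hexp : Real.exp (-t) = 1 - t + t ^ 2 / 2 - t ^ 3 / 6 + t ^ 4 / 24 + R := by rw [hR]; ring
  obtain ⟨hR1, hR2⟩ := abs_le.1 hRb
  have p2 : t ^ 2 ≤ t := by nlinarith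
  have p3 : 0 < t ^ 3 := by positivity
  have p4 : t ^ 4 ≤ t ^ 3 := pow_le_pow_of_le_one ht.le ht1 (by norm_num)
  have p5 : t ^ 5 ≤ t ^ 4 := pow_le_pow_of_le_one ht.le ht1 (by norm_num)
  have p51 : t ^ 5 ≤ t := by simpa using pow_le_pow_of_le_one ht.le ht1 (show 1 ≤ 5 by norm_num)
  have hD : t / 4 ≤ 1 - Real.exp (-t) := by
    rw [hexp]
    linarith
  have hD0 : 0 < 1 - Real.exp (-t) := by linarith
  have key : geo t - 1 / 2 - t⁻¹ - t / 12 =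
      geo t * (1 - (1 - Real.exp (-t)) * (t⁻¹ + 1 / 2 + t / 12)) := by
    rw [geo]
    field_simp
    ring
  have hgeo : 0 < geo t := inv_pos.2 hD0
  have hgeo2 : geo t ≤ 4 * t⁻¹ := by
    rw [geo, inv_le_comm₀ hD0 (by positivity), mul_inv, inv_inv]
    linarith
  have herr : 1 - (1 - Real.exp (-t)) * (t⁻¹ + 1 / 2 + t / 12) =
      t ^ 4 / 144 + t ^ 5 / 288 + R * (t⁻¹ + 1 / 2 + t / 12) := by
    rw [hexp]
    field_simp
    ring
  have hcof : 0 ≤ t⁻¹ + 1 / 2 + t / 12 := by positivity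
  have hcof2 : t ^ 5 / 100 * (t⁻¹ + 1 / 2 + t / 12) = t ^ 4 / 100 + t ^ 5 / 200 + t ^ 6 / 1200 := by
    field_simp
    ring
  have p6 : t ^ 6 ≤ t ^ 4 := pow_le_pow_of_le_one ht.le ht1 (by norm_num)
  have herrb : |1 - (1 - Real.exp (-t)) * (t⁻¹ + 1 / 2 + t / 12)| ≤ t ^ 4 / 2 := by
    rw [herr]
    have h1 := mul_le_mul_of_nonneg_right hRb hcof
    rw [hcof2] at h1
    refine (abs_add_le _ _).trans ?_
    rw [abs_of_pos (by positivity : 0 < t ^ 4 / 144 + t ^ 5 / 288), abs_mul, abs_of_nonneg hcof]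
    have : 0 < t ^ 4 := by positivity
    linarith
  rw [key, abs_mul, abs_of_pos hgeo]
  calc geo t * |1 - (1 - Real.exp (-t)) * (t⁻¹ + 1 / 2 + t / 12)|
      ≤ 4 * t⁻¹ * (t ^ 4 / 2) := mul_le_mul hgeo2 herrb (abs_nonneg _) (by positivity)
    _ = 2 * t ^ 3 := by field_simp; norm_num

/-- The geometric sum, centred. -/
noncomputable def cgeo (X : ℝ) : ℝ := geo X⁻¹ - 1 / 2

lemma big_cgeo : Big (-3) fun X => cgeo X - (X + X⁻¹ / 12) := by
  refine ⟨2, two_pos, fun X hX => ?_⟩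
  have hX0 : 0 < X := by linarith
  have h := abs_geo_sub_le (inv_pos.2 hX0) (inv_le_one_of_one_le₀ (by linarith))
  have e : X ^ (-3 : ℝ) = X⁻¹ ^ 3 := by
    rw [Real.rpow_neg hX0.le, inv_pow]
    norm_cast
  rw [e]
  rw [inv_inv] at h
  refine (le_of_eq ?_).trans h
  simp only [cgeo]
  congr 1
  ring

lemma big_cgeo_sq : Big (-2) fun X => cgeo X ^ 2 - (X ^ 2 + 1 / 6) := by
  have h := big_cgeo
  have h1 : Big 1 fun X => X := by simpa using big_npow 1
  have hs := ((big_inv.mul big_inv).const_mul (1 / 144)).mono (show (-1 + -1 : ℝ) ≤ -2 by norm_num)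
  have e1 := ((h.mul h1).const_mul 2).mono (show (-3 + 1 : ℝ) ≤ -2 by norm_num)
  have e2 := ((h.mul big_inv).const_mul (1 / 6)).mono (show (-3 + -1 : ℝ) ≤ -2 by norm_num)
  have e3 := (h.mul h).mono (show (-3 + -3 : ℝ) ≤ -2 by norm_num)
  refine (((hs.add e1).add e2).add e3).congr fun X hX => ?_
  have : X ≠ 0 := by positivity
  field_simp
  ring

lemma big_cgeo_cube : Big (-1) fun X => cgeo X ^ 3 - (X ^ 3 + X / 4) := by
  have h := big_cgeo
  have g := big_cgeo_sq
  have h1 : Big 1 fun X => X := by simpa using big_npow 1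
  have a1 := (big_inv.const_mul (1 / 72))
  have a2 := (g.mul h1).mono (show (-2 + 1 : ℝ) ≤ -1 by norm_num)
  have a3 := ((g.mul big_inv).const_mul (1 / 12)).mono (show (-2 + -1 : ℝ) ≤ -1 by norm_num)
  have a4 := (g.mul h).mono (show (-2 + -3 : ℝ) ≤ -1 by norm_num)
  have a5 := ((big_npow 2).mul h).mono (show ((2 : ℕ) + -3 : ℝ) ≤ -1 by norm_num)
  have a6 := (h.const_mul (1 / 6)).mono (show (-3 : ℝ) ≤ -1 by norm_num)
  refine (((((a1.add a2).add a3).add a4).add a5).add a6).congr fun X hX => ?_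
  have : X ≠ 0 := by positivity
  field_simp
  ring

lemma big_cgeo_five : Big 1 fun X => cgeo X ^ 5 - (X ^ 5 + 5 / 12 * X ^ 3) := by
  have g := big_cgeo_sq
  have k := big_cgeo_cube
  have h1 : Big 1 fun X => X := by simpa using big_npow 1
  have a1 := h1.const_mul (1 / 24)
  have a2 := (g.mul (big_npow 3)).mono (show (-2 + (3 : ℕ) : ℝ) ≤ 1 by norm_num)
  have a3 := ((g.mul h1).const_mul (1 / 4)).mono (show (-2 + 1 : ℝ) ≤ 1 by norm_num)
  have a4 := (g.mul k).mono (show (-2 + -1 : ℝ) ≤ 1 by norm_num)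
  have a5 := ((big_npow 2).mul k).mono (show ((2 : ℕ) + -1 : ℝ) ≤ 1 by norm_num)
  have a6 := (k.const_mul (1 / 6)).mono (show (-1 : ℝ) ≤ 1 by norm_num)
  refine (((((a1.add a2).add a3).add a4).add a5).add a6).congr fun X hX => ?_
  ring

lemma big_thetaSum (k : ℕ) : Big (-10) fun X => thetaSum k (π ^ 2 * X) - 0 ^ k := by
  have h0 : 0 ≤ thetaSum k 1 := tsum_nonneg fun n => by have := r4_nonneg n; positivity
  refine ⟨Real.exp 1 * thetaSum k 1 * (10).factorial + 1, by positivity, fun X hX => ?_⟩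
  have hX0 : 0 < X := by linarith
  have hp : 1 ≤ π ^ 2 := by nlinarith [Real.pi_gt_three]
  have h := abs_thetaSum_sub_le k (s := π ^ 2 * X) (by nlinarith)
  have h1 : Real.exp (-(π ^ 2 * X)) ≤ (10).factorial * X ^ (-10 : ℝ) := by
    have h2 := Real.pow_div_factorial_le_exp X hX0.le 10
    have h3 : Real.exp (-(π ^ 2 * X)) ≤ (Real.exp X)⁻¹ := by
      rw [← Real.exp_neg]
      exact Real.exp_le_exp.2 (by nlinarith)
    refine h3.trans ((inv_anti₀ (by positivity) h2).trans (le_of_eq ?_))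
    rw [Real.rpow_neg hX0.le, inv_div, div_eq_mul_inv]
    norm_cast
  have h4 : 0 < X ^ (-10 : ℝ) := by positivity
  have h5 := Real.exp_pos 1
  calc _ ≤ _ := h
    _ ≤ Real.exp 1 * thetaSum k 1 * ((10).factorial * X ^ (-10 : ℝ)) :=
      mul_le_mul_of_nonneg_left h1 (by positivity)
    _ ≤ _ := by rw [add_mul]; nlinarith

lemma big_thetaSum_zero : Big (-1) fun X => thetaSum 0 X⁻¹ - π ^ 2 * X ^ 2 := by
  have h := (((big_npow 2).mul (big_thetaSum 0)).const_mul (π ^ 2)).mono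
    (show ((2 : ℕ) + -10 : ℝ) ≤ -1 by norm_num)
  refine h.congr fun X hX => ?_
  have : 0 < X := by linarith
  rw [thetaSum_zero_inv (inv_pos.2 this), div_inv_eq_mul]
  field_simp

lemma big_thetaSum_one : Big 0 fun X => thetaSum 1 X⁻¹ - 2 * π ^ 2 * X ^ 3 := by
  have h := (((big_npow 3).mul (big_thetaSum 0)).const_mul (2 * π ^ 2)).mono
    (show ((3 : ℕ) + -10 : ℝ) ≤ 0 by norm_num)
  have h2 := (((big_npow 4).mul (big_thetaSum 1)).const_mul (-π ^ 4)).mono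
    (show ((4 : ℕ) + -10 : ℝ) ≤ 0 by norm_num)
  refine (h.add h2).congr fun X hX => ?_
  have : 0 < X := by linarith
  rw [thetaSum_one_inv (inv_pos.2 this), div_inv_eq_mul]
  field_simp
  ring

lemma big_thetaSum_two : Big 1 fun X => thetaSum 2 X⁻¹ - 6 * π ^ 2 * X ^ 4 := by
  have h := (((big_npow 4).mul (big_thetaSum 0)).const_mul (6 * π ^ 2)).mono
    (show ((4 : ℕ) + -10 : ℝ) ≤ 1 by norm_num)
  have h2 := (((big_npow 5).mul (big_thetaSum 1)).const_mul (-6 * π ^ 4)).mono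
    (show ((5 : ℕ) + -10 : ℝ) ≤ 1 by norm_num)
  have h3 := (((big_npow 6).mul (big_thetaSum 2)).const_mul (π ^ 6)).mono
    (show ((6 : ℕ) + -10 : ℝ) ≤ 1 by norm_num)
  refine ((h.add h2).add h3).congr fun X hX => ?_
  have : 0 < X := by linarith
  rw [thetaSum_two_inv (inv_pos.2 this), div_inv_eq_mul]
  field_simp
  ring

end FourSq

namespace FourSq

/-- The sum over pairs in the Parseval identity, as a function of the smoothing parameter. -/
noncomputable def pairSum (X : ℝ) : ℝ :=
  ∑' p : ℕ × ℕ, r4 p.1 * r4 p.2 * Real.exp (-X⁻¹ * (max p.1 p.2 : ℕ))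

lemma sqrtCoeff_mul {X : ℝ} (hX : 0 < X) :
    4 * π ^ 2 * X ^ 2 * (sqrtCoeff * √(1 / (2 * π * X))) =
      C4' * Real.Gamma (5 / 2) * X ^ (3 / 2 : ℝ) := by
  have hp := Real.two_pi_pos
  have h1 : √(1 / (2 * π * X)) = (2 * π) ^ (-1 / 2 : ℝ) * X ^ (-1 / 2 : ℝ) := by
    rw [Real.sqrt_eq_rpow, one_div, ← Real.rpow_neg_one, ← Real.rpow_mul (by positivity),
      Real.mul_rpow hp.le hX.le]
    norm_num
  have h2 : X ^ (3 / 2 : ℝ) = X ^ 2 * X ^ (-1 / 2 : ℝ) := by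
    rw [← Real.rpow_natCast X 2, ← Real.rpow_add hX]
    norm_num
  have h3 : (2 * π) ^ (-5 / 2 : ℝ) * (2 * π) ^ (-1 / 2 : ℝ) = ((2 * π) ^ 3)⁻¹ := by
    rw [← Real.rpow_add hp, ← Real.rpow_natCast _ 3, ← Real.rpow_neg hp.le]
    norm_num
  rw [h1, h2, sqrtCoeff]
  calc _ = 4 * π ^ 2 * X ^ 2 * π⁻¹ * Real.Gamma (5 / 2) * (2 * π ^ 2 * C4') * X ^ (-1 / 2 : ℝ) *
        ((2 * π) ^ (-5 / 2 : ℝ) * (2 * π) ^ (-1 / 2 : ℝ)) := by ring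
    _ = _ := by
      rw [h3]
      field_simp
      ring

lemma big_pairSum {η : ℝ} (hη : 0 < η) (hη1 : η < 1) : Big (1 + η) fun X => pairSum X -
    (6 * π ^ 4 * X ^ 4 + 4 * π ^ 2 * X ^ 2 + C4' * Real.Gamma (5 / 2) * X ^ (3 / 2 : ℝ)) := by
  obtain ⟨C, hC, h⟩ := tsum_r4_max hη hη1
  have hp := Real.two_pi_pos
  refine ⟨4 * π ^ 2 * C * (2 * π) ^ (η - 1), by positivity, fun X hX => ?_⟩
  have hX0 : 0 < X := by linarith
  set y := 1 / (2 * π * X) with hy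
  have hy0 : 0 < y := by positivity
  have hy1 : y ≤ 1 := by
    rw [hy, div_le_one (by positivity)]
    nlinarith [Real.pi_gt_three]
  have h1 := h y hy0 hy1
  have e1 : 2 * π * y = X⁻¹ := by
    rw [hy]
    field_simp
  rw [e1] at h1
  change |y ^ 2 * pairSum X - _| ≤ _ at h1
  have e2 : 4 * π ^ 2 * X ^ 2 * y ^ 2 = 1 := by
    rw [hy]
    field_simp
    norm_num
  have e3 : 4 * π ^ 2 * X ^ 2 * (3 / (8 * y ^ 2)) = 6 * π ^ 4 * X ^ 4 := by
    rw [hy]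
    field_simp
    ring
  have e4 : pairSum X -
      (6 * π ^ 4 * X ^ 4 + 4 * π ^ 2 * X ^ 2 + C4' * Real.Gamma (5 / 2) * X ^ (3 / 2 : ℝ)) =
      4 * π ^ 2 * X ^ 2 * (y ^ 2 * pairSum X - (3 / (8 * y ^ 2) + 1 + sqrtCoeff * √y)) := by
    rw [← sqrtCoeff_mul hX0]
    linear_combination (-pairSum X) * e2 + e3
  have e5 : y ^ (1 - η) = (2 * π) ^ (η - 1) * X ^ (η - 1) := by
    rw [hy, one_div, Real.inv_rpow (by positivity), ← Real.rpow_neg (by positivity), neg_sub,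
      Real.mul_rpow hp.le hX0.le]
  have e6 : X ^ (1 + η) = X ^ 2 * X ^ (η - 1) := by
    rw [← Real.rpow_natCast X 2, ← Real.rpow_add hX0]
    congr 1
    push_cast
    ring
  beta_reduce
  rw [e4, abs_mul, abs_of_pos (by positivity : (0 : ℝ) < 4 * π ^ 2 * X ^ 2), e6]
  refine (mul_le_mul_of_nonneg_left h1 (by positivity)).trans (le_of_eq ?_)
  rw [e5]
  ring

lemma big_pairSum_mul {η : ℝ} (hη : 0 < η) (hη1 : η < 1) : Big (2 + η) fun X =>
    geo X⁻¹ * pairSum X - (6 * π ^ 4 * X ^ 5 + 3 * π ^ 4 * X ^ 4 + (π ^ 4 / 2 + 4 * π ^ 2) * X ^ 3 +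
      C4' * Real.Gamma (5 / 2) * X ^ (5 / 2 : ℝ)) := by
  set γ := C4' * Real.Gamma (5 / 2)
  have h1 : Big 1 fun X => X := by simpa using big_npow 1
  have h0 : Big 0 fun _ => 1 := by simpa using big_npow 0
  have hE := big_pairSum hη hη1
  have hL : Big 1 fun X => cgeo X - (X + X⁻¹ / 12) + (X + 1 / 2 * 1 + 1 / 12 * X⁻¹) :=
    (big_cgeo.mono (by norm_num)).add ((h1.add ((h0.const_mul _).mono (by norm_num))).add
      ((big_inv.const_mul _).mono (by norm_num)))
  have hT : Big 4 fun X => 6 * π ^ 4 * X ^ 4 + 4 * π ^ 2 * X ^ 2 + γ * X ^ (3 / 2 : ℝ) :=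
    (((big_npow 4).const_mul _).add (((big_npow 2).const_mul _).mono (by norm_num))).add
      (((big_rpow (3 / 2)).const_mul _).mono (by norm_num))
  have a1 := (hL.mul hE).mono (show 1 + (1 + η) ≤ 2 + η by linarith)
  have a2 := (big_cgeo.mul hT).mono (show -3 + 4 ≤ 2 + η by linarith)
  have a3 :=
    ((big_npow 2).const_mul (2 * π ^ 2)).mono (show ((2 : ℕ) : ℝ) ≤ 2 + η by norm_num; linarith)
  have a4 := ((big_rpow (3 / 2)).const_mul (γ / 2)).mono (show 3 / 2 ≤ 2 + η by linarith)
  have a5 := (h1.const_mul (π ^ 2 / 3)).mono (show 1 ≤ 2 + η by linarith)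
  have a6 := ((big_inv.mul (big_rpow (3 / 2))).const_mul (γ / 12)).mono
    (show -1 + 3 / 2 ≤ 2 + η by linarith)
  refine (((((a1.add a2).add a3).add a4).add a5).add a6).congr fun X hX => ?_
  have hX0 : 0 < X := by linarith
  have e : X ^ (5 / 2 : ℝ) = X * X ^ (3 / 2 : ℝ) := by
    rw [← Real.rpow_one_add' hX0.le (by norm_num)]
    norm_num
  rw [e, show geo X⁻¹ = cgeo X + 1 / 2 by rw [cgeo]; ring]
  field_simp
  ring

/-- The closed form of the sum `∑ n ^ 2 * latCount n * exp (-n / X)`. -/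
noncomputable def mixedSum (X : ℝ) : ℝ :=
  geo X⁻¹ * thetaSum 2 X⁻¹ + 2 * (geo X⁻¹ ^ 2 - geo X⁻¹) * thetaSum 1 X⁻¹ +
    (2 * geo X⁻¹ ^ 3 - 3 * geo X⁻¹ ^ 2 + geo X⁻¹) * thetaSum 0 X⁻¹

lemma mixedSum_eq (X : ℝ) : mixedSum X = (cgeo X + 1 / 2) * thetaSum 2 X⁻¹ +
    2 * (cgeo X ^ 2 - 1 / 4) * thetaSum 1 X⁻¹ + (2 * cgeo X ^ 3 - cgeo X / 2) * thetaSum 0 X⁻¹ := by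
  rw [mixedSum, cgeo]
  ring

lemma big_mixedSum : Big 2 fun X =>
    mixedSum X - π ^ 2 * (12 * X ^ 5 + 3 * X ^ 4 + 1 / 6 * X ^ 3) := by
  have h1 : Big 1 fun X => X := by simpa using big_npow 1
  have h0 : Big 0 fun _ => 1 := by simpa using big_npow 0
  have c1 := big_cgeo
  have c2 := big_cgeo_sq
  have c3 := big_cgeo_cube
  have t0 := big_thetaSum_zero
  have t1 := big_thetaSum_one
  have t2 := big_thetaSum_two
  have m1 : Big 1 fun X => cgeo X - (X + X⁻¹ / 12) + (X + 1 / 12 * X⁻¹ + 1 / 2 * 1) :=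
    (c1.mono (by norm_num)).add ((h1.add ((big_inv.const_mul _).mono (by norm_num))).add
      ((h0.const_mul _).mono (by norm_num)))
  have m2 : Big 2 fun X => cgeo X ^ 2 - (X ^ 2 + 1 / 6) + (X ^ 2 + (-1 / 12) * 1) :=
    (c2.mono (by norm_num)).add (((big_npow 2).mono (by norm_num)).add
      ((h0.const_mul _).mono (by norm_num)))
  have m3 : Big (-1) fun X => 2 * (cgeo X ^ 3 - (X ^ 3 + X / 4)) +
      (-1 / 2) * (cgeo X - (X + X⁻¹ / 12)) + (-1 / 24) * X⁻¹ :=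
    ((c3.const_mul _).add ((c1.const_mul _).mono (by norm_num))).add (big_inv.const_mul _)
  have m4 : Big 3 fun X => 2 * (cgeo X ^ 3 - (X ^ 3 + X / 4)) +
      (-1 / 2) * (cgeo X - (X + X⁻¹ / 12)) + (-1 / 24) * X⁻¹ + 2 * X ^ 3 :=
    (m3.mono (by norm_num)).add (((big_npow 3).const_mul _).mono (by norm_num))
  have a1 := (m1.mul t2).mono (show (1 + 1 : ℝ) ≤ 2 by norm_num)
  have a2 := ((m2.mul t1).const_mul 2).mono (show (2 + 0 : ℝ) ≤ 2 by norm_num)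
  have a3 := (m4.mul t0).mono (show (3 + -1 : ℝ) ≤ 2 by norm_num)
  have b1 := ((c1.mul (big_npow 4)).const_mul (6 * π ^ 2)).mono
    (show (-3 + (4 : ℕ) : ℝ) ≤ 2 by norm_num)
  have b2 := ((c2.mul (big_npow 3)).const_mul (4 * π ^ 2)).mono
    (show (-2 + (3 : ℕ) : ℝ) ≤ 2 by norm_num)
  have b3 := ((m3.mul (big_npow 2)).const_mul (π ^ 2)).mono
    (show (-1 + (2 : ℕ) : ℝ) ≤ 2 by norm_num)
  refine (((((a1.add a2).add a3).add b1).add b2).add b3).congr fun X hX => ?_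
  have hX0 : X ≠ 0 := by positivity
  rw [mixedSum_eq]
  field_simp
  ring

/-- The closed form of the sum `∑ n ^ 4 * exp (-n / X)`. -/
noncomputable def quarticSum (X : ℝ) : ℝ :=
  24 * geo X⁻¹ ^ 5 - 60 * geo X⁻¹ ^ 4 + 50 * geo X⁻¹ ^ 3 - 15 * geo X⁻¹ ^ 2 + geo X⁻¹

lemma big_quarticSum : Big 2 fun X => quarticSum X - 24 * X ^ 5 := by
  have h1 : Big 1 fun X => X := by simpa using big_npow 1
  have a1 := (big_cgeo_five.const_mul 24).mono (show (1 : ℝ) ≤ 2 by norm_num)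
  have a2 := (big_cgeo_cube.const_mul (-10)).mono (show (-1 : ℝ) ≤ 2 by norm_num)
  have a3 := big_cgeo.mono (show (-3 : ℝ) ≤ 2 by norm_num)
  have a4 := (h1.const_mul (-3 / 2)).mono (show (1 : ℝ) ≤ 2 by norm_num)
  have a5 := (big_inv.const_mul (1 / 12)).mono (show (-1 : ℝ) ≤ 2 by norm_num)
  refine ((((a1.add a2).add a3).add a4).add a5).congr fun X hX => ?_
  have hX0 : X ≠ 0 := by positivity
  rw [quarticSum, show geo X⁻¹ = cgeo X + 1 / 2 by rw [cgeo]; ring]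
  field_simp
  ring

lemma Ck_four_mul : Ck 4 * Real.Gamma 3 = 4 * π ^ 2 + π ^ 4 / 3 := by
  have hG2 : Real.Gamma 2 = 1 := by norm_num
  have hG3 : Real.Gamma 3 = 2 := by norm_num
  have hz2 : rzeta 2 = π ^ 2 / 6 := by
    rw [rzeta, Complex.ofReal_ofNat, riemannZeta_two]
    norm_cast
  have hz4 : rzeta 4 = π ^ 4 / 90 := by
    rw [rzeta, Complex.ofReal_ofNat, riemannZeta_four]
    norm_cast
  have e1 : (((4 : ℕ) : ℝ) - 2) = 2 := by norm_num
  have e2 : ((3 : ℝ) - (4 : ℕ)) = -1 := by norm_num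
  have e3 : ((4 : ℕ) : ℝ) / 2 = 2 := by norm_num
  have e4 : ((4 : ℕ) : ℝ) = 4 := by norm_num
  have e5 : (2 : ℝ) ^ (-4 : ℝ) = 1 / 16 := by
    rw [Real.rpow_neg two_pos.le]
    norm_num
  have e6 : π ^ (4 : ℝ) = π ^ 4 := by
    rw [← Real.rpow_natCast]
    norm_num
  rw [Ck, Vk_four, e1, e2, e3, e4, hG2, hG3, hz2, rzeta2, hz4, e5, e6, Real.rpow_neg_one]
  field_simp
  ring

lemma hasSum_Pk_sq {X : ℝ} (hX : 0 < X) :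
    HasSum (fun n : ℕ => Pk 4 ((n : ℝ) + 1) ^ 2 * Real.exp (-((n : ℝ) + 1) / X))
      (geo X⁻¹ * pairSum X - π ^ 2 * mixedSum X + π ^ 4 / 4 * quarticSum X - 1) := by
  have ht := inv_pos.2 hX
  have h := ((hasSum_latCount_sq_exp ht).sub ((hasSum_latCount_mul_exp ht).mul_left (π ^ 2))).add
    ((hasSum_pow_four_exp ht).mul_left (π ^ 4 / 4))
  rw [← hasSum_nat_add_iff' 1] at h
  have e0 : ∑ i ∈ Finset.range 1, (latCount i ^ 2 * Real.exp (-X⁻¹ * i) -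
      π ^ 2 * (latCount i * ((i : ℝ) ^ 2 * Real.exp (-X⁻¹ * i))) +
      π ^ 4 / 4 * ((i : ℝ) ^ 4 * Real.exp (-X⁻¹ * i))) = 1 := by
    simp [latCount, r4_zero]
  rw [e0] at h
  suffices hfun : (fun n : ℕ => Pk 4 ((n : ℝ) + 1) ^ 2 * Real.exp (-((n : ℝ) + 1) / X)) = _
    from hfun ▸ h
  funext n
  have e1 := Pk_four (n + 1)
  push_cast at e1 ⊢
  rw [e1, show -((n : ℝ) + 1) / X = -X⁻¹ * (n + 1) by ring]
  ring

end FourSq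

/-- smoothed second moment of the lattice point discrepancy in dimension 4. -/
theorem smooth_second_moment_dim_four :
    ∀ ε : ℝ, 0 < ε → ∃ A : ℝ, 0 < A ∧ ∀ X : ℝ, 2 ≤ X →
      Summable (fun n : ℕ => Pk 4 ((n : ℝ) + 1) ^ 2 * Real.exp (-((n : ℝ) + 1) / X)) ∧
      |(∑' n : ℕ, Pk 4 ((n : ℝ) + 1) ^ 2 * Real.exp (-((n : ℝ) + 1) / X))
          - Ck 4 * Real.Gamma 3 * X ^ (3 : ℝ)
          - C4' * Real.Gamma (5/2) * X ^ ((5 : ℝ)/2)|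
        ≤ A * X ^ ((2 : ℝ) + ε) := by
  intro ε hε
  obtain ⟨η, hη, hη1, hηε⟩ : ∃ η : ℝ, 0 < η ∧ η < 1 ∧ η ≤ ε :=
    ⟨min ε (1 / 2), by positivity, (min_le_right _ _).trans_lt (by norm_num), min_le_left _ _⟩
  have a1 := (FourSq.big_pairSum_mul hη hη1).mono (show 2 + η ≤ 2 + ε by linarith)
  have a2 := (FourSq.big_mixedSum.const_mul (-π ^ 2)).mono (show 2 ≤ 2 + ε by linarith)
  have a3 := (FourSq.big_quarticSum.const_mul (π ^ 4 / 4)).mono (show 2 ≤ 2 + ε by linarith)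
  have a4 :=
    ((FourSq.big_npow 0).const_mul (-1)).mono (show ((0 : ℕ) : ℝ) ≤ 2 + ε by norm_num; linarith)
  obtain ⟨A, hA, h⟩ := ((a1.add a2).add a3).add a4
  refine ⟨A, hA, fun X hX => ?_⟩
  have hs := FourSq.hasSum_Pk_sq (show 0 < X by linarith)
  refine ⟨hs.summable, (le_of_eq ?_).trans (h X hX)⟩
  rw [hs.tsum_eq, FourSq.Ck_four_mul, show X ^ (3 : ℝ) = X ^ 3 by norm_cast]
  congr 1
  ring
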